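/- Let F ∈ ℤ[x₁,…,xₙ] be an incomplete norm form of degree d > n ≥ 2 with non-zero discriminant, let k ≥ 2 satisfy k ≥ (d−2)/n, let ξ₁ = ξ₁(B) = max{1, C₄ log₂B/(4(n+1)(k−1)log₃B)} for a suitable constant C₄ > 0, and set ξ₂ = Bⁿ(log B)^{2/3}. Define N₃(B) = #{x ∈ ℤⁿ : |xᵢ| ≤ B for all i, there exists a prime p > ξ₂ with pᵏ | F(x), F(x) is indivisible by p² for every prime ξ₁ < p ≤ ξ₂, and every prime p with pᵏ | F(x) satisfies p > ξ₁}. Then N₃(B) = o(Bⁿ) as B → ∞. -/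

import Mathlib

open MvPolynomial Filter Pointwise

noncomputable section

/-- The linear form with coefficient vector `c`. -/
def linForm {R : Type*} [CommRing R] {n : ℕ} (c : Fin n → R) : MvPolynomial (Fin n) R :=
  ∑ i, C (c i) * X i

/-- `ρ_F(m)`: the number of zeros of `F` in `(ℤ/mℤ)ⁿ`. -/
def rhoF {n : ℕ} (F : MvPolynomial (Fin n) ℤ) (m : ℕ) : ℕ :=
  Nat.card {a : Fin n → ZMod m // MvPolynomial.eval a (F.map (Int.castRingHom (ZMod m))) = 0}

/-- The discriminant `Δ(F) = ∏_{i₁<⋯<iₙ} |det(L_{i₁},…,L_{iₙ})|`, the product being over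
all `n`-element subsets of the linear factors (parametrized by strictly monotone maps). -/
def discProd {n d : ℕ} (L : Fin d → Fin n → ℂ) : ℝ :=
  ∏ᶠ g ∈ {g : Fin n → Fin d | StrictMono g},
    norm (Matrix.det (Matrix.of fun i j => L (g i) j))

/-- `F` is a decomposable form with linear factors `L₁,…,L_d` having
algebraic-integer coefficients. -/
def IsDecomp {n d : ℕ} (F : MvPolynomial (Fin n) ℤ) (L : Fin d → Fin n → ℂ) : Prop :=
  (∀ j i, IsIntegral ℤ (L j i)) ∧ F.map (Int.castRingHom ℂ) = ∏ j, linForm (L j)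

/-- An integer is `k`-free if it is divisible by no `k`-th power of a prime. -/
def KFree (k : ℕ) (N : ℤ) : Prop := ∀ p : ℕ, p.Prime → ¬ ((p : ℤ) ^ k ∣ N)

/-- `N_{F,k}(B)`. -/
def NFk {n : ℕ} (F : MvPolynomial (Fin n) ℤ) (k : ℕ) (B : ℝ) : ℕ :=
  Set.ncard {x : Fin n → ℤ | (∀ i, |(x i : ℝ)| ≤ B) ∧ KFree k (MvPolynomial.eval x F)}

def log1 (x : ℝ) : ℝ := max 1 (Real.log x)
def log2 (x : ℝ) : ℝ := log1 (log1 x)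
def log3 (x : ℝ) : ℝ := log1 (log2 x)

/-- `ξ₁` is eventually increasing, tends to infinity and is `O(log₂ B / log₃ B)`. -/
def Xi1Good (ξ₁ : ℝ → ℝ) : Prop :=
  (∃ B₀ : ℝ, ∀ ⦃B B' : ℝ⦄, B₀ ≤ B → B ≤ B' → ξ₁ B ≤ ξ₁ B') ∧
  Tendsto ξ₁ atTop atTop ∧ (ξ₁ =O[atTop] fun B => log2 B / log3 B)

def xi2 (n : ℕ) (B : ℝ) : ℝ := B ^ n * Real.log B ^ ((2 : ℝ) / 3)

def xi3 (C₁ : ℝ) (k : ℕ) (B : ℝ) : ℝ := C₁ * B ^ 2 * Real.log B ^ (-(2 * (k : ℝ)) / 3)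

/-- `C(ξ₁) = ∏_{p ≤ ξ₁} p^{k-1}`. -/
def Cxi (k : ℕ) (ξ : ℝ) : ℕ := ∏ᶠ p ∈ {p : ℕ | p.Prime ∧ (p : ℝ) ≤ ξ}, p ^ (k - 1)

/-- `𝒟(u₂) = ∏ p` over primes `ξ₁ < p ≤ (1/12)log(B²/u₂)`, `p ∤ u₂`, `p ≡ 1 (mod k)`. -/
def scrD (k : ℕ) (ξ₁ B : ℝ) (u₂ : ℕ) : ℕ :=
  ∏ᶠ p ∈ {p : ℕ | p.Prime ∧ ξ₁ < (p : ℝ) ∧ (p : ℝ) ≤ Real.log (B ^ 2 / (u₂ : ℝ)) / 12 ∧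
      ¬ p ∣ u₂ ∧ p % k = 1}, p

/-- The set `𝒮_p ⊆ 𝔽_pⁿ` attached to a factorization `F = F*·∏𝓛ᵢ` over `ℤ_p`. -/
def Sp {n : ℕ} (p : ℕ) (hp : p.Prime) {τ : ℕ}
    (𝓛 : Fin τ → Fin n → @PadicInt p ⟨hp⟩)
    (Fstar : MvPolynomial (Fin n) (@PadicInt p ⟨hp⟩)) (x : Fin n → ZMod p) : Prop :=
  (∃ i j : Fin τ, i < j ∧ (∑ m, (@PadicInt.toZMod p ⟨hp⟩) (𝓛 i m) * x m) = 0 ∧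
      (∑ m, (@PadicInt.toZMod p ⟨hp⟩) (𝓛 j m) * x m) = 0) ∨
  MvPolynomial.eval x (Fstar.map (@PadicInt.toZMod p ⟨hp⟩)) = 0

/-- The data `(𝓛ᵢ, F*)` is a factorization of `F` over `ℤ_p` with `F*` having no
linear factor over `ℚ_p`. -/
def IsPadicFact {n : ℕ} (F : MvPolynomial (Fin n) ℤ) (p : ℕ) (hp : p.Prime) {τ : ℕ}
    (𝓛 : Fin τ → Fin n → @PadicInt p ⟨hp⟩)
    (Fstar : MvPolynomial (Fin n) (@PadicInt p ⟨hp⟩)) : Prop :=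
  F.map (Int.castRingHom (@PadicInt p ⟨hp⟩)) = Fstar * ∏ i, linForm (𝓛 i) ∧
  ∀ c : Fin n → @Padic p ⟨hp⟩, (∃ i, c i ≠ 0) →
    ¬ (linForm c ∣ Fstar.map (@PadicInt.Coe.ringHom p ⟨hp⟩))


-- τ_F(p) intrinsically: number of linear factors of F mod p up to scaling
def tauFp {n : ℕ} (F : MvPolynomial (Fin n) ℤ) (p : ℕ) : ℕ :=
  Nat.card {c : Fin n → ZMod p //
    (∃ i, c i = 1 ∧ ∀ j, j < i → c j = 0) ∧
    linForm c ∣ F.map (Int.castRingHom (ZMod p))}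

def tauF {n : ℕ} (F : MvPolynomial (Fin n) ℤ) (m : ℕ) : ℕ :=
  ∏ p ∈ m.primeFactors, tauFp F p

def sigmaPow (α : ℝ) (m : ℕ) : ℝ := ∑ s ∈ m.divisors, (s : ℝ) ^ α

-- sup norm / lattice minimum / lattice point count
def supNorm {n : ℕ} (x : Fin n → ℤ) : ℕ := Finset.univ.sup fun i => (x i).natAbs

def latMin {n : ℕ} (Λ : AddSubgroup (Fin n → ℤ)) : ℕ :=
  sInf {m : ℕ | ∃ x ∈ Λ, x ≠ 0 ∧ supNorm x = m}

def NLat {n : ℕ} (Λ : AddSubgroup (Fin n → ℤ)) (B : ℝ) : ℕ :=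
  Set.ncard {x : Fin n → ℤ | x ∈ Λ ∧ ∀ i, |(x i : ℝ)| ≤ B}

-- the H_{u₁,u₂}(B) count
def Hcount {n : ℕ} (F : MvPolynomial (Fin n) ℤ)
    {τ : ∀ p : ℕ, p.Prime → ℕ}
    (𝓛 : ∀ (p : ℕ) (hp : p.Prime), Fin (τ p hp) → Fin n → @PadicInt p ⟨hp⟩)
    (Fstar : ∀ (p : ℕ) (hp : p.Prime), MvPolynomial (Fin n) (@PadicInt p ⟨hp⟩))
    (k u₁ u₂ D : ℕ) (B : ℝ) : ℕ :=
  Set.ncard {m : Fin n → ℤ | (∀ i, |(m i : ℝ)| ≤ B) ∧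
    (u₁ : ℤ) ∣ MvPolynomial.eval m F ∧ (u₂ : ℤ) ∣ MvPolynomial.eval m F ∧
    (∃ s : ℕ, s < D ∧ (D : ℤ) ∣ (MvPolynomial.eval m F - (u₁ : ℤ) * u₂ * (s : ℤ) ^ k)) ∧
    ∀ (p : ℕ) (hp : p.Prime), p ∣ u₁ * u₂ →
      ¬ Sp p hp (𝓛 p hp) (Fstar p hp) (fun i => ((m i : ZMod p)))}

-- N₃(B)
def N3count {n : ℕ} (F : MvPolynomial (Fin n) ℤ) (k : ℕ) (ξ₁ ξ₂ B : ℝ) : ℕ :=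
  Set.ncard {x : Fin n → ℤ | (∀ i, |(x i : ℝ)| ≤ B) ∧
    (∃ p : ℕ, p.Prime ∧ ξ₂ < (p : ℝ) ∧ (p : ℤ) ^ k ∣ MvPolynomial.eval x F) ∧
    (∀ p : ℕ, p.Prime → ξ₁ < (p : ℝ) → (p : ℝ) ≤ ξ₂ → ¬ ((p : ℤ) ^ 2 ∣ MvPolynomial.eval x F)) ∧
    (∀ p : ℕ, p.Prime → (p : ℤ) ^ k ∣ MvPolynomial.eval x F → ξ₁ < (p : ℝ))}

-- N₃*(B)
def N3starCount {n : ℕ}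
    {τ : ∀ p : ℕ, p.Prime → ℕ}
    (𝓛 : ∀ (p : ℕ) (hp : p.Prime), Fin (τ p hp) → Fin n → @PadicInt p ⟨hp⟩)
    (Fstar : ∀ (p : ℕ) (hp : p.Prime), MvPolynomial (Fin n) (@PadicInt p ⟨hp⟩))
    (ξ₁ B : ℝ) : ℕ :=
  Set.ncard {x : Fin n → ℤ | (∀ i, |(x i : ℝ)| ≤ B) ∧
    ∃ (p : ℕ) (hp : p.Prime), ξ₁ < (p : ℝ) ∧
      Sp p hp (𝓛 p hp) (Fstar p hp) (fun i => ((x i : ZMod p)))}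

-- N₃†(B)
def N3dag {n : ℕ} (F : MvPolynomial (Fin n) ℤ)
    {τ : ∀ p : ℕ, p.Prime → ℕ}
    (𝓛 : ∀ (p : ℕ) (hp : p.Prime), Fin (τ p hp) → Fin n → @PadicInt p ⟨hp⟩)
    (Fstar : ∀ (p : ℕ) (hp : p.Prime), MvPolynomial (Fin n) (@PadicInt p ⟨hp⟩))
    (k : ℕ) (ξ₁ ξ₂ B : ℝ) : ℕ :=
  Set.ncard {x : Fin n → ℤ | (∀ i, |(x i : ℝ)| ≤ B) ∧
    ∃ (u : ℤ) (q : ℕ), q.Prime ∧ ξ₂ < (q : ℝ) ∧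
      MvPolynomial.eval x F = u * (q : ℤ) ^ k ∧
      (∀ p : ℕ, p.Prime → (p : ℝ) ≤ ξ₁ → ¬ ((p : ℤ) ^ k ∣ u)) ∧
      (∀ p : ℕ, p.Prime → ξ₁ < (p : ℝ) → (p : ℝ) ≤ ξ₂ → ¬ ((p : ℤ) ^ 2 ∣ u)) ∧
      (∀ (p : ℕ) (hp : p.Prime), (p : ℤ) ∣ u →
        ¬ Sp p hp (𝓛 p hp) (Fstar p hp) (fun i => ((x i : ZMod p))))}

-- ℛ_l : congruence classes mod l = u₁u₂D
def Rset {n : ℕ} (F : MvPolynomial (Fin n) ℤ)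
    {τ : ∀ p : ℕ, p.Prime → ℕ}
    (𝓛 : ∀ (p : ℕ) (hp : p.Prime), Fin (τ p hp) → Fin n → @PadicInt p ⟨hp⟩)
    (Fstar : ∀ (p : ℕ) (hp : p.Prime), MvPolynomial (Fin n) (@PadicInt p ⟨hp⟩))
    (k u₁ u₂ D : ℕ) : Set (Fin n → ZMod (u₁ * u₂ * D)) :=
  {m | ∃ a : Fin n → ℤ, (∀ i, ((a i : ZMod (u₁ * u₂ * D))) = m i) ∧
    (u₁ : ℤ) ∣ MvPolynomial.eval a F ∧ (u₂ : ℤ) ∣ MvPolynomial.eval a F ∧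
    (∃ s : ℕ, s < D ∧ (D : ℤ) ∣ (MvPolynomial.eval a F - (u₁ : ℤ) * u₂ * (s : ℤ) ^ k)) ∧
    ∀ (p : ℕ) (hp : p.Prime), p ∣ u₁ * u₂ →
      ¬ Sp p hp (𝓛 p hp) (Fstar p hp) (fun i => ((a i : ZMod p)))}

-- exponential sum E_ℛ(t; l)
def Esum {n l : ℕ} (R : Set (Fin n → ZMod l)) (t : Fin n → ℤ) : ℂ :=
  ∑ᶠ a ∈ R, Complex.exp (-(2 * Real.pi * Complex.I) *
    (∑ i, ((a i).val : ℂ) * (t i : ℂ)) / (l : ℂ))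

def Mplus {n : ℕ} (l : ℕ) (R : Set (Fin n → ZMod l)) (B : ℝ) : ℝ :=
  (3 * B) ^ n * R.ncard / (l : ℝ) ^ n

def Mpp {n : ℕ} (l : ℕ) (R : Set (Fin n → ZMod l)) (B : ℝ) : ℝ :=
  B ^ n / (l : ℝ) ^ n *
    ∑ᶠ t ∈ {t : Fin n → ℤ | t ≠ 0 ∧ ∀ i, |(t i : ℝ)| ≤ (l : ℝ) / B},
      norm (Esum R t)

-- S(t; p)
def Ssum {n : ℕ} (p : ℕ) (hp : p.Prime) {τ : ℕ}
    (𝓛 : Fin τ → Fin n → @PadicInt p ⟨hp⟩) (t : Fin n → ℤ) : ℂ :=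
  ∑ i : Fin τ,
    ∑ᶠ a ∈ {a : Fin n → ZMod p | (∑ m, (@PadicInt.toZMod p ⟨hp⟩) (𝓛 i m) * a m) = 0},
      Complex.exp ((2 * Real.pi * Complex.I) *
        (∑ m, ((a m).val : ℂ) * (t m : ℂ)) / (p : ℂ))

-- |S(t; l)| for squarefree l
def SabsSF {n : ℕ} {τ : ∀ p : ℕ, p.Prime → ℕ}
    (𝓛 : ∀ (p : ℕ) (hp : p.Prime), Fin (τ p hp) → Fin n → @PadicInt p ⟨hp⟩)
    (l : ℕ) (t : Fin n → ℤ) : ℝ :=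
  ∏ p ∈ l.primeFactors.attach,
    norm (Ssum p.1 (Nat.prime_of_mem_primeFactors p.2)
      (𝓛 p.1 (Nat.prime_of_mem_primeFactors p.2)) t)

-- admissible u₂'s
def U2set (ξ₁ ξ₂ ξ₃ : ℝ) : Set ℕ :=
  {u | 0 < u ∧ (u : ℝ) ≤ ξ₃ ∧ Squarefree u ∧
    ∀ p ∈ u.primeFactors, ξ₁ < (p : ℝ) ∧ (p : ℝ) ≤ ξ₂}


-- extra defs for theorems

/-- `N₄(B)` from Lemma N4B. -/
def N4sum {n : ℕ} (F : MvPolynomial (Fin n) ℤ)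
    {τ : ∀ p : ℕ, p.Prime → ℕ}
    (𝓛 : ∀ (p : ℕ) (hp : p.Prime), Fin (τ p hp) → Fin n → @PadicInt p ⟨hp⟩)
    (Fstar : ∀ (p : ℕ) (hp : p.Prime), MvPolynomial (Fin n) (@PadicInt p ⟨hp⟩))
    (k : ℕ) (C₁ : ℝ) (ξ₁ : ℝ → ℝ) (B : ℝ) : ℝ :=
  ∑ᶠ u₁ ∈ {u₁ : ℕ | u₁ ∣ Cxi k (ξ₁ B)},
    ∑ᶠ u₂ ∈ U2set (ξ₁ B) (xi2 n B) (xi3 C₁ k B),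
      Mplus (u₁ * u₂ * scrD k (ξ₁ B) B u₂)
        (Rset F 𝓛 Fstar k u₁ u₂ (scrD k (ξ₁ B) B u₂)) B /
        (k : ℝ) ^ (scrD k (ξ₁ B) B u₂).primeFactors.card

/-- the inner truncated sum `Σ'_{|tᵢ|≤Y} |S(t;u₂)|`. -/
def Ssumbox {n : ℕ} {τ : ∀ p : ℕ, p.Prime → ℕ}
    (𝓛 : ∀ (p : ℕ) (hp : p.Prime), Fin (τ p hp) → Fin n → @PadicInt p ⟨hp⟩)
    (u₂ : ℕ) (Y : ℝ) : ℝ :=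
  ∑ᶠ t ∈ {t : Fin n → ℤ | t ≠ 0 ∧ ∀ i, |(t i : ℝ)| ≤ Y}, SabsSF 𝓛 u₂ t

/-- `Q` restricted to a set of `u₂`'s. -/
def QUgen {n : ℕ} {τ : ∀ p : ℕ, p.Prime → ℕ}
    (𝓛 : ∀ (p : ℕ) (hp : p.Prime), Fin (τ p hp) → Fin n → @PadicInt p ⟨hp⟩)
    (S : Set ℕ) (B : ℝ) : ℝ :=
  ∑ᶠ u₂ ∈ S, (1 / (u₂ : ℝ) ^ n) *
    Ssumbox 𝓛 u₂ ((u₂ : ℝ) ^ ((9 : ℝ) / 10) / B ^ ((4 : ℝ) / 5))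

/-- `l* = ∏_{p ≤ Ξ, p | u₂} p`. -/
def lstar (u₂ : ℕ) (Ξ : ℝ) : ℕ :=
  ∏ᶠ p ∈ {p : ℕ | p.Prime ∧ p ∣ u₂ ∧ (p : ℝ) ≤ Ξ}, p

/-- A function on `ℤ` bounded by `1` with zero sum over all intervals of length `q` has all sums over
intervals bounded by `q`. -/
lemma abs_sum_Ico_le_of_periodic (h : ℤ → ℝ) (q : ℕ) (hq : 0 < q)
    (hb : ∀ t, |h t| ≤ 1)
    (hz : ∀ t0 : ℤ, ∑ i ∈ Finset.range q, h (t0 + i) = 0) (N : ℕ) (t0 : ℤ) :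
    |∑ i ∈ Finset.range N, h (t0 + i)| ≤ q := by
  induction N using Nat.strong_induction_on generalizing t0 with
  | _ N ih =>
    by_cases hN : N < q
    · calc _ ≤ ∑ i ∈ Finset.range N, |h (t0 + i)| := Finset.abs_sum_le_sum_abs _ _
        _ ≤ ∑ i ∈ Finset.range N, (1 : ℝ) := Finset.sum_le_sum fun i _ => hb _
        _ ≤ q := by simp; exact hN.le
    · push Not at hN
      obtain ⟨m, rfl⟩ := Nat.exists_eq_add_of_le hN
      rw [Finset.sum_range_add, hz, zero_add]
      have := ih m (by omega) (t0 + q)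
      convert this using 3 with i
      congr 1
      push_cast; ring

lemma sum_range_zmod (q : ℕ) [NeZero q] (g : ZMod q → ℝ) (t0 : ℤ) :
    ∑ i ∈ Finset.range q, g ((t0 + i : ℤ) : ZMod q) = ∑ z, g z := by
  rw [← Equiv.sum_comp (Equiv.addLeft (t0 : ZMod q)) g]
  refine Finset.sum_bij' (fun (i : ℕ) _ => (i : ZMod q)) (fun z _ => z.val) ?_ ?_ ?_ ?_ ?_
  · simp
  · intro z _; simpa using ZMod.val_lt z
  · intro i hi; simp at hi; exact ZMod.val_cast_of_lt hi
  · intro z _; simp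
  · intro i _; simp

lemma sum_range_mul_zmod (p q : ℕ) [NeZero p] [NeZero q] (hpq : p.Coprime q)
    (f : ZMod p → ℝ) (g : ZMod q → ℝ) (t0 : ℤ) :
    ∑ i ∈ Finset.range (p * q), f ((t0 + i : ℤ) : ZMod p) * g ((t0 + i : ℤ) : ZMod q)
      = (∑ z, f z) * ∑ z, g z := by
  have : NeZero (p * q) := ⟨mul_ne_zero (NeZero.ne p) (NeZero.ne q)⟩
  have h := sum_range_zmod (p * q)
    (fun z => f (ZMod.chineseRemainder hpq z).1 * g (ZMod.chineseRemainder hpq z).2) t0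
  simp only [map_intCast, Prod.fst_intCast, Prod.snd_intCast] at h
  rw [h, Finset.sum_mul_sum, ← Fintype.sum_prod_type (fun z : ZMod p × ZMod q => f z.1 * g z.2)]
  exact Equiv.sum_comp (ZMod.chineseRemainder hpq).toEquiv
    (fun z : ZMod p × ZMod q => f z.1 * g z.2)

/-- A second-moment (Turán) sieve: integers of an interval of length `N` avoiding a third of the
residue classes modulo each prime of `S`. -/
lemma turan_sieve (S : Finset ℕ) (hS : ∀ p ∈ S, p.Prime) (P : ℝ) (hP : ∀ p ∈ S, (p : ℝ) ≤ P)
    (hne : S.Nonempty) (N : ℕ) (A : Finset ℕ) (hA : A ⊆ Finset.range N)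
    (Ω : ∀ p : ℕ, Finset (ZMod p)) (hΩ : ∀ p ∈ S, 3 * (Ω p).card ≤ 2 * p)
    (h : ∀ p ∈ S, ∀ t ∈ A, (t : ZMod p) ∈ Ω p) :
    (A.card : ℝ) ≤ 9 * (N / S.card + P ^ 2) := by
  classical
  set g : ∀ p : ℕ, ZMod p → ℝ := fun p z => (if z ∈ Ω p then 1 else 0) - (Ω p).card / p with hg
  have hθ : ∀ p ∈ S, ((Ω p).card : ℝ) / p ≤ 2 / 3 := by
    intro p hp
    have hp0 : (0 : ℝ) < p := by exact_mod_cast (hS p hp).pos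
    rw [div_le_div_iff₀ hp0 (by norm_num)]
    have := hΩ p hp
    have h2 : (3 : ℝ) * (Ω p).card ≤ 2 * p := by exact_mod_cast this
    linarith
  have hθ0 : ∀ p : ℕ, (0 : ℝ) ≤ (Ω p).card / p := fun p => by positivity
  have hgb : ∀ p ∈ S, ∀ z, |g p z| ≤ 1 := by
    intro p hp z
    have h1 := hθ p hp
    have h2 := hθ0 p
    simp only [hg]
    rw [abs_le]
    split_ifs <;> constructor <;> linarith
  have hgz : ∀ p ∈ S, ∀ [NeZero p], ∑ z, g p z = 0 := by
    intro p hp _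
    have hp0 : (p : ℝ) ≠ 0 := by exact_mod_cast (hS p hp).ne_zero
    simp only [hg, Finset.sum_sub_distrib, Finset.sum_const, Finset.card_univ, ZMod.card,
      nsmul_eq_mul]
    rw [mul_div_cancel₀ _ hp0]
    simp
  set r := S.card with hr
  have hr0 : (0 : ℝ) < r := by exact_mod_cast hne.card_pos
  have hP0 : 0 ≤ P := by
    obtain ⟨p, hp⟩ := hne
    exact (Nat.cast_nonneg p).trans (hP p hp)
  set Xf : ℕ → ℝ := fun t => ∑ p ∈ S, g p (t : ZMod p) with hX
  have hlow : ∀ t ∈ A, (r : ℝ) / 3 ≤ Xf t := by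
    intro t ht
    have : ∑ p ∈ S, (1 / 3 : ℝ) ≤ Xf t := by
      apply Finset.sum_le_sum
      intro p hp
      simp only [hg, if_pos (h p hp t ht)]
      linarith [hθ p hp]
    simpa [div_eq_mul_inv] using this
  have hpair : ∀ p ∈ S, ∀ q ∈ S, p ≠ q →
      ∑ t ∈ Finset.range N, g p (t : ZMod p) * g q (t : ZMod q) ≤ P ^ 2 := by
    intro p hp q hq hpq
    have : NeZero p := ⟨(hS p hp).ne_zero⟩
    have : NeZero q := ⟨(hS q hq).ne_zero⟩
    have hco : p.Coprime q := (Nat.coprime_primes (hS p hp) (hS q hq)).2 hpq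
    have key := abs_sum_Ico_le_of_periodic
      (fun t : ℤ => g p (t : ZMod p) * g q (t : ZMod q)) (p * q)
      (Nat.mul_pos (hS p hp).pos (hS q hq).pos)
      (by
        intro t
        rw [abs_mul]
        exact mul_le_one₀ (hgb p hp _) (abs_nonneg _) (hgb q hq _))
      (by
        intro t0
        rw [sum_range_mul_zmod p q hco (g p) (g q) t0, hgz p hp, zero_mul]) N 0
    simp only [zero_add, Int.cast_natCast] at key
    calc _ ≤ _ := le_abs_self _
      _ ≤ _ := key
      _ ≤ P ^ 2 := by
        push_cast
        rw [sq]
        exact mul_le_mul (hP p hp) (hP q hq) (Nat.cast_nonneg _) hP0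
  have hup : ∑ t ∈ Finset.range N, Xf t ^ 2 ≤ r * N + r ^ 2 * P ^ 2 := by
    have e1 : ∑ t ∈ Finset.range N, Xf t ^ 2 = ∑ p ∈ S, ∑ q ∈ S,
        ∑ t ∈ Finset.range N, g p (t : ZMod p) * g q (t : ZMod q) := by
      simp only [hX, sq, Finset.sum_mul_sum]
      rw [Finset.sum_comm]
      apply Finset.sum_congr rfl
      intro p _
      rw [Finset.sum_comm]
    rw [e1]
    calc _ ≤ ∑ p ∈ S, ∑ q ∈ S, ((if p = q then (N : ℝ) else 0) + P ^ 2) := by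
          apply Finset.sum_le_sum; intro p hp
          apply Finset.sum_le_sum; intro q hq
          split_ifs with hpq
          · subst hpq
            have : ∑ t ∈ Finset.range N, g p (t : ZMod p) * g p (t : ZMod p) ≤
                ∑ t ∈ Finset.range N, (1 : ℝ) := by
              apply Finset.sum_le_sum
              intro t _
              have h1 := abs_le.1 (hgb p hp (t : ZMod p))
              nlinarith [h1.1, h1.2]
            simp at this
            nlinarith [sq_nonneg P]
          · simpa using hpair p hp q hq hpq
      _ = r * N + r ^ 2 * P ^ 2 := by
          simp only [Finset.sum_add_distrib, Finset.sum_ite_eq, Finset.sum_const, nsmul_eq_mul]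
          simp [← hr]
          ring
  have hlow2 : (A.card : ℝ) * (r / 3) ^ 2 ≤ ∑ t ∈ Finset.range N, Xf t ^ 2 := by
    calc (A.card : ℝ) * (r / 3) ^ 2 = ∑ t ∈ A, ((r : ℝ) / 3) ^ 2 := by simp
      _ ≤ ∑ t ∈ A, Xf t ^ 2 := Finset.sum_le_sum fun t ht =>
          pow_le_pow_left₀ (by positivity) (hlow t ht) 2
      _ ≤ _ := Finset.sum_le_sum_of_subset_of_nonneg hA fun _ _ _ => sq_nonneg _
  have h3 := hlow2.trans hup
  have e : r * N + r ^ 2 * P ^ 2 = (r : ℝ) ^ 2 * (N / r + P ^ 2) := by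
    field_simp
  rw [e] at h3
  have h4 : (r : ℝ) ^ 2 * A.card ≤ r ^ 2 * (9 * (N / r + P ^ 2)) := by nlinarith
  exact le_of_mul_le_mul_left h4 (by positivity)

/-- The elements `z` of a field of `p ≥ 3` elements which are pairwise `k`-th-power equivalent are
few as soon as there is a nontrivial `k`-th root of unity. -/
lemma three_mul_card_le_of_kpow (p : ℕ) [Fact p.Prime] (hp : 3 ≤ p) (k : ℕ) (hk : 1 ≤ k)
    (z : ZMod p) (hz : z ^ k = 1) (hz1 : z ≠ 1) (V : Finset (ZMod p))
    (hV : ∀ x ∈ V, ∀ y ∈ V, ∃ w, x * y ^ (k - 1) = w ^ k) :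
    3 * V.card ≤ 2 * p := by
  classical
  by_cases h0 : ∃ y ∈ V, y ≠ 0
  · obtain ⟨y, hy, hy0⟩ := h0
    set T : Finset (ZMod p) := (Finset.univ.erase 0).image (fun w : ZMod p => w ^ k) with hT
    have hTcard : 2 * T.card ≤ p - 1 := by
      have h1 : (Finset.univ.erase (0 : ZMod p)).card = p - 1 := by
        rw [Finset.card_erase_of_mem (Finset.mem_univ _), Finset.card_univ, ZMod.card]
      rw [← h1]
      apply Finset.mul_card_image_le_card
      intro b hb
      simp only [Finset.mem_image, Finset.mem_erase, Finset.mem_univ, and_true] at hb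
      obtain ⟨w, hw, rfl⟩ := hb
      have hz0 : z ≠ 0 := by
        rintro rfl
        rw [zero_pow (by omega)] at hz
        exact zero_ne_one hz
      have hsub : ({w, z * w} : Finset (ZMod p)) ⊆
          (Finset.univ.erase (0 : ZMod p)).filter (fun a => a ^ k = w ^ k) := by
        intro a ha
        simp only [Finset.mem_insert, Finset.mem_singleton] at ha
        rcases ha with rfl | rfl
        · simp [hw]
        · simp [hw, hz0, mul_pow, hz]
      calc 2 = ({w, z * w} : Finset (ZMod p)).card := by
            rw [Finset.card_pair]
            intro h
            apply hz1
            have : (z - 1) * w = 0 := by linear_combination -h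
            rcases mul_eq_zero.1 this with h | h
            · linear_combination h
            · exact absurd h hw
        _ ≤ _ := Finset.card_le_card hsub
    have hsub : V ⊆ insert 0 (T.image (fun t => t * (y ^ (k - 1))⁻¹)) := by
      intro x hx
      rw [Finset.mem_insert]
      by_cases hx0 : x = 0
      · exact Or.inl hx0
      · right
        obtain ⟨w, hw⟩ := hV x hx y hy
        have hyk : y ^ (k - 1) ≠ 0 := pow_ne_zero _ hy0
        rw [Finset.mem_image]
        refine ⟨w ^ k, ?_, ?_⟩
        · rw [hT, Finset.mem_image]
          refine ⟨w, ?_, rfl⟩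
          simp only [Finset.mem_erase, Finset.mem_univ, and_true]
          rintro rfl
          rw [zero_pow (by omega)] at hw
          exact mul_ne_zero hx0 hyk hw
        · rw [← hw]; field_simp
    have hc := (Finset.card_le_card hsub).trans (Finset.card_insert_le _ _)
    have hc2 : (T.image (fun t => t * (y ^ (k - 1))⁻¹)).card ≤ T.card := Finset.card_image_le
    omega
  · push Not at h0
    have : V ⊆ {0} := fun x hx => Finset.mem_singleton.2 (h0 x hx)
    have := Finset.card_le_card this
    simp at this
    omega

/-- Sieving along the direction `v`: a set `A` whose translates along `v` stay in `Y`, and whose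
images under linear maps to `ZMod p` not killing `v` avoid a third of the classes, is small
compared with `Y`. -/
lemma row_sieve {G : Type*} [AddCommGroup G] [DecidableEq G] (S : Finset ℕ)
    (hS : ∀ p ∈ S, p.Prime) (P : ℝ) (hP : ∀ p ∈ S, (p : ℝ) ≤ P) (hne : S.Nonempty)
    (φ : ∀ p : ℕ, G →+ ZMod p) (v : G) (hφv : ∀ p ∈ S, φ p v ≠ 0)
    (A Y : Finset G) (N : ℕ) (hN : 0 < N)
    (hY : ∀ x ∈ A, ∀ m < N, x + m • v ∈ Y)
    (hΩ : ∀ p ∈ S, 3 * (A.image (φ p)).card ≤ 2 * p) :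
    (A.card : ℝ) ≤ 9 * Y.card * (1 / S.card + P ^ 2 / N) := by
  classical
  have hrow : ∀ y ∈ Y, (((Finset.range N).filter (fun m => y - m • v ∈ A)).card : ℝ)
      ≤ 9 * (N / S.card + P ^ 2) := by
    intro y _
    have key := turan_sieve S hS P hP hne N ((Finset.range N).filter (fun m => y - m • v ∈ A))
      (Finset.filter_subset _ _)
      (fun p => (A.image (φ p)).image (fun w => (φ p y - w) * (φ p v)⁻¹))
      (fun p hp => (Nat.mul_le_mul_left 3 Finset.card_image_le).trans (hΩ p hp))
      (by
        intro p hp t ht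
        have := Fact.mk (hS p hp)
        simp only [Finset.mem_filter] at ht
        rw [Finset.mem_image]
        refine ⟨φ p (y - t • v), Finset.mem_image_of_mem _ ht.2, ?_⟩
        have := hφv p hp
        rw [map_sub, map_nsmul, nsmul_eq_mul]
        field_simp
        ring)
    exact key
  have hcount : (N : ℝ) * A.card ≤
      ∑ y ∈ Y, (((Finset.range N).filter (fun m => y - m • v ∈ A)).card : ℝ) := by
    have h1 : (A ×ˢ Finset.range N).card ≤
        (Y.sigma (fun y => (Finset.range N).filter (fun m => y - m • v ∈ A))).card := by
      apply Finset.card_le_card_of_injOn (fun x => ⟨x.1 + x.2 • v, x.2⟩)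
      · rintro ⟨x, m⟩ hx
        simp only [Finset.coe_product, Set.mem_prod, Finset.mem_coe, Finset.mem_range] at hx
        simp only [Finset.coe_sigma, Set.mem_sigma_iff, Finset.mem_coe, Finset.mem_filter,
          Finset.mem_range]
        exact ⟨hY x hx.1 m hx.2, hx.2, by simpa using hx.1⟩
      · rintro ⟨x, m⟩ _ ⟨x', m'⟩ _ h
        simp only [Sigma.mk.injEq, heq_eq_eq] at h
        obtain ⟨h1, rfl⟩ := h
        simpa using h1
    rw [Finset.card_product, Finset.card_range, Finset.card_sigma, mul_comm] at h1
    exact_mod_cast h1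
  have h2 := hcount.trans (Finset.sum_le_sum hrow)
  rw [Finset.sum_const, nsmul_eq_mul] at h2
  have hN' : (0 : ℝ) < N := by exact_mod_cast hN
  have e : (Y.card : ℝ) * (9 * (N / S.card + P ^ 2)) =
      N * (9 * Y.card * (1 / S.card + P ^ 2 / N)) := by
    field_simp
  rw [e] at h2
  exact le_of_mul_le_mul_left h2 hN'

/-- An upper bound of Mertens type. -/
lemma sum_log_div_prime_le (n : ℕ) (hn : 1 ≤ n) :
    ∑ p ∈ (Finset.Icc 1 n).filter Nat.Prime, Real.log p / p ≤ Real.log n + Real.log 4 := by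
  set S := (Finset.Icc 1 n).filter Nat.Prime with hS
  have hSp : ∀ p ∈ S, p.Prime := fun p hp => (Finset.mem_filter.1 hp).2
  have hdvd : ∏ p ∈ S, p ^ (n / p) ∣ n.factorial := by
    apply Finset.prod_dvd_of_isRelPrime
    · intro p hp q hq hpq
      exact Nat.coprime_iff_isRelPrime.1 (Nat.Coprime.pow _ _
        ((Nat.coprime_primes (hSp p hp) (hSp q hq)).2 hpq))
    · intro p hp
      rw [(hSp p hp).pow_dvd_factorial_iff (b := n + 1) (by
        exact lt_of_le_of_lt (Nat.log_le_self _ _) (by omega))]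
      calc n / p = n / p ^ 1 := by simp
        _ ≤ _ := Finset.single_le_sum (f := fun i => n / p ^ i) (fun i _ => Nat.zero_le _)
            (by simp; omega)
  have h1 : ∑ p ∈ S, ((n / p : ℕ) : ℝ) * Real.log p ≤ n * Real.log n := by
    have := Nat.le_of_dvd (Nat.factorial_pos n) hdvd
    have h2 : ∏ p ∈ S, p ^ (n / p) ≤ n ^ n := this.trans (Nat.factorial_le_pow n)
    have h3 : (∏ p ∈ S, (p : ℝ) ^ (n / p)) ≤ (n : ℝ) ^ n := by exact_mod_cast h2
    have h4 := Real.log_le_log (Finset.prod_pos fun p hp => by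
      have := (hSp p hp).pos
      positivity) h3
    rw [Real.log_prod (fun p hp => by
      have := (hSp p hp).pos
      positivity), Real.log_pow] at h4
    simpa [Real.log_pow] using h4
  have h2 : ∑ p ∈ S, Real.log p ≤ Real.log 4 * n := by
    have := Chebyshev.theta_le_log4_mul_x (x := n) (Nat.cast_nonneg n)
    rw [Chebyshev.theta_eq_sum_Icc] at this
    refine le_trans (Finset.sum_le_sum_of_subset_of_nonneg ?_ ?_) this
    · intro p
      simp +contextual [hS]
    · intro p hp _
      exact Real.log_natCast_nonneg p
  have hn0 : (0 : ℝ) < n := by exact_mod_cast hn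
  have h3 : n * ∑ p ∈ S, Real.log p / p ≤ n * (Real.log n + Real.log 4) := by
    have : n * ∑ p ∈ S, Real.log p / p ≤
        ∑ p ∈ S, ((n / p : ℕ) : ℝ) * Real.log p + ∑ p ∈ S, Real.log p := by
      rw [Finset.mul_sum, ← Finset.sum_add_distrib]
      apply Finset.sum_le_sum
      intro p hp
      have hf : (n : ℝ) / p ≤ (n / p : ℕ) + 1 := by
        rw [← Nat.floor_div_eq_div (K := ℝ)]
        exact (Nat.lt_floor_add_one _).le
      calc (n : ℝ) * (Real.log p / p) = n / p * Real.log p := by ring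
        _ ≤ ((n / p : ℕ) + 1) * Real.log p :=
            mul_le_mul_of_nonneg_right hf (Real.log_natCast_nonneg p)
        _ = _ := by ring
    nlinarith
  exact le_of_mul_le_mul_left h3 hn0

/-- The sum of `log p / p` over any `r` primes. -/
lemma sum_log_div_le_of_card (S : Finset ℕ) (hS : ∀ p ∈ S, p.Prime) (r : ℕ) (hr : 3 ≤ r)
    (hSr : S.card ≤ r) :
    ∑ p ∈ S, Real.log p / p ≤ 2 * Real.log r + Real.log 4 := by
  classical
  have hr0 : (0 : ℝ) < r := by positivity
  rw [← Finset.sum_filter_add_sum_filter_not S (fun p => p ≤ r)]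
  have h1 : ∑ p ∈ S.filter (fun p => p ≤ r), Real.log p / p ≤ Real.log r + Real.log 4 := by
    refine le_trans (Finset.sum_le_sum_of_subset_of_nonneg ?_ ?_)
      (sum_log_div_prime_le r (by omega))
    · intro p hp
      simp only [Finset.mem_filter, Finset.mem_Icc] at hp ⊢
      exact ⟨⟨(hS p hp.1).one_le, hp.2⟩, hS p hp.1⟩
    · intro p _ _
      exact div_nonneg (Real.log_natCast_nonneg p) (Nat.cast_nonneg p)
  have h2 : ∑ p ∈ S.filter (fun p => ¬ p ≤ r), Real.log p / p ≤ Real.log r := by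
    have he : Real.exp 1 ≤ r := by
      have : (3 : ℝ) ≤ r := by exact_mod_cast hr
      linarith [Real.exp_one_lt_d9]
    calc _ ≤ ∑ p ∈ S.filter (fun p => ¬ p ≤ r), Real.log r / r := by
          apply Finset.sum_le_sum
          intro p hp
          have hp2 : r < p := by simpa using (Finset.mem_filter.1 hp).2
          have hp3 : (r : ℝ) ≤ p := by exact_mod_cast hp2.le
          exact Real.log_div_self_antitoneOn he (he.trans hp3) hp3
      _ = (S.filter (fun p => ¬ p ≤ r)).card * (Real.log r / r) := by simp
      _ ≤ r * (Real.log r / r) := by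
          apply mul_le_mul_of_nonneg_right
          · exact_mod_cast (Finset.card_filter_le _ _).trans hSr
          · exact div_nonneg (Real.log_natCast_nonneg r) (Nat.cast_nonneg r)
      _ = Real.log r := by field_simp
  linarith

lemma sum_Icc_pow_le (x : ℝ) (hx : 0 ≤ x) (hx2 : x ≤ 1 / 2) (J : ℕ) :
    ∑ j ∈ Finset.Icc 1 J, x ^ j ≤ 2 * x := by
  have : ∑ j ∈ Finset.Icc 1 J, x ^ j + 2 * x ^ (J + 1) ≤ 2 * x := by
    induction J with
    | zero => simp
    | succ J ih =>
      rw [Finset.sum_Icc_succ_top (by omega)]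
      have : x ^ (J + 1 + 1) ≤ x ^ (J + 1) / 2 := by
        rw [pow_succ]
        nlinarith [pow_nonneg hx (J + 1)]
      linarith
  have h2 : 0 ≤ x ^ (J + 1) := pow_nonneg hx _
  linarith

lemma log_le_sum_prime_pow (n : ℕ) (hn : n ≠ 0) (S : Finset ℕ) (hS : n.primeFactors ⊆ S)
    (J : ℕ → ℕ) (hJ : ∀ p ∈ n.primeFactors, n < p ^ (J p + 1)) :
    Real.log n ≤ ∑ p ∈ S, ∑ j ∈ Finset.Icc 1 (J p), if p ^ j ∣ n then Real.log p else 0 := by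
  have h1 : Real.log n = ∑ p ∈ n.primeFactors, (n.factorization p : ℝ) * Real.log p := by
    conv_lhs => rw [← Nat.prod_factorization_pow_eq_self hn]
    rw [Finsupp.prod, Nat.support_factorization]
    push_cast
    rw [Real.log_prod (fun p hp => by
      have := (Nat.prime_of_mem_primeFactors hp).pos
      positivity)]
    simp [Real.log_pow]
  rw [h1]
  refine le_trans ?_ (Finset.sum_le_sum_of_subset_of_nonneg hS ?_)
  · apply Finset.sum_le_sum
    intro p hp
    have hpp := Nat.prime_of_mem_primeFactors hp
    have hv : n.factorization p ≤ J p := by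
      by_contra hlt
      push Not at hlt
      have h2 : p ^ (J p + 1) ∣ n :=
        (pow_dvd_pow p hlt).trans (Nat.ordProj_dvd n p)
      exact absurd (Nat.le_of_dvd (Nat.pos_of_ne_zero hn) h2) (not_le.2 (hJ p hp))
    rw [← Finset.sum_filter, Finset.sum_const, nsmul_eq_mul]
    apply mul_le_mul_of_nonneg_right _ (Real.log_natCast_nonneg p)
    have : Finset.Icc 1 (n.factorization p) ⊆
        (Finset.Icc 1 (J p)).filter (fun j => p ^ j ∣ n) := by
      intro j hj
      simp only [Finset.mem_Icc, Finset.mem_filter] at hj ⊢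
      exact ⟨⟨hj.1, hj.2.trans hv⟩, (pow_dvd_pow p hj.2).trans (Nat.ordProj_dvd n p)⟩
    have := Finset.card_le_card this
    rw [Nat.card_Icc, Nat.add_sub_cancel] at this
    exact_mod_cast this
  · intro p _ _
    apply Finset.sum_nonneg
    intro j _
    split_ifs
    · exact Real.log_natCast_nonneg p
    · exact le_rfl

/-- A sequence of polynomial growth with the divisor distribution of a polynomial has many prime
divisors. -/
lemma many_prime_divisors (h : ℕ → ℕ) (g : ℕ) (hg : 1 ≤ g) (C : ℝ) (hC : 1 ≤ C)
    (h0 : ∀ t, 1 ≤ t → h t ≠ 0) (hlow : ∀ t : ℕ, 1 ≤ t → (t : ℝ) ≤ C * h t)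
    (hup : ∀ t : ℕ, 1 ≤ t → (h t : ℝ) ≤ C * (t : ℝ) ^ g)
    (hcount : ∀ T p j : ℕ, p.Prime → 1 ≤ j →
      (((Finset.Icc 1 T).filter (fun t => p ^ j ∣ h t)).card : ℝ) ≤ g * ((T : ℝ) / p ^ j + 1)) :
    ∃ T₀ : ℕ, ∀ T : ℕ, T₀ ≤ T → (T : ℝ) ^ (1 / (32 * g) : ℝ) ≤
      ((Finset.Icc 1 T).biUnion (fun t => (h t).primeFactors)).card := by
  have hg0 : (1 : ℝ) ≤ g := by exact_mod_cast hg
  set κ : ℝ := 1 / (32 * g) with hκ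
  have hκ0 : 0 < κ := by positivity
  have hκ1 : κ ≤ 1 / 32 := by
    rw [hκ, div_le_div_iff₀ (by positivity) (by norm_num)]; linarith
  have hl : Filter.Tendsto (fun T : ℝ => Real.log T) Filter.atTop Filter.atTop :=
    Real.tendsto_log_atTop
  have hbig1 : ∀ᶠ T : ℝ in Filter.atTop, 3 ≤ T ^ κ :=
    (tendsto_rpow_atTop hκ0).eventually_ge_atTop 3
  have hbig2 : ∀ᶠ T : ℝ in Filter.atTop, 2 * (1 + Real.log C + 2 * g * Real.log 4 + 1) < Real.log T :=
    hl.eventually_gt_atTop _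
  have hbig3 : ∀ᶠ T : ℝ in Filter.atTop, g * Real.log C + g ^ 2 * Real.log T ≤ T ^ (1 / 2 : ℝ) := by
    have h1 : (fun T : ℝ => g * Real.log C + g ^ 2 * Real.log T) =o[Filter.atTop]
        (fun T : ℝ => T ^ (1 / 2 : ℝ)) := by
      apply Asymptotics.IsLittleO.add
      · apply Asymptotics.isLittleO_const_left.2
        right
        exact tendsto_norm_atTop_atTop.comp (tendsto_rpow_atTop (by norm_num))
      · exact (isLittleO_log_rpow_atTop (by norm_num)).const_mul_left _
    filter_upwards [h1.bound (c := 1) one_pos, Filter.eventually_ge_atTop 0] with T hT hT0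
    rw [one_mul, Real.norm_of_nonneg (Real.rpow_nonneg hT0 _)] at hT
    exact (le_abs_self _).trans hT
  obtain ⟨T₁, hT₁⟩ := Filter.eventually_atTop.1 (hbig1.and (hbig2.and
    (hbig3.and (Filter.eventually_ge_atTop 1))))
  refine ⟨⌈T₁⌉₊, fun T hT => ?_⟩
  obtain ⟨hb1, hb2, hb3, hT1⟩ := hT₁ T ((Nat.le_ceil T₁).trans (by exact_mod_cast hT))
  set S := (Finset.Icc 1 T).biUnion (fun t => (h t).primeFactors) with hS
  by_contra hlt
  push Not at hlt
  have hSp : ∀ p ∈ S, p.Prime := by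
    intro p hp
    simp only [hS, Finset.mem_biUnion] at hp
    obtain ⟨t, _, ht⟩ := hp
    exact Nat.prime_of_mem_primeFactors ht
  have hTpos : (0 : ℝ) < T := by linarith
  set Q : ℕ := ⌊C * (T : ℝ) ^ g⌋₊ with hQ
  have hQ1 : Q ≠ 0 := by
    have h1 : (1 : ℝ) ≤ C * (T : ℝ) ^ g := one_le_mul_of_one_le_of_one_le hC (one_le_pow₀ hT1)
    have : 0 < ⌊C * (T : ℝ) ^ g⌋₊ := Nat.floor_pos.2 h1
    omega
  set r := max S.card 3 with hr
  have hrT : (r : ℝ) ≤ (T : ℝ) ^ κ := by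
    rw [hr]; push_cast
    exact max_le hlt.le hb1
  have hr3 : (3 : ℝ) ≤ r := by rw [hr]; exact_mod_cast le_max_right _ _
  -- the lower bound
  have hlower : T * Real.log T - T - T * Real.log C ≤
      ∑ t ∈ Finset.Icc 1 T, Real.log (h t) := by
    have h1 : ∑ t ∈ Finset.Icc 1 T, (Real.log t - Real.log C) ≤
        ∑ t ∈ Finset.Icc 1 T, Real.log (h t) := by
      apply Finset.sum_le_sum
      intro t ht
      have ht1 := (Finset.mem_Icc.1 ht).1
      have hht : (0 : ℝ) < h t := by
        exact_mod_cast Nat.pos_of_ne_zero (h0 t ht1)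
      have := Real.log_le_log (by exact_mod_cast (ht1 : 0 < t)) (hlow t ht1)
      rw [Real.log_mul (by linarith) hht.ne'] at this
      linarith
    have h2 : ∑ t ∈ Finset.Icc 1 T, Real.log t = Real.log (T.factorial) := by
      have e : Finset.Icc 1 T = Finset.Ico 1 (T + 1) := by
        ext; simp
      rw [e, ← Finset.prod_Ico_id_eq_factorial]
      push_cast
      rw [Real.log_prod]
      intro t ht
      have := (Finset.mem_Ico.1 ht).1
      positivity
    have h3 : T * Real.log T - T ≤ Real.log (T.factorial) := by
      have h4 := Real.pow_div_factorial_le_exp (T : ℝ) hTpos.le T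
      have h5 := Real.log_le_log (by positivity) h4
      rw [Real.log_exp, Real.log_div (by positivity) (by positivity), Real.log_pow] at h5
      linarith
    rw [Finset.sum_sub_distrib, h2] at h1
    simp at h1
    linarith
  -- the upper bound
  have hupper : ∑ t ∈ Finset.Icc 1 T, Real.log (h t) ≤
      g * (2 * T * (2 * Real.log r + Real.log 4) + r * (Real.log C + g * Real.log T)) := by
    have hht : ∀ t ∈ Finset.Icc 1 T, h t ≤ Q := by
      intro t ht
      rw [Finset.mem_Icc] at ht
      apply Nat.le_floor
      refine (hup t ht.1).trans ?_
      have : (t : ℝ) ≤ T := by exact_mod_cast ht.2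
      gcongr
    calc _ ≤ ∑ t ∈ Finset.Icc 1 T, ∑ p ∈ S, ∑ j ∈ Finset.Icc 1 (Nat.log p Q),
            (if p ^ j ∣ h t then Real.log p else 0) := by
          apply Finset.sum_le_sum
          intro t ht
          have ht1 := (Finset.mem_Icc.1 ht).1
          exact log_le_sum_prime_pow (h t) (h0 t ht1) S
            (Finset.subset_biUnion_of_mem (fun t => (h t).primeFactors) ht)
            (fun p => Nat.log p Q) (fun p hp => (hht t ht).trans_lt
              (Nat.lt_pow_succ_log_self (Nat.prime_of_mem_primeFactors hp).one_lt Q))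
      _ = ∑ p ∈ S, ∑ j ∈ Finset.Icc 1 (Nat.log p Q),
            ∑ t ∈ Finset.Icc 1 T, (if p ^ j ∣ h t then Real.log p else 0) := by
          rw [Finset.sum_comm]
          apply Finset.sum_congr rfl
          intro p _
          rw [Finset.sum_comm]
      _ ≤ ∑ p ∈ S, ∑ j ∈ Finset.Icc 1 (Nat.log p Q), g * ((T : ℝ) / p ^ j + 1) * Real.log p := by
          apply Finset.sum_le_sum; intro p hp
          apply Finset.sum_le_sum; intro j hj
          rw [← Finset.sum_filter, Finset.sum_const, nsmul_eq_mul]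
          exact mul_le_mul_of_nonneg_right (hcount T p j (hSp p hp) (Finset.mem_Icc.1 hj).1)
            (Real.log_natCast_nonneg p)
      _ ≤ ∑ p ∈ S, g * (2 * T * (Real.log p / p) + (Real.log C + g * Real.log T)) := by
          apply Finset.sum_le_sum; intro p hp
          have hpp := hSp p hp
          have hp2 : (2 : ℝ) ≤ p := by exact_mod_cast hpp.two_le
          have hlp := Real.log_natCast_nonneg p
          have e : ∑ j ∈ Finset.Icc 1 (Nat.log p Q), g * ((T : ℝ) / p ^ j + 1) * Real.log p
              = g * (T * Real.log p * ∑ j ∈ Finset.Icc 1 (Nat.log p Q), ((1 : ℝ) / p) ^ j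
                + Nat.log p Q * Real.log p) := by
            rw [Finset.mul_sum, mul_add, Finset.mul_sum]
            have : (g : ℝ) * (Nat.log p Q * Real.log p) =
                ∑ j ∈ Finset.Icc 1 (Nat.log p Q), g * Real.log p := by
              simp; ring
            rw [this, ← Finset.sum_add_distrib]
            apply Finset.sum_congr rfl
            intro j _
            rw [div_pow, one_pow]; ring
          rw [e]
          have h1 := sum_Icc_pow_le ((1 : ℝ) / p) (by positivity)
            (one_div_le_one_div_of_le (by norm_num) hp2) (Nat.log p Q)
          have h2 : (Nat.log p Q : ℝ) * Real.log p ≤ Real.log C + g * Real.log T := by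
            have h3 : p ^ Nat.log p Q ≤ Q := Nat.pow_log_le_self p hQ1
            have h4 : (p : ℝ) ^ Nat.log p Q ≤ C * (T : ℝ) ^ g := by
              have h3' : ((p ^ Nat.log p Q : ℕ) : ℝ) ≤ Q := Nat.cast_le.2 h3
              push_cast at h3'
              exact h3'.trans (Nat.floor_le (by positivity))
            have h5 := Real.log_le_log (by positivity) h4
            rwa [Real.log_pow, Real.log_mul (by positivity) (by positivity), Real.log_pow] at h5
          apply mul_le_mul_of_nonneg_left _ (by positivity)
          apply add_le_add _ h2
          calc _ ≤ T * Real.log p * (2 * (1 / p)) := by gcongr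
            _ = _ := by ring
      _ = g * (2 * T * ∑ p ∈ S, (Real.log p / p) + S.card * (Real.log C + g * Real.log T)) := by
          rw [← Finset.mul_sum, Finset.sum_add_distrib, ← Finset.mul_sum, Finset.sum_const,
            nsmul_eq_mul]
      _ ≤ _ := by
          have h1 := sum_log_div_le_of_card S hSp r (le_max_right _ _) (le_max_left _ _)
          have h2 : (S.card : ℝ) ≤ r := by exact_mod_cast le_max_left S.card 3
          have h3 : 0 ≤ Real.log C := Real.log_nonneg hC
          have h4 : 0 ≤ Real.log T := Real.log_nonneg hT1
          gcongr
  have hfin := hlower.trans hupper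
  have hlr : Real.log r ≤ κ * Real.log T := by
    have := Real.log_le_log (by positivity) hrT
    rwa [Real.log_rpow hTpos] at this
  have hlast : g * (r * (Real.log C + g * Real.log T)) ≤ T := by
    have h3 : 0 ≤ Real.log C := Real.log_nonneg hC
    have h4 : 0 ≤ Real.log T := Real.log_nonneg hT1
    calc (g : ℝ) * (r * (Real.log C + g * Real.log T))
        = r * (g * Real.log C + g ^ 2 * Real.log T) := by ring
      _ ≤ (T : ℝ) ^ (1 / 2 : ℝ) * (T : ℝ) ^ (1 / 2 : ℝ) := by
          apply mul_le_mul _ hb3 (by positivity) (by positivity)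
          refine hrT.trans (Real.rpow_le_rpow_of_exponent_le hT1 (by linarith))
      _ = T := by rw [← Real.rpow_add hTpos]; norm_num
  have hκg : (g : ℝ) * κ = 1 / 32 := by rw [hκ]; field_simp
  have h6 : (g : ℝ) * (2 * T * (2 * Real.log r)) ≤ T * Real.log T / 8 := by
    calc (g : ℝ) * (2 * T * (2 * Real.log r)) = 4 * T * g * Real.log r := by ring
      _ ≤ 4 * T * g * (κ * Real.log T) := by gcongr
      _ = 4 * T * (g * κ) * Real.log T := by ring
      _ = _ := by rw [hκg]; ring
  have h7 : T * (2 * (1 + Real.log C + 2 * g * Real.log 4 + 1)) < T * Real.log T :=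
    mul_lt_mul_of_pos_left hb2 hTpos
  have h8 : 0 ≤ T * Real.log T := mul_nonneg hTpos.le (Real.log_nonneg hT1)
  linarith

open NumberField in
/-- A number field has an integral polynomial whose roots modulo almost all primes are simple and
give residue fields of degree one. -/
lemma exists_poly_of_numberField (M : Type*) [Field M] [NumberField M] :
    ∃ (f : Polynomial ℤ) (R : ℤ), f.Monic ∧ 1 ≤ f.natDegree ∧ R ≠ 0 ∧
      ∀ (p : ℕ), p.Prime → ¬ ((p : ℤ) ∣ R) → ∀ s : ℤ, (p : ℤ) ∣ f.eval s →
        Nonempty (𝓞 M →+* ZMod p) ∧ ¬ ((p : ℤ) ∣ f.derivative.eval s) := by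
  obtain ⟨α, hα⟩ := Field.exists_primitive_element ℚ M
  obtain ⟨m, hm0, hm⟩ := exists_integral_multiples ℤ ℚ ({α} : Finset M)
  have hm := hm α (by simp)
  have hm0' : (m : ℚ) ≠ 0 := by exact_mod_cast hm0
  obtain ⟨θ, hθM⟩ : ∃ θ : 𝓞 M, algebraMap (𝓞 M) M θ = (m : ℚ) • α := by
    refine ⟨⟨m • α, hm⟩, ?_⟩
    change m • α = _
    rw [Algebra.smul_def, Algebra.smul_def]; simp
  have hadj : Algebra.adjoin ℚ {algebraMap (𝓞 M) M θ} = ⊤ := by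
    have h1 : IntermediateField.adjoin ℚ {algebraMap (𝓞 M) M θ} = ⊤ := by
      rw [eq_top_iff, ← hα, IntermediateField.adjoin_simple_le_iff]
      have h2 : algebraMap (𝓞 M) M θ ∈ IntermediateField.adjoin ℚ {algebraMap (𝓞 M) M θ} :=
        IntermediateField.mem_adjoin_simple_self _ _
      have h3 : α = (m : ℚ)⁻¹ • algebraMap (𝓞 M) M θ := by
        rw [hθM, smul_smul, inv_mul_cancel₀ hm0', one_smul]
      have h4 := IntermediateField.smul_mem _ h2 (x := (m : ℚ)⁻¹)
      rwa [← h3] at h4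
    rw [← IntermediateField.adjoin_simple_toSubalgebra_of_isAlgebraic
      (Algebra.IsAlgebraic.isAlgebraic _), h1]
    rfl
  have hcond := conductor_mul_differentIdeal ℤ ℚ M θ hadj
  set f := minpoly ℤ θ with hf
  have hint : IsIntegral ℤ θ := RingOfIntegers.isIntegral θ
  set D := Polynomial.aeval θ f.derivative with hD
  have hD0 : D ≠ 0 := by
    have h1 := (Algebra.IsSeparable.isSeparable ℚ (algebraMap (𝓞 M) M θ)).aeval_derivative_ne_zero
      (minpoly.aeval ℚ (algebraMap (𝓞 M) M θ))
    rw [minpoly.isIntegrallyClosed_eq_field_fractions ℚ M hint,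
      Polynomial.derivative_map, Polynomial.aeval_map_algebraMap,
      Polynomial.aeval_algebraMap_apply] at h1
    intro h
    exact h1 (by rw [← hf, ← hD, h, map_zero])
  have hDc : D ∈ conductor ℤ θ := by
    have : D ∈ conductor ℤ θ * differentIdeal ℤ (𝓞 M) := by
      rw [hcond]; exact Ideal.mem_span_singleton_self D
    have hle : conductor ℤ θ * differentIdeal ℤ (𝓞 M) ≤ conductor ℤ θ := Ideal.mul_le_left
    exact hle this
  set R := Ideal.absNorm (Ideal.span {D}) with hR
  have hDdvd : D ∣ (R : 𝓞 M) := Ideal.mem_span_singleton.1 (Ideal.absNorm_mem _)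
  have hR0 : R ≠ 0 := by
    rw [hR, Ne, Ideal.absNorm_eq_zero_iff, Ideal.span_singleton_eq_bot]
    exact hD0
  refine ⟨f, R, minpoly.monic hint, (minpoly.natDegree_pos hint), by exact_mod_cast hR0, ?_⟩
  intro p hp hpR s hs
  have : Fact p.Prime := ⟨hp⟩
  have hexp : ¬ p ∣ RingOfIntegers.exponent θ := by
    intro h
    apply hpR
    refine (Int.natCast_dvd_natCast.2 h).trans ?_
    rw [RingOfIntegers.exponent, ← Ideal.mem_span_singleton, Int.ideal_span_absNorm_eq_self,
      Ideal.mem_comap]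
    obtain ⟨w, hw⟩ := hDdvd
    rw [map_natCast, hw]
    exact Ideal.mul_mem_right _ _ hDc
  let e := RingOfIntegers.ZModXQuotSpanEquivQuotSpan hexp
  let ev : (Polynomial (ZMod p) ⧸ Ideal.span {Polynomial.map (Int.castRingHom (ZMod p)) f}) →+* ZMod p :=
    Ideal.Quotient.lift _ (Polynomial.evalRingHom (s : ZMod p)) (by
      intro a ha
      obtain ⟨b, rfl⟩ := Ideal.mem_span_singleton'.1 ha
      have : (Polynomial.map (Int.castRingHom (ZMod p)) f).eval (s : ZMod p) = 0 := by
        have h1 := Polynomial.eval_map_apply (Int.castRingHom (ZMod p)) s (p := f)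
        rw [eq_intCast] at h1
        rw [h1]
        exact (ZMod.intCast_zmod_eq_zero_iff_dvd _ _).2 hs
      simp [this])
  let ψ : 𝓞 M →+* ZMod p := ev.comp (e.symm.toRingHom.comp (Ideal.Quotient.mk _))
  have hψ : ∀ Q : Polynomial ℤ, ψ (Polynomial.aeval θ Q) = ((Q.eval s : ℤ) : ZMod p) := by
    intro Q
    have h1 := RingOfIntegers.ZModXQuotSpanEquivQuotSpan_mk_apply hexp Q
    change ev (e.symm (Ideal.Quotient.mk _ (Polynomial.aeval θ Q))) = _
    rw [← h1, RingEquiv.symm_apply_apply]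
    change Polynomial.eval (s : ZMod p) _ = _
    have h1 := Polynomial.eval_map_apply (Int.castRingHom (ZMod p)) s (p := Q)
    rwa [eq_intCast] at h1
  refine ⟨⟨ψ⟩, fun hd => ?_⟩
  have h2 : ψ D = 0 := by
    rw [hD, hψ]; exact (ZMod.intCast_zmod_eq_zero_iff_dvd _ _).2 hd
  apply hpR
  rw [← ZMod.intCast_zmod_eq_zero_iff_dvd]
  have h3 := map_dvd ψ hDdvd
  rw [h2, zero_dvd_iff] at h3
  simpa using h3

lemma card_filter_le_of_forall_modEq (T m : ℕ) (A : Finset ℕ) (hA : A ⊆ Finset.Icc 1 T)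
    (h : ∀ t ∈ A, ∀ t' ∈ A, (m : ℤ) ∣ (t' : ℤ) - t) : A.card ≤ T / m + 1 := by
  rw [← Finset.card_range (T / m + 1)]
  apply Finset.card_le_card_of_injOn (fun t => t / m)
  · intro t ht
    have := (Finset.mem_Icc.1 (hA ht)).2
    simp only [Finset.coe_range, Set.mem_Iio]
    exact Nat.lt_succ_of_le (Nat.div_le_div_right this)
  · intro t ht t' ht' hdiv
    have h1 := h t ht t' ht'
    have h2 : t % m = t' % m := by
      have : t ≡ t' [MOD m] := (Nat.modEq_iff_dvd).2 h1
      exact this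
    rw [← Nat.div_add_mod t m, ← Nat.div_add_mod t' m, h2]
    simp only at hdiv
    rw [hdiv]

/-- Polynomials whose roots modulo primes are simple have values with many prime divisors. -/
lemma exists_many_primes_of_poly (f : Polynomial ℤ) (R : ℤ) (hmon : f.Monic)
    (hdeg : 1 ≤ f.natDegree) (hR : R ≠ 0)
    (hder : ∀ (p : ℕ), p.Prime → ¬ ((p : ℤ) ∣ R) → ∀ s : ℤ, (p : ℤ) ∣ f.eval s →
      ¬ ((p : ℤ) ∣ f.derivative.eval s)) :
    ∃ (C : ℝ) (T₀ : ℕ), 1 ≤ C ∧ ∀ T : ℕ, T₀ ≤ T → ∃ S : Finset ℕ,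
      (T : ℝ) ^ (1 / (32 * f.natDegree) : ℝ) ≤ S.card ∧
      ∀ p ∈ S, p.Prime ∧ (p : ℝ) ≤ C * (T : ℝ) ^ f.natDegree ∧ ¬ ((p : ℤ) ∣ R) ∧
        ∃ s : ℤ, (p : ℤ) ∣ f.eval s := by
  obtain ⟨c, hc⟩ : ∃ c : ℤ, f.eval c ≠ 0 := by
    by_contra hcon
    push Not at hcon
    exact hmon.ne_zero (Polynomial.funext (by simpa using hcon))
  set a := f.eval c with ha
  set D := 2 * R * a with hD
  have hD0 : D ≠ 0 := by positivity
  let s : ℕ → ℤ := fun t => c + a * D * t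
  have hw : ∀ t : ℕ, ∃ w : ℤ, f.eval (s t) = a * (1 + D * t * w) := by
    intro t
    obtain ⟨w, hw⟩ := Polynomial.sub_dvd_eval_sub (s t) c f
    refine ⟨w, ?_⟩
    simp only [s] at hw ⊢
    linear_combination hw
  choose w hw using hw
  let h : ℕ → ℕ := fun t => (1 + D * t * w t).natAbs
  have hcast : ∀ t, ((h t : ℕ) : ℝ) = |((f.eval (s t) : ℤ) : ℝ)| / |(a : ℝ)| := by
    intro t
    rw [hw]
    push_cast
    rw [abs_mul, mul_div_cancel_left₀ _ (by positivity)]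
    simp [h]
  have h0 : ∀ t, h t ≠ 0 := by
    intro t ht
    have h1 : (1 + D * t * w t) = 0 := Int.natAbs_eq_zero.1 ht
    have h2 : (2 : ℤ) ∣ 1 := by
      refine ⟨- (R * a * t * w t), ?_⟩
      rw [hD] at h1; linear_combination h1
    norm_num at h2
  have hpD : ∀ t (p : ℕ), p.Prime → p ∣ h t → ¬ ((p : ℤ) ∣ D) := by
    intro t p hp hpt hpD
    have h1 : (p : ℤ) ∣ 1 + D * t * w t := Int.natCast_dvd.2 hpt
    have h2 : (p : ℤ) ∣ 1 := by
      have := dvd_sub h1 ((hpD.mul_right (t : ℤ)).mul_right (w t))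
      simpa using this
    have := Int.eq_one_of_dvd_one (by positivity) h2
    exact hp.one_lt.ne' (by exact_mod_cast this)
  let q : Polynomial ℝ := (f.comp (Polynomial.C c + Polynomial.C (a * D) * Polynomial.X)).map
    (Int.castRingHom ℝ)
  have hq : ∀ t : ℕ, q.eval (t : ℝ) = ((f.eval (s t) : ℤ) : ℝ) := by
    intro t
    rw [show ((t : ℝ)) = Int.castRingHom ℝ (t : ℤ) by simp, Polynomial.eval_map_apply]
    simp [s]
  have hqdeg : q.natDegree = f.natDegree := by
    have h2 : (Polynomial.C c + Polynomial.C (a * D) * Polynomial.X).natDegree = 1 := by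
      rw [add_comm]; exact Polynomial.natDegree_linear (by positivity)
    simp only [q]
    rw [Polynomial.natDegree_map_eq_of_injective (RingHom.injective_int _),
      Polynomial.natDegree_comp, h2, mul_one]
  have hq0 : q ≠ 0 := by
    rintro h3; rw [h3] at hqdeg; simp at hqdeg; omega
  have hqdeg' : q.degree = f.natDegree := by
    rw [Polynomial.degree_eq_natDegree hq0, hqdeg]
  have hO1 : (Polynomial.X : Polynomial ℝ).eval =O[Filter.atTop] q.eval := by
    apply Polynomial.isBigO_atTop_of_degree_le
    rw [hqdeg', Polynomial.degree_X]; exact_mod_cast hdeg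
  have hO2 : q.eval =O[Filter.atTop] ((Polynomial.X : Polynomial ℝ) ^ f.natDegree).eval := by
    apply Polynomial.isBigO_atTop_of_degree_le
    rw [hqdeg', Polynomial.degree_X_pow]
  obtain ⟨C₁, hC₁, hO1⟩ := Asymptotics.bound_of_isBigO_nat_atTop
    (hO1.comp_tendsto tendsto_natCast_atTop_atTop)
  obtain ⟨C₂, hC₂, hO2⟩ := Asymptotics.bound_of_isBigO_nat_atTop
    (hO2.comp_tendsto tendsto_natCast_atTop_atTop)
  simp only [Function.comp_apply, Polynomial.eval_X, Polynomial.eval_pow, hq] at hO1 hO2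
  have haR : (0 : ℝ) < |(a : ℝ)| := by positivity
  set C : ℝ := max 1 (max (C₁ * |(a : ℝ)|) (C₂ / |(a : ℝ)|)) with hCdef
  have hC1 : 1 ≤ C := le_max_left _ _
  have hCa : C₁ * |(a : ℝ)| ≤ C := (le_max_left _ _).trans (le_max_right _ _)
  have hCb : C₂ / |(a : ℝ)| ≤ C := (le_max_right _ _).trans (le_max_right _ _)
  have hlow : ∀ t : ℕ, 1 ≤ t → (t : ℝ) ≤ C * h t := by
    intro t ht
    have hne : ((f.eval (s t) : ℤ) : ℝ) ≠ 0 := by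
      intro hz
      have := hcast t
      rw [hz] at this
      simp at this
      exact h0 t this
    have h1 := hO1 hne
    rw [Real.norm_of_nonneg (by positivity), Real.norm_eq_abs] at h1
    calc (t : ℝ) ≤ _ := h1
      _ = C₁ * |(a : ℝ)| * h t := by rw [hcast]; field_simp
      _ ≤ _ := by gcongr
  have hup : ∀ t : ℕ, 1 ≤ t → (h t : ℝ) ≤ C * (t : ℝ) ^ f.natDegree := by
    intro t ht
    have h1 := hO2 (x := t) (by positivity)
    rw [Real.norm_eq_abs, Real.norm_of_nonneg (by positivity)] at h1
    rw [hcast]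
    calc _ ≤ C₂ * (t : ℝ) ^ f.natDegree / |(a : ℝ)| := by gcongr
      _ = C₂ / |(a : ℝ)| * (t : ℝ) ^ f.natDegree := by ring
      _ ≤ _ := by gcongr
  have hRD : R ∣ D := ⟨2 * a, by rw [hD]; ring⟩
  have haD : a ∣ D := ⟨2 * R, by rw [hD]; ring⟩
  have hdvd : ∀ t (m : ℕ), m ∣ h t → (m : ℤ) ∣ f.eval (s t) := by
    intro t m hm
    rw [hw]
    exact (Int.natCast_dvd.2 hm).mul_left _
  have hcount : ∀ T p j : ℕ, p.Prime → 1 ≤ j →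
      (((Finset.Icc 1 T).filter (fun t => p ^ j ∣ h t)).card : ℝ) ≤
        f.natDegree * ((T : ℝ) / p ^ j + 1) := by
    intro T p j hp hj
    have : Fact p.Prime := ⟨hp⟩
    set A := (Finset.Icc 1 T).filter (fun t => p ^ j ∣ h t) with hA
    let φ : ℕ → ZMod p := fun t => ((s t : ℤ) : ZMod p)
    have hpp : ∀ t ∈ A, p ∣ h t := by
      intro t ht
      exact (dvd_pow_self p (by omega)).trans (Finset.mem_filter.1 ht).2
    have hfib : ∀ b ∈ A.image φ, (A.filter (fun t => φ t = b)).card ≤ T / p ^ j + 1 := by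
      intro b _
      apply card_filter_le_of_forall_modEq
      · exact (Finset.filter_subset _ _).trans (Finset.filter_subset _ _)
      · intro t ht t' ht'
        rw [Finset.mem_filter] at ht ht'
        have hpD1 := hpD t p hp (hpp t ht.1)
        have hpR : ¬ ((p : ℤ) ∣ R) := fun hh => hpD1 (hh.trans hRD)
        have hpa : ¬ ((p : ℤ) ∣ a) := fun hh => hpD1 (hh.trans haD)
        have hpz : Prime (p : ℤ) := Nat.prime_iff_prime_int.1 hp
        have hder1 := hder p hp hpR (s t) (hdvd t p (hpp t ht.1))
        have hcong : (p : ℤ) ∣ s t' - s t := by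
          rw [← ZMod.intCast_zmod_eq_zero_iff_dvd]
          push_cast
          rw [sub_eq_zero]
          exact ht'.2.trans ht.2.symm
        obtain ⟨m, hm⟩ := Polynomial.binomExpansion f (s t) (s t' - s t)
        rw [add_sub_cancel] at hm
        have h1 := hdvd t _ (Finset.mem_filter.1 ht.1).2
        have h2 := hdvd t' _ (Finset.mem_filter.1 ht'.1).2
        push_cast at h1 h2 ⊢
        have h3 : (p : ℤ) ^ j ∣ (s t' - s t) * (f.derivative.eval (s t) + m * (s t' - s t)) := by
          have h7 := dvd_sub h2 h1
          have h8 : f.eval (s t') - f.eval (s t) =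
              (s t' - s t) * (f.derivative.eval (s t) + m * (s t' - s t)) := by
            linear_combination hm
          rwa [h8] at h7
        have h4 : ¬ ((p : ℤ) ∣ f.derivative.eval (s t) + m * (s t' - s t)) := by
          intro hh
          exact hder1 ((Int.dvd_add_left (hcong.mul_left m)).1 hh)
        have h5 : (p : ℤ) ^ j ∣ s t' - s t := hpz.pow_dvd_of_dvd_mul_right j h4 h3
        have h6 : s t' - s t = a * D * ((t' : ℤ) - t) := by simp only [s]; ring
        rw [h6] at h5
        refine hpz.pow_dvd_of_dvd_mul_left j ?_ h5
        intro hh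
        rcases hpz.dvd_or_dvd hh with hh | hh
        · exact hpa hh
        · exact hpD1 hh
    have h1 := Finset.card_le_mul_card_image A _ hfib
    have h2 : (A.image φ).card ≤ f.natDegree := by
      let fp := f.map (Int.castRingHom (ZMod p))
      have hfp : fp.Monic := hmon.map _
      have hsub : A.image φ ⊆ fp.roots.toFinset := by
        intro b hb
        obtain ⟨t, ht, rfl⟩ := Finset.mem_image.1 hb
        rw [Multiset.mem_toFinset, Polynomial.mem_roots hfp.ne_zero, Polynomial.IsRoot.def]
        have h3 := Polynomial.eval_map_apply (Int.castRingHom (ZMod p)) (s t) (p := f)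
        simp only [eq_intCast] at h3
        simp only [fp, φ]
        rw [h3]
        exact (ZMod.intCast_zmod_eq_zero_iff_dvd _ _).2 (hdvd t p (hpp t ht))
      calc _ ≤ _ := Finset.card_le_card hsub
        _ ≤ _ := Multiset.toFinset_card_le _
        _ ≤ fp.natDegree := Polynomial.card_roots' _
        _ ≤ _ := Polynomial.natDegree_map_le
    calc (A.card : ℝ) ≤ ((T / p ^ j + 1 : ℕ) : ℝ) * ((A.image φ).card : ℝ) := by exact_mod_cast h1
      _ ≤ ((T : ℝ) / p ^ j + 1) * f.natDegree := by
        have h3 : ((T / p ^ j : ℕ) : ℝ) ≤ (T : ℝ) / p ^ j := by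
          simpa using Nat.cast_div_le (α := ℝ) (m := T) (n := p ^ j)
        push_cast
        gcongr
      _ = _ := mul_comm _ _
  obtain ⟨T₀, hT₀⟩ := many_prime_divisors h f.natDegree hdeg C hC1 (fun t _ => h0 t) hlow hup hcount
  refine ⟨C, T₀, hC1, fun T hT => ⟨_, hT₀ T hT, ?_⟩⟩
  intro p hp
  rw [Finset.mem_biUnion] at hp
  obtain ⟨t, ht, hpt⟩ := hp
  rw [Finset.mem_Icc] at ht
  have hpp := Nat.prime_of_mem_primeFactors hpt
  have hpd := Nat.dvd_of_mem_primeFactors hpt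
  refine ⟨hpp, ?_, fun hh => hpD t p hpp hpd (hh.trans hRD), s t, hdvd t p hpd⟩
  have h1 : (p : ℝ) ≤ h t := by exact_mod_cast Nat.le_of_dvd (Nat.pos_of_ne_zero (h0 t)) hpd
  have h2 : (t : ℝ) ≤ T := by exact_mod_cast ht.2
  refine h1.trans ((hup t ht.1).trans ?_)
  gcongr

open NumberField in
/-- Every number field has, up to `P`, at least a power of `P` many primes with a residue field of
degree one. -/
theorem exists_prime_supply (M : Type*) [Field M] [NumberField M] :
    ∃ δ : ℝ, 0 < δ ∧ δ ≤ 1 ∧ ∃ P₀ : ℝ, 1 ≤ P₀ ∧ ∀ P : ℝ, P₀ ≤ P → ∃ S : Finset ℕ,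
      (∀ p ∈ S, p.Prime ∧ P ^ (2 * δ) ≤ p ∧ (p : ℝ) ≤ P ∧ Nonempty (𝓞 M →+* ZMod p)) ∧
      P ^ δ ≤ S.card ∧ (S.card : ℝ) ≤ P ^ δ + 1 := by
  obtain ⟨f, R, hmon, hdeg, hR, hf⟩ := exists_poly_of_numberField M
  obtain ⟨C, T₀, hC, hT₀⟩ := exists_many_primes_of_poly f R hmon hdeg hR
    (fun p hp hpR s hs => (hf p hp hpR s hs).2)
  set g := f.natDegree with hg
  have hg1 : (1 : ℝ) ≤ g := by exact_mod_cast hdeg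
  have hC0 : 0 < C := by linarith
  set δ : ℝ := 1 / (256 * g ^ 2) with hδ
  have hδ0 : 0 < δ := by positivity
  have e1 : ∀ᶠ P : ℝ in Filter.atTop, (T₀ : ℝ) + 1 ≤ P ^ (1 / (2 * g) : ℝ) :=
    (tendsto_rpow_atTop (by positivity)).eventually_ge_atTop _
  have e2 : ∀ᶠ P : ℝ in Filter.atTop, 2 * C ≤ P ^ (1 / (2 * g) : ℝ) :=
    (tendsto_rpow_atTop (by positivity)).eventually_ge_atTop _
  have e3 : ∀ᶠ P : ℝ in Filter.atTop, 2 ≤ P ^ δ :=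
    (tendsto_rpow_atTop hδ0).eventually_ge_atTop _
  obtain ⟨P₁, hP₁⟩ := Filter.eventually_atTop.1
    (e1.and (e2.and (e3.and (Filter.eventually_ge_atTop 1))))
  refine ⟨δ, hδ0, ?_, max 1 P₁, le_max_left _ _, fun P hP => ?_⟩
  · rw [hδ, div_le_one (by positivity)]; nlinarith
  obtain ⟨h1, h2, h3, hP1⟩ := hP₁ P ((le_max_right _ _).trans hP)
  have hP0 : 0 < P := by linarith
  set y := P ^ (1 / (2 * g) : ℝ) with hy
  have hy0 : 0 < y := by positivity
  set T := ⌊y * y / C⌋₊ with hT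
  have hCy : C * y ≤ y * y / C * C := by
    rw [div_mul_cancel₀ _ hC0.ne']
    nlinarith
  have hTy : y ≤ T := by
    have h4 : y * y / C < T + 1 := Nat.lt_floor_add_one _
    have h5 : 2 * y ≤ y * y / C := by
      rw [le_div_iff₀ hC0]; nlinarith
    have : (1 : ℝ) ≤ y := by
      have : (0 : ℝ) ≤ T₀ := by positivity
      linarith
    linarith
  have hTup : (T : ℝ) ≤ y * y / C := Nat.floor_le (by positivity)
  have hCT : C * (T : ℝ) ^ g ≤ P := by
    have hyy : (y * y) ^ g = P := by
      rw [hy, ← Real.rpow_add hP0, ← Real.rpow_natCast, ← Real.rpow_mul hP0.le]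
      have : (1 / (2 * (g : ℝ)) + 1 / (2 * g)) * g = 1 := by field_simp; norm_num
      rw [this, Real.rpow_one]
    calc C * (T : ℝ) ^ g ≤ C * (y * y / C) ^ g := by gcongr
      _ = C / C ^ g * (y * y) ^ g := by rw [div_pow]; field_simp
      _ ≤ 1 * (y * y) ^ g := by
        gcongr
        rw [div_le_one (by positivity)]
        exact le_self_pow₀ hC (by omega)
      _ = P := by rw [one_mul, hyy]
  obtain ⟨S, hScard, hS⟩ := hT₀ T (by
    have : (T₀ : ℝ) ≤ T := by linarith
    exact_mod_cast this)
  set x := P ^ δ with hx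
  have hx4 : x ^ 4 ≤ S.card := by
    refine le_trans ?_ hScard
    calc x ^ 4 = y ^ (1 / (32 * g) : ℝ) := by
          rw [hx, hy, ← Real.rpow_natCast, ← Real.rpow_mul hP0.le, ← Real.rpow_mul hP0.le]
          congr 1
          rw [hδ]; push_cast; field_simp; norm_num
      _ ≤ _ := Real.rpow_le_rpow hy0.le hTy (by positivity)
  have hx2 : P ^ (2 * δ) = x ^ 2 := by
    rw [hx, ← Real.rpow_natCast, ← Real.rpow_mul hP0.le]; congr 1; push_cast; ring
  set S' := S.filter (fun p : ℕ => x ^ 2 ≤ (p : ℝ)) with hS'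
  have hS'card : (S.card : ℝ) ≤ S'.card + (x ^ 2 + 1) := by
    have h4 := Finset.card_filter_add_card_filter_not (s := S) (fun p : ℕ => x ^ 2 ≤ (p : ℝ))
    have h5 : (S.filter (fun p : ℕ => ¬ x ^ 2 ≤ (p : ℝ))).card ≤ ⌊x ^ 2⌋₊ + 1 := by
      rw [← Finset.card_range (⌊x ^ 2⌋₊ + 1)]
      apply Finset.card_le_card
      intro p hp
      rw [Finset.mem_filter, not_le] at hp
      rw [Finset.mem_range]
      exact Nat.lt_succ_of_le (Nat.le_floor hp.2.le)
    have h6 : ((⌊x ^ 2⌋₊ : ℕ) : ℝ) ≤ x ^ 2 := Nat.floor_le (by positivity)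
    have h7 : ((S.filter (fun p : ℕ => ¬ x ^ 2 ≤ (p : ℝ))).card : ℝ) ≤ x ^ 2 + 1 :=
      (by exact_mod_cast h5 : _ ≤ ((⌊x ^ 2⌋₊ : ℕ) : ℝ) + 1).trans (by linarith)
    have h8 : (S.card : ℝ) = S'.card + ((S.filter (fun p : ℕ => ¬ x ^ 2 ≤ (p : ℝ))).card : ℝ) := by
      exact_mod_cast h4.symm
    linarith
  have hceil : ⌈x⌉₊ ≤ S'.card := by
    rw [Nat.ceil_le]
    nlinarith [mul_self_nonneg (x ^ 2 - 1), mul_self_nonneg (x - 1)]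
  obtain ⟨S'', hsub, hc⟩ := Finset.exists_subset_card_eq hceil
  refine ⟨S'', ?_, ?_, ?_⟩
  · intro p hp
    obtain ⟨hpS, hpx⟩ := Finset.mem_filter.1 (hsub hp)
    obtain ⟨hpp, hple, hpR, s, hs⟩ := hS p hpS
    exact ⟨hpp, hx2 ▸ hpx, hple.trans hCT, (hf p hpp hpR s hs).1⟩
  · rw [hc]; exact Nat.le_ceil _
  · rw [hc]; exact (Nat.ceil_lt_add_one (by positivity)).le

open NumberField UniqueFactorizationMonoid in
/-- The divisor bound for ideals of a number field. -/
theorem exists_card_ideal_dvd_le (K : Type*) [Field K] [NumberField K] (ε : ℝ) (hε : 0 < ε) :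
    ∃ C : ℝ, 1 ≤ C ∧ ∀ I : Ideal (𝓞 K), I ≠ ⊥ →
      {J : Ideal (𝓞 K) | J ∣ I}.Finite ∧
      ({J : Ideal (𝓞 K) | J ∣ I}.ncard : ℝ) ≤ C * (Ideal.absNorm I : ℝ) ^ ε := by
  classical
  set A : ℝ := 1 + 1 / (ε * Real.log 2) with hA
  have hl2 : 0 < Real.log 2 := Real.log_pos (by norm_num)
  have hA1 : 1 ≤ A := by
    have : 0 ≤ 1 / (ε * Real.log 2) := by positivity
    linarith
  set y : ℝ := (2 : ℝ) ^ (1 / ε) with hy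
  have hfin : {I : Ideal (𝓞 K) | Ideal.absNorm I ≤ ⌊y⌋₊}.Finite :=
    Ideal.finite_setOfPred_absNorm_le ⌊y⌋₊
  set Q := hfin.toFinset with hQ
  have key : ∀ (N e : ℕ), 2 ≤ N → ((e : ℝ) + 1) ≤
      (if N ≤ ⌊y⌋₊ then A else 1) * (((N ^ e : ℕ) : ℝ)) ^ ε := by
    intro N e hN
    have hN' : (2 : ℝ) ≤ N := by exact_mod_cast hN
    have e1 : (((N ^ e : ℕ) : ℝ)) ^ ε = ((N : ℝ) ^ ε) ^ e := by
      push_cast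
      rw [← Real.rpow_natCast, ← Real.rpow_natCast, ← Real.rpow_mul (by positivity),
        ← Real.rpow_mul (by positivity), mul_comm]
    rw [e1]
    split_ifs with h
    · have h1 : (1 : ℝ) + ε * Real.log 2 ≤ (N : ℝ) ^ ε := by
        calc (1 : ℝ) + ε * Real.log 2 ≤ Real.exp (ε * Real.log 2) := by
              rw [add_comm]; exact Real.add_one_le_exp _
          _ = (2 : ℝ) ^ ε := by rw [Real.rpow_def_of_pos (by norm_num), mul_comm]
          _ ≤ _ := Real.rpow_le_rpow (by norm_num) hN' hε.le
      have h2 : 1 + (e : ℝ) * (ε * Real.log 2) ≤ ((N : ℝ) ^ ε) ^ e := by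
        refine (one_add_mul_le_pow ?_ e).trans ?_
        · have : 0 < ε * Real.log 2 := by positivity
          linarith
        · have : 0 < ε * Real.log 2 := by positivity
          gcongr
      have h3 : 0 < ε * Real.log 2 := by positivity
      calc (e : ℝ) + 1 ≤ A * (1 + (e : ℝ) * (ε * Real.log 2)) := by
            rw [hA]
            have : (1 + 1 / (ε * Real.log 2)) * (1 + (e : ℝ) * (ε * Real.log 2)) =
              1 + (e : ℝ) * (ε * Real.log 2) + 1 / (ε * Real.log 2) + e := by field_simp; ring
            rw [this]
            have h4 : 0 ≤ 1 / (ε * Real.log 2) := by positivity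
            have h5 : 0 ≤ (e : ℝ) * (ε * Real.log 2) := by positivity
            linarith
        _ ≤ _ := by gcongr
    · rw [not_le, Nat.floor_lt (by positivity)] at h
      have h1 : (2 : ℝ) ≤ (N : ℝ) ^ ε := by
        have := Real.rpow_le_rpow (by positivity) h.le hε.le
        rwa [hy, ← Real.rpow_mul (by norm_num), one_div_mul_cancel hε.ne', Real.rpow_one] at this
      have h2 := one_add_mul_le_pow (a := (1 : ℝ)) (by norm_num) e
      rw [one_mul]
      calc (e : ℝ) + 1 ≤ (1 + 1) ^ e := by linarith
        _ ≤ _ := by rw [show (1 : ℝ) + 1 = 2 by norm_num]; gcongr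
  refine ⟨A ^ Q.card, one_le_pow₀ hA1, fun I hI => ?_⟩
  set m := normalizedFactors I with hm
  have hinj : Set.InjOn (fun J : Ideal (𝓞 K) => normalizedFactors J) {J | J ∣ I} := by
    intro J hJ J' hJ' h
    have hJ0 : J ≠ 0 := ne_zero_of_dvd_ne_zero hI hJ
    have hJ0' : J' ≠ 0 := ne_zero_of_dvd_ne_zero hI hJ'
    simp only at h
    rw [← associated_iff_eq, associated_iff_normalizedFactors_eq_normalizedFactors hJ0 hJ0']
    exact h
  have hmaps : Set.MapsTo (fun J : Ideal (𝓞 K) => normalizedFactors J) {J | J ∣ I}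
      (Finset.Iic m : Set (Multiset (Ideal (𝓞 K)))) := by
    intro J hJ
    simp only [Finset.coe_Iic, Set.mem_Iic]
    exact (dvd_iff_normalizedFactors_le_normalizedFactors (ne_zero_of_dvd_ne_zero hI hJ) hI).1 hJ
  have hcard : {J : Ideal (𝓞 K) | J ∣ I}.ncard ≤ ∏ i ∈ m.toFinset, (m.count i + 1) := by
    rw [← Multiset.card_Iic, ← Set.ncard_coe_finset]
    exact Set.ncard_le_ncard_of_injOn _ hmaps hinj
  refine ⟨Set.Finite.of_injOn hmaps hinj (Finset.finite_toSet _), ?_⟩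
  have hnorm : (Ideal.absNorm I : ℝ) =
      ∏ i ∈ m.toFinset, (((Ideal.absNorm i) ^ (m.count i) : ℕ) : ℝ) := by
    conv_lhs => rw [← associated_iff_eq.1 (prod_normalizedFactors hI), ← hm,
      Finset.prod_multiset_count]
    rw [map_prod]
    push_cast
    simp
  calc ({J : Ideal (𝓞 K) | J ∣ I}.ncard : ℝ) ≤ ∏ i ∈ m.toFinset, ((m.count i : ℝ) + 1) := by
        exact_mod_cast hcard
    _ ≤ ∏ i ∈ m.toFinset, ((if Ideal.absNorm i ≤ ⌊y⌋₊ then A else 1) *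
          (((Ideal.absNorm i ^ (m.count i) : ℕ) : ℝ)) ^ ε) := by
        apply Finset.prod_le_prod
        · intro i _; positivity
        · intro i hi
          apply key
          rw [Multiset.mem_toFinset] at hi
          have hp := prime_of_normalized_factor i hi
          have h1 : Ideal.absNorm i ≠ 0 := by
            rw [Ne, Ideal.absNorm_eq_zero_iff]; exact hp.ne_zero
          have h2 : Ideal.absNorm i ≠ 1 := by
            rw [Ne, Ideal.absNorm_eq_one_iff, ← Ideal.isUnit_iff]; exact hp.not_isUnit
          omega
    _ = (∏ i ∈ m.toFinset, (if Ideal.absNorm i ≤ ⌊y⌋₊ then A else 1)) *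
          (Ideal.absNorm I : ℝ) ^ ε := by
        rw [Finset.prod_mul_distrib, hnorm, Real.finsetProd_rpow]
        intro i _; positivity
    _ ≤ A ^ Q.card * (Ideal.absNorm I : ℝ) ^ ε := by
        gcongr
        rw [← Finset.prod_filter, Finset.prod_const]
        apply pow_le_pow_right₀ hA1
        apply Finset.card_le_card
        intro i hi
        rw [Finset.mem_filter] at hi
        simp [hQ, hi.2]

open NumberField in
lemma finite_units_quotient_pow (K : Type*) [Field K] [NumberField K] (k : ℕ) (hk : 1 ≤ k) :
    Finite ((𝓞 K)ˣ ⧸ (powMonoidHom k : (𝓞 K)ˣ →* (𝓞 K)ˣ).range) := by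
  have : Group.FG (𝓞 K)ˣ := Group.fg_iff_monoid_fg.2 inferInstance
  apply CommGroup.finite_of_fg_isMulTorsion
  intro x
  induction x using QuotientGroup.induction_on with
  | H u =>
    rw [isOfFinOrder_iff_pow_eq_one]
    refine ⟨k, hk, ?_⟩
    rw [← QuotientGroup.mk_pow, QuotientGroup.eq_one_iff]
    exact ⟨u, rfl⟩

open NumberField in
/-- Elements generating an ideal of the form `𝔠 𝔭ᵏ`, with `𝔠` fixed, fall into boundedly many
classes of elements differing by `k`-th powers. -/
theorem exists_kpow_classes (K : Type*) [Field K] [NumberField K] (k : ℕ) (hk : 1 ≤ k) :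
    ∃ N : ℕ, ∀ 𝔠 : Ideal (𝓞 K), ∃ κ : 𝓞 K → Fin N, ∀ ξ η : 𝓞 K, ξ ≠ 0 → η ≠ 0 →
      (∃ 𝔭 : Ideal (𝓞 K), Ideal.span {ξ} = 𝔠 * 𝔭 ^ k) →
      (∃ 𝔭 : Ideal (𝓞 K), Ideal.span {η} = 𝔠 * 𝔭 ^ k) →
      κ ξ = κ η → ∃ w : 𝓞 K, ξ * η ^ (k - 1) = w ^ k := by
  classical
  have := finite_units_quotient_pow K k hk
  set H := (powMonoidHom k : (𝓞 K)ˣ →* (𝓞 K)ˣ).range with hH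
  obtain ⟨N, ⟨e⟩⟩ := Finite.exists_equiv_fin (ClassGroup (𝓞 K) × ((𝓞 K)ˣ ⧸ H))
  refine ⟨N, fun 𝔠 => ?_⟩
  let good : 𝓞 K → Prop := fun ξ => ξ ≠ 0 ∧ ∃ 𝔭 : Ideal (𝓞 K), Ideal.span {ξ} = 𝔠 * 𝔭 ^ k
  have hgood : ∀ ξ, good ξ → ∃ 𝔭 : (nonZeroDivisors (Ideal (𝓞 K))),
      Ideal.span {ξ} = 𝔠 * (𝔭 : Ideal (𝓞 K)) ^ k := by
    rintro ξ ⟨h0, 𝔭, h⟩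
    refine ⟨⟨𝔭, mem_nonZeroDivisors_of_ne_zero ?_⟩, h⟩
    rintro rfl
    rw [zero_pow (by omega), mul_zero, Ideal.zero_eq_bot, Ideal.span_singleton_eq_bot] at h
    exact h0 h
  choose! 𝔭 h𝔭 using hgood
  let cl : 𝓞 K → ClassGroup (𝓞 K) := fun ξ => ClassGroup.mk0 (𝔭 ξ)
  -- a base element in each class
  have hbase : ∀ a : ClassGroup (𝓞 K), ∃ b : 𝓞 K, (∃ ξ, good ξ ∧ cl ξ = a) → good b ∧ cl b = a := by
    intro a
    by_cases h : ∃ ξ, good ξ ∧ cl ξ = a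
    · obtain ⟨ξ, hξ⟩ := h
      exact ⟨ξ, fun _ => hξ⟩
    · exact ⟨0, fun h' => absurd h' h⟩
  choose b hb using hbase
  have hunit : ∀ ξ, good ξ → ∃ u : (𝓞 K)ˣ, ∃ z : K, (ξ : K) = (u : 𝓞 K) * z ^ k * (b (cl ξ) : K) := by
    intro ξ hξ
    obtain ⟨hb1, hb2⟩ := hb (cl ξ) ⟨ξ, hξ, rfl⟩
    have h1 : ClassGroup.mk0 (𝔭 ξ) = ClassGroup.mk0 (𝔭 (b (cl ξ))) := hb2.symm
    obtain ⟨x, y, hx, hy, hxy⟩ := ClassGroup.mk0_eq_mk0_iff.1 h1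
    have h2 : Ideal.span {x ^ k * ξ} = Ideal.span {y ^ k * b (cl ξ)} := by
      rw [← Ideal.span_singleton_mul_span_singleton, ← Ideal.span_singleton_mul_span_singleton,
        ← Ideal.span_singleton_pow, ← Ideal.span_singleton_pow, h𝔭 ξ hξ, h𝔭 _ hb1,
        mul_left_comm, ← mul_pow, hxy, mul_pow, mul_left_comm]
    obtain ⟨u, hu⟩ := (Ideal.span_singleton_eq_span_singleton.1 h2).symm
    refine ⟨u, (y : K) / x, ?_⟩
    have hxK : (x : K) ≠ 0 := by simpa using hx
    have hu' := congrArg (algebraMap (𝓞 K) K) hu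
    simp only [map_mul, map_pow] at hu'
    rw [div_pow]
    field_simp
    linear_combination -hu'
  choose! u z hz using hunit
  refine ⟨fun ξ => e (cl ξ, (u ξ : (𝓞 K)ˣ ⧸ H)), fun ξ η h0ξ h0η hξ hη hκ => ?_⟩
  have hgξ : good ξ := ⟨h0ξ, hξ⟩
  have hgη : good η := ⟨h0η, hη⟩
  obtain ⟨hcl, hu⟩ := Prod.mk.inj (e.injective hκ)
  have hu' : (u η)⁻¹ * u ξ ∈ H := QuotientGroup.eq.1 hu.symm
  obtain ⟨w, hw⟩ := hu'
  have hw' : u ξ = u η * w ^ k := by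
    rw [powMonoidHom_apply] at hw
    rw [hw, mul_inv_cancel_left]
  have hzξ := hz ξ hgξ
  have hzη := hz η hgη
  rw [hcl] at hzξ
  set β := b (cl η)
  let t : K := ((u η : (𝓞 K)ˣ) : 𝓞 K) * (w : 𝓞 K) * z ξ * z η ^ (k - 1) * (β : K)
  obtain ⟨l, rfl⟩ : ∃ l, k = l + 1 := ⟨k - 1, by omega⟩
  have ht : t ^ (l + 1) = ((ξ * η ^ l : 𝓞 K) : K) := by
    simp only [t, map_mul, map_pow, hzξ, hzη, hw', Units.val_mul, Units.val_pow_eq_pow_val,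
      Nat.add_sub_cancel]
    ring
  have hint : IsIntegral ℤ t := by
    refine IsIntegral.of_pow (n := l + 1) (by omega) ?_
    rw [ht]
    exact RingOfIntegers.isIntegral_coe _
  refine ⟨⟨t, hint⟩, ?_⟩
  apply RingOfIntegers.ext
  simp only [Nat.add_sub_cancel]
  rw [← ht]
  rfl

open NumberField in
theorem exists_card_ideals_le (K : Type*) [Field K] [NumberField K] :
    ∃ C : ℝ, 1 ≤ C ∧ ∀ (y : ℝ) (𝒞 : Finset (Ideal (𝓞 K))),
      (∀ I ∈ 𝒞, I ≠ ⊥ ∧ (Ideal.absNorm I : ℝ) ≤ y) → 0 ≤ y → (𝒞.card : ℝ) ≤ C * y := by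
  obtain ⟨l, hl⟩ : ∃ l : ℝ, Filter.Tendsto (fun s : ℝ ↦
      (Nat.card {I : Ideal (𝓞 K) // (Ideal.absNorm I : ℝ) ≤ s} : ℝ) / s) Filter.atTop (nhds l) :=
    ⟨_, NumberField.Ideal.tendsto_norm_le_div_atTop K⟩
  obtain ⟨y₀, hy₀⟩ := Filter.eventually_atTop.1
    ((hl.eventually (gt_mem_nhds (lt_add_one l))).and (Filter.eventually_ge_atTop 1))
  have hy₀1 := (hy₀ y₀ le_rfl).2
  have hcard : ∀ (y : ℝ) (𝒞 : Finset (Ideal (𝓞 K))),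
      (∀ I ∈ 𝒞, I ≠ ⊥ ∧ (Ideal.absNorm I : ℝ) ≤ y) →
      𝒞.card ≤ Nat.card {I : Ideal (𝓞 K) // (Ideal.absNorm I : ℝ) ≤ y} := by
    intro y 𝒞 h
    have hfin : {I : Ideal (𝓞 K) | (Ideal.absNorm I : ℝ) ≤ y}.Finite := by
      apply (Ideal.finite_setOfPred_absNorm_le ⌊y⌋₊).subset
      intro I hI
      exact Nat.le_floor hI
    rw [← Set.ncard_coe_finset]
    exact Set.ncard_le_ncard (fun I hI => (h I hI).2) hfin
  have hlarge : ∀ (y : ℝ) (𝒞 : Finset (Ideal (𝓞 K))),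
      (∀ I ∈ 𝒞, I ≠ ⊥ ∧ (Ideal.absNorm I : ℝ) ≤ y) → y₀ ≤ y → (𝒞.card : ℝ) ≤ (l + 1) * y := by
    intro y 𝒞 h hy
    obtain ⟨h1, h2⟩ := hy₀ y hy
    rw [div_lt_iff₀ (by linarith)] at h1
    exact (Nat.cast_le.2 (hcard y 𝒞 h)).trans h1.le
  have hl1 : 0 ≤ l + 1 := by
    have := hlarge y₀ ∅ (by simp) le_rfl
    simp at this
    nlinarith
  refine ⟨max 1 ((l + 1) * y₀), le_max_left _ _, fun y 𝒞 h hy => ?_⟩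
  rcases lt_or_ge y 1 with hlt | hge
  · have : 𝒞 = ∅ := by
      apply Finset.eq_empty_of_forall_notMem
      intro I hI
      obtain ⟨h1, h2⟩ := h I hI
      have h3 : (Ideal.absNorm I : ℝ) < 1 := by linarith
      have h4 : Ideal.absNorm I = 0 := by
        have : Ideal.absNorm I < 1 := by exact_mod_cast h3
        omega
      exact h1 (Ideal.absNorm_eq_zero_iff.1 h4)
    rw [this]; simp; positivity
  · have h1 := hlarge (y * y₀) 𝒞 (fun I hI => ⟨(h I hI).1, (h I hI).2.trans (by nlinarith)⟩)
      (by nlinarith)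
    calc _ ≤ _ := h1
      _ = (l + 1) * y₀ * y := by ring
      _ ≤ _ := by gcongr; exact le_max_right _ _

theorem MvPolynomial.exists_retraction_map (k E : Type*) [Field k] [Field E] [Algebra k E]
    (σ : Type*) :
    ∃ Φ : MvPolynomial σ E → MvPolynomial σ k,
      (∀ P R, Φ (P.map (algebraMap k E) * R) = P * Φ R) ∧ Φ 1 = 1 := by
  classical
  obtain ⟨π, hπ⟩ := LinearMap.exists_leftInverse_of_injective (Algebra.linearMap k E)
    (LinearMap.ker_eq_bot.2 (algebraMap k E).injective)
  let Φ : MvPolynomial σ E → MvPolynomial σ k := fun R =>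
    ∑ m ∈ R.support, monomial m (π (coeff m R))
  have hΦ : ∀ R m, coeff m (Φ R) = π (coeff m R) := by
    intro R m
    simp only [Φ, coeff_sum, coeff_monomial]
    rw [Finset.sum_ite_eq' R.support m]
    split_ifs with h
    · rfl
    · rw [notMem_support_iff.1 h, map_zero]
  have hπ1 : π 1 = 1 := by
    have := LinearMap.congr_fun hπ 1
    simpa using this
  refine ⟨Φ, fun P R => ?_, ?_⟩
  · ext m
    rw [hΦ, coeff_mul, coeff_mul, map_sum]
    refine Finset.sum_congr rfl fun x _ => ?_
    rw [coeff_map, hΦ, ← Algebra.smul_def, map_smul, smul_eq_mul]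
  · ext m
    rw [hΦ, coeff_one, coeff_one]
    split_ifs <;> simp [hπ1]

theorem MvPolynomial.dvd_of_map_dvd_map {k E : Type*} [Field k] [Field E] [Algebra k E]
    {σ : Type*} {P Q : MvPolynomial σ k}
    (h : P.map (algebraMap k E) ∣ Q.map (algebraMap k E)) : P ∣ Q := by
  obtain ⟨Φ, hΦ, hΦ1⟩ := MvPolynomial.exists_retraction_map k E σ
  obtain ⟨R, hR⟩ := h
  have h1 := hΦ Q 1
  have h2 := hΦ P R
  rw [← hR, ← mul_one (Q.map _), h1, hΦ1, mul_one] at h2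
  exact ⟨_, h2⟩

theorem MvPolynomial.exists_map_eq_of_eval_mem_range {k E : Type*} [Field k] [Infinite k] [Field E]
    [Algebra k E] {σ : Type*} [Finite σ] {Q : MvPolynomial σ E}
    (h : ∀ x : σ → k, ∃ y : k, eval (fun i => algebraMap k E (x i)) Q = algebraMap k E y) :
    ∃ P : MvPolynomial σ k, P.map (algebraMap k E) = Q := by
  classical
  obtain ⟨π, hπ⟩ := LinearMap.exists_leftInverse_of_injective (Algebra.linearMap k E)
    (LinearMap.ker_eq_bot.2 (algebraMap k E).injective)
  have hπ' : ∀ y : k, π (algebraMap k E y) = y := fun y => by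
    simpa using LinearMap.congr_fun hπ y
  let P : MvPolynomial σ k := ∑ m ∈ Q.support, monomial m (π (coeff m Q))
  have hP : ∀ x : σ → k, eval x P = π (eval (fun i => algebraMap k E (x i)) Q) := by
    intro x
    rw [eval_eq (fun i => algebraMap k E (x i)) Q, map_sum, map_sum]
    refine Finset.sum_congr rfl fun m _ => ?_
    have : ∏ i ∈ m.support, algebraMap k E (x i) ^ m i
        = algebraMap k E (∏ i ∈ m.support, x i ^ m i) := by simp
    rw [this, mul_comm, ← Algebra.smul_def, map_smul, smul_eq_mul, eval_monomial, mul_comm]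
    rfl
  refine ⟨P, ?_⟩
  refine MvPolynomial.funext_set (fun _ => Set.range (algebraMap k E))
    (fun _ => Set.infinite_range_of_injective (algebraMap k E).injective) ?_
  intro y hy
  choose x hx using fun i => hy i (Set.mem_univ i)
  obtain rfl : (fun i => algebraMap k E (x i)) = y := _root_.funext hx
  obtain ⟨z, hz⟩ := h x
  have h3 : eval (fun i => algebraMap k E (x i)) (P.map (algebraMap k E))
      = algebraMap k E (eval x P) := by
    rw [eval_map, eval₂_comp]; rfl
  rw [h3, hP, hz, hπ']

theorem eval_linForm {R : Type*} [CommRing R] {n : ℕ} (c x : Fin n → R) :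
    eval x (linForm c) = ∑ i, c i * x i := by
  simp [linForm]

theorem map_linForm {R S : Type*} [CommRing R] [CommRing S] (f : R →+* S) {n : ℕ}
    (c : Fin n → R) : (linForm c).map f = linForm (fun i => f (c i)) := by
  simp [linForm]

theorem linForm_isHomogeneous {R : Type*} [CommRing R] {n : ℕ} (c : Fin n → R) :
    (linForm c).IsHomogeneous 1 := by
  refine IsHomogeneous.sum _ _ _ fun i _ => ?_
  simpa using (isHomogeneous_C _ (c i)).mul (isHomogeneous_X R i)

theorem linForm_ne_zero {R : Type*} [CommRing R] {n : ℕ} {c : Fin n → R} {i : Fin n}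
    (h : c i ≠ 0) : linForm c ≠ 0 := by
  intro h0
  have := eval_linForm c (Pi.single i 1)
  rw [h0] at this
  simp [Pi.single_apply] at this
  exact h this.symm

theorem linForm_irreducible {K : Type*} [Field K] {n : ℕ} {c : Fin n → K} {i : Fin n}
    (h : c i ≠ 0) : Irreducible (linForm c) := by
  refine irreducible_of_totalDegree_eq_one
    ((linForm_isHomogeneous c).totalDegree (linForm_ne_zero h)) fun x hx => ?_
  rw [isUnit_iff_ne_zero]
  rintro rfl
  have h1 : coeff (Finsupp.single i 1) (linForm c) = c i := by
    simp only [linForm, coeff_sum, coeff_C_mul, coeff_X]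
    simp [Finsupp.single_left_inj]
  have := hx (Finsupp.single i 1)
  rw [h1, zero_dvd_iff] at this
  exact h this

theorem mul_eq_of_linForm_dvd {K : Type*} [Field K] {n : ℕ} {c c' : Fin n → K} 
    (h : linForm c ∣ linForm c') (i i₀ : Fin n) : c' i * c i₀ = c i * c' i₀ := by
  obtain ⟨R, hR⟩ := h
  have := congrArg (eval (Pi.single i (c i₀) - Pi.single i₀ (c i))) hR
  rw [map_mul, eval_linForm, eval_linForm] at this
  simp only [Pi.sub_apply, mul_sub, Finset.sum_sub_distrib, Pi.single_apply, mul_ite, mul_zero,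
    Finset.sum_ite_eq', Finset.mem_univ, if_true] at this
  rw [mul_comm (c i) (c i₀), sub_self, zero_mul] at this
  linear_combination this

theorem exists_norm_form {n d : ℕ} (hd : n < d)
    (F : MvPolynomial (Fin n) ℤ) (L : Fin d → Fin n → ℂ)
    (hF : IsDecomp F L) (hirr : Irreducible (F.map (Int.castRingHom ℚ)))
    (hΔ : discProd L ≠ 0) :
    ∃ K : IntermediateField ℚ ℂ, FiniteDimensional ℚ K ∧ Module.finrank ℚ K = d ∧
      ∃ (m : Fin n → K) (i₀ : Fin n) (a : ℤ), m i₀ = 1 ∧ a ≠ 0 ∧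
        (∀ x : Fin n → ℤ, ((eval x F : ℤ) : ℚ) = a * Algebra.norm ℚ (∑ i, (x i : K) * m i)) ∧
        (∀ x : Fin n → ℤ, ∑ i, (x i : K) * m i = 0 → x = 0) ∧
        (∀ τ τ' : K →ₐ[ℚ] ℂ, (∀ i, τ (m i) = τ' (m i)) → τ = τ') := by
  classical
  obtain ⟨hint, hprod⟩ := hF
  have hF0 : F.map (Int.castRingHom ℂ) ≠ 0 := by
    intro h
    have h1 : F = 0 := map_injective (Int.castRingHom ℂ) Int.cast_injective (by simpa using h)
    exact hirr.ne_zero (by simp [h1])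
  have hLne : ∀ j, ∃ i, L j i ≠ 0 := by
    intro j
    by_contra! h
    refine hF0 ?_
    rw [hprod]
    refine Finset.prod_eq_zero (Finset.mem_univ j) ?_
    simp [linForm, h]
  let j₀ : Fin d := ⟨0, by omega⟩
  obtain ⟨i₀, hi₀⟩ := hLne j₀
  let m' : Fin n → ℂ := fun i => L j₀ i / L j₀ i₀
  have hm'int : ∀ i, IsIntegral ℚ (m' i) := fun i =>
    ((hint j₀ i).tower_top.mul (hint j₀ i₀).tower_top.inv : IsIntegral ℚ (L j₀ i * (L j₀ i₀)⁻¹))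
  let K : IntermediateField ℚ ℂ := IntermediateField.adjoin ℚ (Set.range m')
  have hKfin : FiniteDimensional ℚ K := by
    refine IntermediateField.finiteDimensional_adjoin ?_
    rintro _ ⟨i, rfl⟩
    exact hm'int i
  let m : Fin n → K := fun i => ⟨m' i, IntermediateField.subset_adjoin _ _ ⟨i, rfl⟩⟩
  have hm1 : m i₀ = 1 := Subtype.ext (div_self hi₀)
  have hext : ∀ τ τ' : K →ₐ[ℚ] ℂ, (∀ i, τ (m i) = τ' (m i)) → τ = τ' := by
    intro τ τ' h
    refine IntermediateField.algHom_ext_of_eq_adjoin ℚ (S := K) (s := Set.range m') rfl ?_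
    rintro _ ⟨i, rfl⟩
    exact h i
  have hmapmap : ∀ τ : K →ₐ[ℚ] ℂ, (F.map (Int.castRingHom K)).map (τ : K →+* ℂ)
      = F.map (Int.castRingHom ℂ) := by
    intro τ
    rw [MvPolynomial.map_map]
    congr 2
    exact RingHom.ext_int _ _
  have hdvdK : linForm m ∣ F.map (Int.castRingHom K) := by
    refine dvd_of_map_dvd_map (E := ℂ) ?_
    have h2 : (F.map (Int.castRingHom K)).map (algebraMap K ℂ) = F.map (Int.castRingHom ℂ) :=
      hmapmap K.val
    rw [h2, hprod, map_linForm]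
    refine dvd_trans ?_ (Finset.dvd_prod_of_mem _ (Finset.mem_univ j₀))
    refine ⟨C (L j₀ i₀), ?_⟩
    rw [linForm, linForm, Finset.sum_mul]
    refine Finset.sum_congr rfl fun i _ => ?_
    have : L j₀ i = m' i * L j₀ i₀ := by simp [m', hi₀]
    rw [this, C_mul]
    change _ = C (m' i) * X i * _
    ring
  have hne : ∀ τ : K →ₐ[ℚ] ℂ, (fun i => τ (m i)) i₀ ≠ 0 := fun τ => by simp [hm1]
  have hdvdτ : ∀ τ : K →ₐ[ℚ] ℂ, linForm (fun i => τ (m i)) ∣ F.map (Int.castRingHom ℂ) := by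
    intro τ
    rw [← hmapmap τ]
    have := _root_.map_dvd (MvPolynomial.map (τ : K →+* ℂ)) hdvdK
    rwa [map_linForm] at this
  let P : MvPolynomial (Fin n) ℂ := ∏ τ : K →ₐ[ℚ] ℂ, linForm (fun i => τ (m i))
  have hPdvd : P ∣ F.map (Int.castRingHom ℂ) := by
    refine Finset.prod_dvd_of_isRelPrime ?_ fun τ _ => hdvdτ τ
    intro τ _ τ' _ hττ'
    rw [Function.onFun, (linForm_irreducible (hne τ)).isRelPrime_iff_not_dvd]
    intro h
    refine hττ' (hext _ _ fun i => ?_)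
    have := mul_eq_of_linForm_dvd h i i₀
    simpa [hm1] using this.symm
  have hPeval : ∀ x : Fin n → ℚ, eval (fun i => algebraMap ℚ ℂ (x i)) P
      = algebraMap ℚ ℂ (Algebra.norm ℚ (∑ i, algebraMap ℚ K (x i) * m i)) := by
    intro x
    rw [Algebra.norm_eq_prod_embeddings ℚ ℂ, eval_prod]
    refine Finset.prod_congr rfl fun τ _ => ?_
    rw [eval_linForm, map_sum]
    refine Finset.sum_congr rfl fun i _ => ?_
    rw [map_mul, AlgHom.commutes, mul_comm]
  obtain ⟨P₀, hP₀⟩ := exists_map_eq_of_eval_mem_range (k := ℚ) (E := ℂ) (Q := P)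
    fun x => ⟨_, hPeval x⟩
  have hFQ : (F.map (Int.castRingHom ℚ)).map (algebraMap ℚ ℂ) = F.map (Int.castRingHom ℂ) := by
    rw [MvPolynomial.map_map]
    congr 1
  have hPhom : P.IsHomogeneous (∑ _τ : K →ₐ[ℚ] ℂ, 1) :=
    IsHomogeneous.prod _ _ _ fun τ _ => linForm_isHomogeneous _
  have hP₀dvd : P₀ ∣ F.map (Int.castRingHom ℚ) := by
    refine dvd_of_map_dvd_map (E := ℂ) ?_
    rw [hP₀, hFQ]
    exact hPdvd
  have hPirr : ¬ IsUnit P₀ := by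
    intro h
    have h1 : IsUnit P := by
      rw [← hP₀]; exact h.map _
    have τ : K →ₐ[ℚ] ℂ := K.val
    have h2 : linForm (fun i => τ (m i)) ∣ P := Finset.dvd_prod_of_mem _ (Finset.mem_univ τ)
    exact (linForm_irreducible (hne τ)).not_isUnit (isUnit_of_dvd_unit h2 h1)
  obtain ⟨u, hu⟩ : Associated P₀ (F.map (Int.castRingHom ℚ)) :=
    ((hirr.dvd_iff.1 hP₀dvd).resolve_left hPirr).symm
  obtain ⟨a', ha'⟩ : ∃ a' : ℚ, (u : MvPolynomial (Fin n) ℚ) = C a' := by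
    have := u.isUnit
    obtain ⟨r, hr, h⟩ := MvPolynomial.isUnit_iff_eq_C_of_isReduced.1 this
    exact ⟨r, h⟩
  have hFP : F.map (Int.castRingHom ℂ) = P * C (algebraMap ℚ ℂ a') := by
    rw [← hFQ, ← hu, ha', map_mul, hP₀, map_C]
  have hFev : ∀ x : Fin n → ℤ, ((eval x F : ℤ) : ℚ)
      = a' * Algebra.norm ℚ (∑ i, (x i : K) * m i) := by
    intro x
    apply (algebraMap ℚ ℂ).injective
    have h1 : algebraMap ℚ ℂ ((eval x F : ℤ) : ℚ)
        = eval (fun i => algebraMap ℚ ℂ (x i : ℚ)) (F.map (Int.castRingHom ℂ)) := by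
      rw [eval_map]
      have := eval₂_comp (Int.castRingHom ℂ) x F
      simp only [eq_intCast, map_intCast] at this ⊢
      rw [this]
      rfl
    rw [h1, hFP, map_mul, hPeval (fun i => (x i : ℚ)), eval_C, map_mul, mul_comm]
    simp
  have haF : ((eval (Pi.single i₀ (1 : ℤ)) F : ℤ) : ℚ) = a' := by
    rw [hFev]
    simp [Pi.single_apply, hm1]
  have ha0 : a' ≠ 0 := by
    rintro rfl
    exact hF0 (by rw [hFP]; simp)
  refine ⟨K, hKfin, ?_, m, i₀, eval (Pi.single i₀ (1 : ℤ)) F, hm1, ?_, ?_, ?_, hext⟩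
  · have h1 : (F.map (Int.castRingHom ℂ)).IsHomogeneous (∑ _j : Fin d, 1) := by
      rw [hprod]
      exact IsHomogeneous.prod _ _ _ fun τ _ => linForm_isHomogeneous _
    have h2 : (F.map (Int.castRingHom ℂ)).IsHomogeneous ((∑ _τ : K →ₐ[ℚ] ℂ, 1) + 0) := by
      rw [hFP]
      exact hPhom.mul (isHomogeneous_C _ _)
    have := h1.inj_right h2 hF0
    simp only [Finset.sum_const, Finset.card_univ, Fintype.card_fin, smul_eq_mul, mul_one,
      add_zero] at this
    rw [this, AlgHom.card]
  · intro h
    rw [h] at haF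
    exact ha0 (by simpa using haF.symm)
  · intro x
    rw [haF, hFev]
  · intro x hx
    have hLx : ∀ j, ∑ i, L j i * (x i : ℂ) = 0 := by
      intro j
      obtain ⟨i₁, hi₁⟩ := hLne j
      have hp : Prime (linForm (L j)) := (linForm_irreducible hi₁).prime
      have h1 : linForm (L j) ∣ P := by
        have h2 : linForm (L j) ∣ P * C (algebraMap ℚ ℂ a') := by
          rw [← hFP, hprod]; exact Finset.dvd_prod_of_mem _ (Finset.mem_univ j)
        refine (hp.dvd_or_dvd h2).resolve_right fun h3 => ?_
        refine hp.not_isUnit (isUnit_of_dvd_unit h3 ?_)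
        exact (isUnit_iff_ne_zero.2 (by simpa using ha0)).map C
      obtain ⟨τ, -, hτ⟩ := hp.exists_mem_finset_dvd h1
      obtain ⟨R, hR⟩ := hτ
      -- τ m is proportional to L j
      have h4 : ∀ i, L j i = τ (m i) * L j i₀ := by
        intro i
        have := mul_eq_of_linForm_dvd ⟨R, hR⟩ i i₀
        simp [hm1] at this
        exact this.symm
      have h5 := congrArg τ hx
      rw [map_sum, map_zero] at h5
      calc ∑ i, L j i * (x i : ℂ) = L j i₀ * ∑ i, τ ((x i : K) * m i) := by
            rw [Finset.mul_sum]
            refine Finset.sum_congr rfl fun i _ => ?_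
            rw [h4 i, map_mul, map_intCast]; ring
        _ = 0 := by rw [h5, mul_zero]
    have hdet : Matrix.det (Matrix.of fun i j => L (Fin.castLE hd.le i) j) ≠ 0 := by
      intro h
      refine hΔ ?_
      rw [discProd]
      have hfin : Set.Finite {g : Fin n → Fin d | StrictMono g} := Set.toFinite _
      rw [finprod_mem_eq_finite_toFinset_prod _ hfin]
      refine Finset.prod_eq_zero (i := Fin.castLE hd.le) ?_ (by rw [h, norm_zero])
      simp [Fin.strictMono_castLE]
    have := Matrix.eq_zero_of_mulVec_eq_zero hdet (v := fun i => (x i : ℂ)) (by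
      ext i
      simpa [Matrix.mulVec, dotProduct] using hLx (Fin.castLE hd.le i))
    ext i
    have := congrFun this i
    simpa using this

/-- Arithmetic data attached to a norm form: `F(x)` is, up to the constant `c`, the norm of
`∑ xᵢ ωᵢ`, the conjugates of which live in the number field `M` containing a nontrivial
`k`-th root of unity. -/
structure NormData (n d k : ℕ) (F : MvPolynomial (Fin n) ℤ) (K M : Type) [Field K] [NumberField K]
    [Field M] [NumberField M] where
  σ : Fin d → NumberField.RingOfIntegers K →+* NumberField.RingOfIntegers M
  ω : Fin n → NumberField.RingOfIntegers K
  i₀ : Fin n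
  b : ℤ
  c : ℤ
  ζ : NumberField.RingOfIntegers M
  b_ne : b ≠ 0
  c_ne : c ≠ 0
  ω_i₀ : ω i₀ = b
  norm_eq : ∀ y, ((Algebra.norm ℤ y : ℤ) : NumberField.RingOfIntegers M) = ∏ j, σ j y
  σ_inj : ∀ j, Function.Injective (σ j)
  σ_ne : ∀ j j', j ≠ j' → ∃ i, σ j (ω i) ≠ σ j' (ω i)
  norm_form : ∀ x : Fin n → ℤ, Algebra.norm ℤ (∑ i, x i • ω i) = c * eval x F
  lin_indep : ∀ x : Fin n → ℤ, ∑ i, x i • ω i = 0 → x = 0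
  ζ_pow : ζ ^ k = 1
  ζ_ne : ζ ≠ 1
  finrank_eq : Module.finrank ℚ K = d

theorem exists_normData {n d k : ℕ} (hd : n < d) (hk : 2 ≤ k)
    (F : MvPolynomial (Fin n) ℤ) (L : Fin d → Fin n → ℂ)
    (hF : IsDecomp F L) (hirr : Irreducible (F.map (Int.castRingHom ℚ)))
    (hΔ : discProd L ≠ 0) :
    ∃ (K M : Type) (_ : Field K) (_ : NumberField K) (_ : Field M) (_ : NumberField M),
      Nonempty (NormData n d k F K M) := by
  classical
  obtain ⟨K, hKfin, hKd, m, i₀, a, hm1, ha, hFev, hlin, hext⟩ :=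
    exists_norm_form hd F L hF hirr hΔ
  have hKnf : NumberField K := ⟨⟩
  have hk0 : k ≠ 0 := by omega
  let z : ℂ := Complex.exp (2 * Real.pi * Complex.I / k)
  have hz : IsPrimitiveRoot z k := Complex.isPrimitiveRoot_exp k hk0
  have hzint : IsIntegral ℤ z := hz.isIntegral (by omega)
  have hfd : FiniteDimensional ℚ (IntermediateField.adjoin ℚ {z}) :=
    IntermediateField.adjoin.finiteDimensional hzint.tower_top
  let M : IntermediateField ℚ ℂ := IntermediateField.normalClosure ℚ K ℂ ⊔
    IntermediateField.adjoin ℚ {z}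
  have hMfd : FiniteDimensional ℚ M := IntermediateField.finiteDimensional_sup _ _
  have hMnf : NumberField M := ⟨⟩
  have hzM : z ∈ M := (le_sup_right : _ ≤ M) (IntermediateField.mem_adjoin_simple_self ℚ z)
  have hτM : ∀ (τ : K →ₐ[ℚ] ℂ) (y : K), τ y ∈ M := fun τ y =>
    (le_sup_left : _ ≤ M) (τ.fieldRange_le_normalClosure ⟨y, rfl⟩)
  have hcard : Fintype.card (K →ₐ[ℚ] ℂ) = d := by rw [AlgHom.card, hKd]
  let e : Fin d ≃ (K →ₐ[ℚ] ℂ) := (Fintype.equivFinOfCardEq hcard).symm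
  let s : (K →ₐ[ℚ] ℂ) → (K →ₐ[ℚ] M) := fun τ => τ.codRestrict M.toSubalgebra (hτM τ)
  let σ : Fin d → NumberField.RingOfIntegers K →+* NumberField.RingOfIntegers M := fun j =>
    NumberField.RingOfIntegers.mapRingHom (s (e j))
  have hσ : ∀ j y, (((σ j y : NumberField.RingOfIntegers M) : M) : ℂ) = e j (y : K) := by
    intro j y; rfl
  obtain ⟨b', hb', hb'int⟩ := exists_integral_multiples ℤ ℚ (Finset.univ.image m)
  have hωint : ∀ i, IsIntegral ℤ ((a * b' : ℤ) * m i : K) := by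
    intro i
    have h1 := hb'int (m i) (Finset.mem_image_of_mem _ (Finset.mem_univ i))
    have h2 := (isIntegral_algebraMap (R := ℤ) (A := K) (x := a)).mul h1
    have h3 : ((a * b' : ℤ) * m i : K) = algebraMap ℤ K a * b' • m i := by
      rw [zsmul_eq_mul, ← mul_assoc]
      simp
    rw [h3]
    exact h2
  let ω : Fin n → NumberField.RingOfIntegers K := fun i => ⟨_, hωint i⟩
  have hωc : ∀ x : Fin n → ℤ, ((∑ i, x i • ω i : NumberField.RingOfIntegers K) : K)
      = ((a * b' : ℤ) : K) * ∑ i, (x i : K) * m i := by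
    intro x
    change algebraMap (NumberField.RingOfIntegers K) K (∑ i, x i • ω i) = _
    rw [map_sum, Finset.mul_sum]
    refine Finset.sum_congr rfl fun i _ => ?_
    rw [zsmul_eq_mul, map_mul, map_intCast]
    change (x i : K) * ((a * b' : ℤ) * m i) = _
    ring
  have hab : (a * b' : ℤ) ≠ 0 := mul_ne_zero ha hb'
  have hcoe : Function.Injective (fun y : NumberField.RingOfIntegers M => ((y : M) : ℂ)) := by
    intro y y' h
    exact NumberField.RingOfIntegers.ext (Subtype.ext h)
  have hσω : ∀ j i, (((σ j (ω i) : NumberField.RingOfIntegers M) : M) : ℂ)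
      = ((a * b' : ℤ) : ℂ) * e j (m i) := by
    intro j i
    rw [hσ]
    change e j (((a * b' : ℤ) : K) * m i) = _
    rw [map_mul, map_intCast]
  have hzint' : IsIntegral ℤ (⟨z, hzM⟩ : M) := by
    rw [← isIntegral_algHom_iff (M.val.restrictScalars ℤ) Subtype.val_injective]
    exact hzint
  obtain ⟨ζ, hζ⟩ : ∃ ζ : NumberField.RingOfIntegers M, 
      ((algebraMap M ℂ).comp (algebraMap (NumberField.RingOfIntegers M) M)) ζ = z :=
    ⟨⟨⟨z, hzM⟩, hzint'⟩, rfl⟩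
  refine ⟨K, M, inferInstance, hKnf, inferInstance, hMnf, ⟨{
    σ := σ
    ω := ω
    i₀ := i₀
    b := a * b'
    c := a ^ (d - 1) * b' ^ d
    ζ := ζ
    b_ne := hab
    c_ne := mul_ne_zero (pow_ne_zero _ ha) (pow_ne_zero _ hb')
    ω_i₀ := ?_
    norm_eq := ?_
    σ_inj := fun j => ?_
    σ_ne := ?_
    norm_form := ?_
    lin_indep := ?_
    ζ_pow := ?_
    ζ_ne := ?_
    finrank_eq := hKd }⟩⟩
  · apply NumberField.RingOfIntegers.ext
    change ((a * b' : ℤ) : K) * m i₀ = _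
    rw [hm1, mul_one]
    simp
  · intro y
    apply hcoe
    have h1 := Algebra.coe_norm_int y
    have h2 := Algebra.norm_eq_prod_embeddings ℚ ℂ (y : K)
    rw [← h1] at h2
    have h3 : (((((Algebra.norm ℤ y : ℤ) : NumberField.RingOfIntegers M) : M) : ℂ))
        = algebraMap ℚ ℂ ((Algebra.norm ℤ y : ℤ) : ℚ) := by simp
    change (((((Algebra.norm ℤ y : ℤ) : NumberField.RingOfIntegers M) : M) : ℂ)) = _
    rw [h3, h2, ← e.prod_comp]
    change _ = ((algebraMap M ℂ).comp (algebraMap (NumberField.RingOfIntegers M) M)) (∏ j, σ j y)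
    rw [map_prod]
    rfl
  · intro y y' h
    have h1 := hσ j y
    rw [h, hσ] at h1
    exact NumberField.RingOfIntegers.ext ((e j).injective h1.symm)
  · intro j j' hjj'
    by_contra! h
    refine hjj' (e.injective (hext _ _ fun i => ?_))
    have := congrArg (fun y : NumberField.RingOfIntegers M => ((y : M) : ℂ)) (h i)
    simp only [hσω] at this
    exact mul_left_cancel₀ (by exact_mod_cast hab) this
  · intro x
    have h1 := Algebra.coe_norm_int (∑ i, x i • ω i)
    rw [hωc, map_mul] at h1
    have h2 : Algebra.norm ℚ (((a * b' : ℤ) : K)) = ((a * b' : ℤ) : ℚ) ^ d := by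
      have : ((a * b' : ℤ) : K) = algebraMap ℚ K ((a * b' : ℤ) : ℚ) := by simp
      rw [this, Algebra.norm_algebraMap, hKd]
    rw [h2] at h1
    have h3 : ((Algebra.norm ℤ (∑ i, x i • ω i) : ℤ) : ℚ)
        = ((a ^ (d - 1) * b' ^ d * eval x F : ℤ) : ℚ) := by
      rw [h1]
      push_cast
      rw [hFev x]
      obtain ⟨d', rfl⟩ : ∃ d', d = d' + 1 := ⟨d - 1, by omega⟩
      simp only [Nat.add_sub_cancel]
      ring
    exact_mod_cast h3
  · intro x hx
    refine hlin x ?_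
    have := hωc x
    rw [hx] at this
    exact (mul_eq_zero.1 ((map_zero (algebraMap (NumberField.RingOfIntegers K) K)).symm.trans
      this).symm).resolve_left (by exact_mod_cast hab)
  · have h1 : ((algebraMap M ℂ).comp (algebraMap (NumberField.RingOfIntegers M) M)) (ζ ^ k)
        = ((algebraMap M ℂ).comp (algebraMap (NumberField.RingOfIntegers M) M)) 1 := by
      rw [map_pow, map_one, hζ]
      exact hz.pow_eq_one
    exact hcoe h1
  · intro h
    rw [h, map_one] at hζ
    exact hz.ne_one (by omega) hζ.symm

theorem exists_abs_norm_sum_le {M : Type*} [Field M] [NumberField M] {n : ℕ}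
    (η : Fin n → NumberField.RingOfIntegers M) :
    ∃ C : ℝ, 1 ≤ C ∧ ∀ (B : ℝ) (x : Fin n → ℤ), (∀ i, |(x i : ℝ)| ≤ B) → 0 ≤ B →
      |((Algebra.norm ℤ (∑ i, x i • η i) : ℤ) : ℝ)| ≤ (C * B) ^ Module.finrank ℚ M := by
  classical
  let C : ℝ := 1 + ∑ φ : M →ₐ[ℚ] ℂ, ∑ i, ‖φ (η i : M)‖
  have hC : ∀ φ : M →ₐ[ℚ] ℂ, ∑ i, ‖φ (η i : M)‖ ≤ C := by
    intro φ
    have := Finset.single_le_sum (f := fun φ : M →ₐ[ℚ] ℂ => ∑ i, ‖φ (η i : M)‖)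
      (fun φ _ => Finset.sum_nonneg fun i _ => norm_nonneg _) (Finset.mem_univ φ)
    simp only [C]
    linarith
  refine ⟨C, ?_, fun B x hx hB => ?_⟩
  · have : 0 ≤ ∑ φ : M →ₐ[ℚ] ℂ, ∑ i, ‖φ (η i : M)‖ :=
      Finset.sum_nonneg fun φ _ => Finset.sum_nonneg fun i _ => norm_nonneg _
    simp only [C]; linarith
  have h1 : |((Algebra.norm ℤ (∑ i, x i • η i) : ℤ) : ℝ)|
      = ∏ φ : M →ₐ[ℚ] ℂ, ‖φ ((∑ i, x i • η i : NumberField.RingOfIntegers M) : M)‖ := by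
    have h2 := Algebra.norm_eq_prod_embeddings ℚ ℂ
      ((∑ i, x i • η i : NumberField.RingOfIntegers M) : M)
    rw [← Algebra.coe_norm_int] at h2
    rw [← norm_prod, ← h2]
    simp
  rw [h1, ← AlgHom.card ℚ M ℂ, Fintype.card, ← Finset.prod_const]
  refine Finset.prod_le_prod (fun φ _ => norm_nonneg _) fun φ _ => ?_
  have h3 : φ ((∑ i, x i • η i : NumberField.RingOfIntegers M) : M)
      = ∑ i, (x i : ℂ) * φ (η i : M) := by
    change (φ : M →+* ℂ) (algebraMap (NumberField.RingOfIntegers M) M (∑ i, x i • η i)) = _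
    rw [map_sum, map_sum]
    refine Finset.sum_congr rfl fun i _ => ?_
    rw [zsmul_eq_mul, map_mul, map_mul, map_intCast, map_intCast]
    rfl
  rw [h3]
  calc ‖∑ i, (x i : ℂ) * φ (η i : M)‖ ≤ ∑ i, B * ‖φ (η i : M)‖ := by
        refine norm_sum_le_of_le _ fun i _ => ?_
        rw [norm_mul]
        refine mul_le_mul_of_nonneg_right ?_ (norm_nonneg _)
        simpa using hx i
    _ = B * ∑ i, ‖φ (η i : M)‖ := by rw [Finset.mul_sum]
    _ ≤ C * B := by rw [mul_comm]; exact mul_le_mul_of_nonneg_right (hC φ) hB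

/-- The integer points of a box with one coordinate set to zero. -/
theorem card_box_slice_le {n : ℕ} (i₀ : Fin n) (B : ℝ) (hB : 1 ≤ B)
    (T : Finset (Fin n → ℤ)) (hT : ∀ x ∈ T, (∀ i, |(x i : ℝ)| ≤ B) ∧ x i₀ = 0) :
    (T.card : ℝ) ≤ (3 * B) ^ (n - 1) := by
  classical
  let N : ℤ := ⌊B⌋
  have hsub : T ⊆ Fintype.piFinset (fun i => if i = i₀ then {0} else Finset.Icc (-N) N) := by
    intro x hx
    rw [Fintype.mem_piFinset]
    intro i
    split_ifs with h
    · subst h; simpa using (hT x hx).2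
    · have h1 := abs_le.1 ((hT x hx).1 i)
      rw [Finset.mem_Icc]
      have h2 : x i ≤ N := Int.le_floor.2 h1.2
      have h3 : -x i ≤ N := Int.le_floor.2 (by push_cast; linarith)
      constructor <;> linarith
  have hN : (N : ℝ) ≤ B := Int.floor_le B
  have hN0 : 0 ≤ N := Int.floor_nonneg.2 (by linarith)
  have hc : (Fintype.piFinset (fun i => if i = i₀ then {0} else Finset.Icc (-N) N)).card
      = (2 * N + 1).toNat ^ (n - 1) := by
    rw [Fintype.card_piFinset]
    rw [← Finset.mul_prod_erase _ _ (Finset.mem_univ i₀)]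
    rw [Finset.prod_congr rfl (g := fun _ => (2 * N + 1).toNat)]
    · simp
    · intro i hi
      rw [if_neg (Finset.ne_of_mem_erase hi), Int.card_Icc]
      congr 1; ring
  calc (T.card : ℝ) ≤ (((2 * N + 1).toNat ^ (n - 1) : ℕ) : ℝ) := by
        rw [← hc]; exact_mod_cast Finset.card_le_card hsub
    _ = ((2 * N + 1 : ℤ) : ℝ) ^ (n - 1) := by
        push_cast
        congr 1
        have : (((2 * N + 1).toNat : ℤ) : ℝ) = ((2 * N + 1 : ℤ) : ℝ) := by
          rw [Int.toNat_of_nonneg (by linarith)]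
        push_cast at this
        exact this
    _ ≤ (3 * B) ^ (n - 1) := by
        refine pow_le_pow_left₀ (by exact_mod_cast (by linarith : (0:ℤ) ≤ 2 * N + 1)) ?_ _
        push_cast; linarith

theorem card_box_le {n : ℕ} (B : ℝ) (hB : 1 ≤ B)
    (T : Finset (Fin n → ℤ)) (hT : ∀ x ∈ T, ∀ i, |(x i : ℝ)| ≤ B) :
    (T.card : ℝ) ≤ (3 * B) ^ n := by
  classical
  let f : (Fin n → ℤ) → (Fin (n + 1) → ℤ) := fun x => Fin.cons 0 x
  have hf : Function.Injective f := fun x y h => by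
    funext i
    simpa [f] using congrFun h i.succ
  have := card_box_slice_le (0 : Fin (n + 1)) B hB (T.image f) (by
    intro y hy
    obtain ⟨x, hx, rfl⟩ := Finset.mem_image.1 hy
    refine ⟨fun i => ?_, by simp [f]⟩
    refine Fin.cases ?_ (fun i => ?_) i
    · simp [f]; linarith
    · simpa [f] using hT x hx i)
  rwa [Finset.card_image_of_injective _ hf, Nat.add_sub_cancel] at this

theorem finite_box {n : ℕ} (B : ℝ) : {x : Fin n → ℤ | ∀ i, |(x i : ℝ)| ≤ B}.Finite := by
  refine (Set.Finite.pi' (t := fun _ => (Set.Icc (-⌊B⌋) ⌊B⌋ : Set ℤ))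
    fun _ => Set.finite_Icc _ _).subset fun x hx i => ?_
  have h1 := abs_le.1 (hx i)
  have h2 : x i ≤ ⌊B⌋ := Int.le_floor.2 h1.2
  have h3 : -x i ≤ ⌊B⌋ := Int.le_floor.2 (by push_cast; linarith)
  constructor <;> linarith

theorem prime_card_le_of_dvd {B : ℝ} (hB : 1 < B) {N : ℤ} (hN : N ≠ 0) {g : ℕ}
    (hNB : |(N : ℝ)| ≤ B ^ g) (T : Finset ℕ) (hT : ∀ q ∈ T, q.Prime ∧ B < q ∧ (q : ℤ) ∣ N) :
    T.card ≤ g := by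
  have h1 : ∏ q ∈ T, q ∣ N.natAbs :=
    Finset.prod_primes_dvd _ (fun q hq => (hT q hq).1.prime)
      fun q hq => by
        have := (hT q hq).2.2
        exact Int.natCast_dvd.1 this
  have h2 := Nat.le_of_dvd (Int.natAbs_pos.2 hN) h1
  have h3 : B ^ T.card ≤ B ^ g := by
    calc B ^ T.card = ∏ q ∈ T, B := by rw [Finset.prod_const]
      _ ≤ ∏ q ∈ T, (q : ℝ) := Finset.prod_le_prod (fun _ _ => by linarith)
          fun q hq => (hT q hq).2.1.le
      _ = ((∏ q ∈ T, q : ℕ) : ℝ) := by push_cast; rfl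
      _ ≤ (N.natAbs : ℝ) := by exact_mod_cast h2
      _ = |(N : ℝ)| := by rw [Nat.cast_natAbs]; push_cast; rfl
      _ ≤ B ^ g := hNB
  exact (pow_le_pow_iff_right₀ hB).1 h3

/-- The additive map `x ↦ ∑ xᵢ ωᵢ`. -/
def NormData.lin {n d k : ℕ} {F : MvPolynomial (Fin n) ℤ} {K M : Type} [Field K] [NumberField K]
    [Field M] [NumberField M] (D : NormData n d k F K M) :
    (Fin n → ℤ) →+ NumberField.RingOfIntegers K where
  toFun x := ∑ i, x i • D.ω i
  map_zero' := by simp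
  map_add' x y := by simp [add_smul, Finset.sum_add_distrib]

theorem NormData.lin_apply {n d k : ℕ} {F : MvPolynomial (Fin n) ℤ} {K M : Type} [Field K]
    [NumberField K] [Field M] [NumberField M] (D : NormData n d k F K M) (x : Fin n → ℤ) :
    D.lin x = ∑ i, x i • D.ω i := rfl

theorem NormData.lin_injective {n d k : ℕ} {F : MvPolynomial (Fin n) ℤ} {K M : Type} [Field K]
    [NumberField K] [Field M] [NumberField M] (D : NormData n d k F K M) :
    Function.Injective D.lin :=
  (injective_iff_map_eq_zero D.lin).2 fun x hx => D.lin_indep x hx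

/-- A prime ideal containing a rational prime `q` meets the integers in the multiples of `q`. -/
theorem int_mem_prime_iff {R : Type*} [CommRing R] {I : Ideal R} (hI : I.IsPrime) {q : ℕ}
    (hq : q.Prime) (hqI : (q : R) ∈ I) (z : ℤ) : (z : R) ∈ I ↔ (q : ℤ) ∣ z := by
  constructor
  · intro hz
    by_contra h
    have hc : IsCoprime (q : ℤ) z :=
      (Nat.prime_iff_prime_int.1 hq).coprime_iff_not_dvd.2 h
    obtain ⟨a, b, hab⟩ := hc
    refine hI.ne_top ((Ideal.eq_top_iff_one _).2 ?_)
    have : (1 : R) = a * q + b * z := by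
      have := congrArg (fun t : ℤ => (t : R)) hab
      push_cast at this
      exact this.symm
    rw [this]
    exact I.add_mem (I.mul_mem_left _ hqI) (I.mul_mem_left _ hz)
  · rintro ⟨t, rfl⟩
    push_cast
    exact I.mul_mem_right _ hqI

theorem int_dvd_norm_of_mem {M : Type*} [Field M] [NumberField M]
    {I : Ideal (NumberField.RingOfIntegers M)} (hI : I.IsPrime) {q : ℕ}
    (hq : q.Prime) (hqI : (q : NumberField.RingOfIntegers M) ∈ I)
    {y : NumberField.RingOfIntegers M} (hy : y ∈ I) : (q : ℤ) ∣ Algebra.norm ℤ y := by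
  rw [← int_mem_prime_iff hI hq hqI]
  have h1 := Ideal.absNorm_mem (Ideal.span {y})
  rw [Ideal.absNorm_span_singleton] at h1
  have h2 : ((Algebra.norm ℤ y).natAbs : NumberField.RingOfIntegers M) ∈ I :=
    (Ideal.span_singleton_le_iff_mem I).2 hy h1
  rcases Int.natAbs_eq (Algebra.norm ℤ y) with h | h
  · rw [h, Int.cast_natCast]; exact h2
  · rw [h, Int.cast_neg, Int.cast_natCast]; exact I.neg_mem h2

section
variable {n d k : ℕ} {F : MvPolynomial (Fin n) ℤ} {K M : Type} [Field K] [NumberField K]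
    [Field M] [NumberField M]

theorem NormData.exists_card_bad_pair_le (D : NormData n d k F K M) (hn : 2 ≤ n)
    (𝔔 : ℕ → Ideal (NumberField.RingOfIntegers M))
    (h𝔔 : ∀ q : ℕ, q.Prime → (𝔔 q).IsPrime ∧ (q : NumberField.RingOfIntegers M) ∈ 𝔔 q)
    (j j' : Fin d) (hjj' : j ≠ j') :
    ∃ C B₀ : ℝ, 1 ≤ C ∧ 1 ≤ B₀ ∧ ∀ B, B₀ ≤ B → ∀ T : Finset (Fin n → ℤ),
      (∀ x ∈ T, (∀ i, |(x i : ℝ)| ≤ B) ∧ ∃ q : ℕ, q.Prime ∧ B ^ n < q ∧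
        D.σ j (D.lin x) ∈ 𝔔 q ∧ D.σ j' (D.lin x) ∈ 𝔔 q) →
      (T.card : ℝ) ≤ C * B ^ (n - 1) := by
  classical
  obtain ⟨i₁, hi₁⟩ := D.σ_ne j j' hjj'
  let η : Fin n → NumberField.RingOfIntegers M := fun i => D.σ j (D.ω i) - D.σ j' (D.ω i)
  have hη₀ : η D.i₀ = 0 := by simp [η, D.ω_i₀]
  have hη : ∀ x, D.σ j (D.lin x) - D.σ j' (D.lin x) = ∑ i, x i • η i := by
    intro x
    simp [η, D.lin_apply, smul_sub, Finset.sum_sub_distrib]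
  obtain ⟨C₁, hC₁, hnorm⟩ := exists_abs_norm_sum_le η
  let g := Module.finrank ℚ M
  refine ⟨3 ^ (n - 1) * (g + 1), max (max 3 C₁) (|(D.b : ℝ)| + 1), ?_, ?_, ?_⟩
  · have h1 : (1 : ℝ) ≤ 3 ^ (n - 1) := one_le_pow₀ (by norm_num)
    have h2 : (0 : ℝ) ≤ g := Nat.cast_nonneg _
    nlinarith
  · exact le_max_of_le_left (le_max_of_le_left (by norm_num))
  intro B hB T hT
  have hB3 : 3 ≤ B := le_trans (le_max_of_le_left (le_max_left _ _)) hB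
  have hBC : C₁ ≤ B := le_trans (le_max_of_le_left (le_max_right _ _)) hB
  have hBb : |(D.b : ℝ)| + 1 ≤ B := le_trans (le_max_right _ _) hB
  have hBn : B ^ 2 ≤ B ^ n := pow_le_pow_right₀ (by linarith) hn
  have hpow : (3 * B) ^ (n - 1) = 3 ^ (n - 1) * B ^ (n - 1) := mul_pow _ _ _
  let δ : (Fin n → ℤ) → NumberField.RingOfIntegers M := fun x => ∑ i, x i • η i
  have hδupd : ∀ x i, δ (Function.update x i 0) = δ x - x i • η i := by
    intro x i
    simp only [δ]
    rw [← Finset.add_sum_erase _ _ (Finset.mem_univ i),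
      ← Finset.add_sum_erase _ (fun i => x i • η i) (Finset.mem_univ i)]
    rw [Finset.sum_congr rfl (g := fun i => x i • η i)]
    · simp
    · intro i' hi'
      rw [Function.update_of_ne (Finset.ne_of_mem_erase hi')]
  have hbox : ∀ (i : Fin n) (x : Fin n → ℤ), (∀ i, |(x i : ℝ)| ≤ B) → ∀ i',
      |((Function.update x i 0 i' : ℤ) : ℝ)| ≤ B := by
    intro i x hx i'
    by_cases h : i' = i
    · subst h; simp; linarith
    · rw [Function.update_of_ne h]; exact hx i'
  have hT0 : ((T.filter (fun x => δ x = 0)).card : ℝ) ≤ (3 * B) ^ (n - 1) := by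
    rw [← Finset.card_image_of_injOn (f := fun x => Function.update x i₁ 0)]
    · refine card_box_slice_le i₁ B (by linarith) _ ?_
      intro y hy
      obtain ⟨x, hx, rfl⟩ := Finset.mem_image.1 hy
      exact ⟨hbox _ x (hT x (Finset.mem_filter.1 hx).1).1, by simp⟩
    · intro x hx y hy hxy
      have hx' := (Finset.mem_filter.1 hx).2
      have hy' := (Finset.mem_filter.1 hy).2
      have h1 := hδupd x i₁
      have h2 := hδupd y i₁
      simp only at hxy
      rw [hxy, h2, hx', hy', zero_sub, zero_sub, neg_inj] at h1
      have h3 : y i₁ = x i₁ := by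
        have : (y i₁ - x i₁) • η i₁ = 0 := by rw [sub_smul, h1, sub_self]
        rcases smul_eq_zero.1 this with h | h
        · linarith
        · exact absurd (sub_eq_zero.1 h) hi₁
      have h4 := congrArg (fun z => Function.update z i₁ (x i₁)) hxy
      simp only [Function.update_idem] at h4
      rw [Function.update_eq_self] at h4
      rw [h4, ← h3, Function.update_eq_self]
  have hT1 : ((T.filter (fun x => δ x ≠ 0)).card : ℝ) ≤ g * (3 * B) ^ (n - 1) := by
    have hQ : ∀ x : Fin n → ℤ, ∃ q : ℕ, x ∈ T → q.Prime ∧ B ^ n < q ∧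
        D.σ j (D.lin x) ∈ 𝔔 q ∧ D.σ j' (D.lin x) ∈ 𝔔 q := by
      intro x
      by_cases hx : x ∈ T
      · obtain ⟨q, hq⟩ := (hT x hx).2
        exact ⟨q, fun _ => hq⟩
      · exact ⟨0, fun h => absurd h hx⟩
    choose Q hQ using hQ
    have hfib := Finset.card_le_mul_card_image (f := fun x => Function.update x D.i₀ (0 : ℤ))
      (T.filter (fun x => δ x ≠ 0)) g (by
        intro y hy
        rw [← Finset.card_image_of_injOn (f := Q)]
        · obtain ⟨x₀, hx₀, hx₀y⟩ := Finset.mem_image.1 hy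
          have hδy : δ y = δ x₀ := by
            rw [← hx₀y, hδupd, hη₀, smul_zero, sub_zero]
          have hx₀' := Finset.mem_filter.1 hx₀
          refine prime_card_le_of_dvd (B := B ^ 2) (by nlinarith) (N := Algebra.norm ℤ (δ x₀))
            ?_ ?_ _ ?_
          · rw [Algebra.norm_ne_zero_iff]; exact hx₀'.2
          · refine (hnorm B x₀ (hT x₀ hx₀'.1).1 (by linarith)).trans ?_
            refine pow_le_pow_left₀ (by nlinarith) (by nlinarith) _
          · intro q hq
            obtain ⟨x, hx, rfl⟩ := Finset.mem_image.1 hq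
            have hx1 := Finset.mem_filter.1 hx
            have hxT := (Finset.mem_filter.1 hx1.1).1
            obtain ⟨h1, h2, h3, h4⟩ := hQ x hxT
            refine ⟨h1, by linarith, ?_⟩
            have hδx : δ x = δ x₀ := by
              rw [← hδy, ← hx1.2, hδupd, hη₀, smul_zero, sub_zero]
            rw [← hδx]
            refine int_dvd_norm_of_mem (h𝔔 _ h1).1 h1 (h𝔔 _ h1).2 ?_
            rw [show δ x = _ from (hη x).symm]
            exact (𝔔 _).sub_mem h3 h4
        · intro x hx x' hx' hxx'
          have hx1 := Finset.mem_filter.1 (Finset.mem_coe.1 hx)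
          have hx1' := Finset.mem_filter.1 (Finset.mem_coe.1 hx')
          have hxT := (Finset.mem_filter.1 hx1.1).1
          have hxT' := (Finset.mem_filter.1 hx1'.1).1
          obtain ⟨h1, h2, h3, -⟩ := hQ x hxT
          obtain ⟨-, -, h3', -⟩ := hQ x' hxT'
          rw [← hxx'] at h3'
          have hup : Function.update x D.i₀ 0 = Function.update x' D.i₀ 0 := hx1.2.trans hx1'.2.symm
          have hdiff : x - x' = Pi.single D.i₀ (x D.i₀ - x' D.i₀) := by
            funext i
            by_cases hi : i = D.i₀
            · subst hi; simp
            · have := congrFun hup i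
              rw [Function.update_of_ne hi, Function.update_of_ne hi] at this
              simp [hi, this]
          have hlin : D.lin (x - x') = ((D.b * (x D.i₀ - x' D.i₀) : ℤ) :
              NumberField.RingOfIntegers K) := by
            rw [hdiff, D.lin_apply, Finset.sum_eq_single D.i₀]
            · rw [Pi.single_eq_same, D.ω_i₀, zsmul_eq_mul]; push_cast; ring
            · intro i _ hi; simp [hi]
            · simp
          have hmem : D.σ j (D.lin (x - x')) ∈ 𝔔 (Q x) := by
            rw [map_sub, map_sub]; exact (𝔔 _).sub_mem h3 h3'
          rw [hlin, map_intCast, int_mem_prime_iff (h𝔔 _ h1).1 h1 (h𝔔 _ h1).2] at hmem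
          have hBq : B ^ 2 < (Q x : ℝ) := lt_of_le_of_lt hBn h2
          have hsmall : ∀ z : ℤ, |(z : ℝ)| ≤ B ^ 2 → (Q x : ℤ) ∣ z → z = 0 := by
            intro z hz hdvd
            refine Int.eq_zero_of_abs_lt_dvd hdvd ?_
            have : |(z : ℝ)| < (Q x : ℝ) := by linarith
            exact_mod_cast this
          have hz : x D.i₀ - x' D.i₀ = 0 := by
            rcases (Nat.prime_iff_prime_int.1 h1).dvd_or_dvd hmem with h | h
            · exact absurd (hsmall _ (by nlinarith) h) D.b_ne
            · refine hsmall _ ?_ h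
              have e1 := (hT x hxT).1 D.i₀
              have e2 := (hT x' hxT').1 D.i₀
              push_cast
              have := abs_sub (x D.i₀ : ℝ) (x' D.i₀)
              nlinarith
          rw [hz, Pi.single_zero] at hdiff
          exact sub_eq_zero.1 hdiff)
    calc ((T.filter (fun x => δ x ≠ 0)).card : ℝ)
        ≤ ((g * ((T.filter (fun x => δ x ≠ 0)).image
            (fun x => Function.update x D.i₀ (0 : ℤ))).card : ℕ) : ℝ) := by exact_mod_cast hfib
      _ ≤ g * (3 * B) ^ (n - 1) := by
          push_cast
          refine mul_le_mul_of_nonneg_left ?_ (Nat.cast_nonneg _)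
          refine card_box_slice_le D.i₀ B (by linarith) _ ?_
          intro y hy
          obtain ⟨x, hx, rfl⟩ := Finset.mem_image.1 hy
          exact ⟨hbox _ x (hT x (Finset.mem_filter.1 hx).1).1, by simp⟩
  have hsum := Finset.card_filter_add_card_filter_not (s := T) (fun x => δ x = 0)
  have hsum' : (T.card : ℝ) = ((T.filter (fun x => δ x = 0)).card : ℝ)
      + ((T.filter (fun x => δ x ≠ 0)).card : ℝ) := by exact_mod_cast hsum.symm
  rw [hsum']
  calc _ ≤ (3 * B) ^ (n - 1) + g * (3 * B) ^ (n - 1) := add_le_add hT0 hT1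
    _ = _ := by rw [hpow]; ring

theorem NormData.exists_card_bad_le (D : NormData n d k F K M) (hn : 2 ≤ n)
    (𝔔 : ℕ → Ideal (NumberField.RingOfIntegers M))
    (h𝔔 : ∀ q : ℕ, q.Prime → (𝔔 q).IsPrime ∧ (q : NumberField.RingOfIntegers M) ∈ 𝔔 q) :
    ∃ C B₀ : ℝ, 0 ≤ C ∧ 1 ≤ B₀ ∧ ∀ B, B₀ ≤ B → ∀ T : Finset (Fin n → ℤ),
      (∀ x ∈ T, (∀ i, |(x i : ℝ)| ≤ B) ∧ ∃ q : ℕ, q.Prime ∧ B ^ n < q ∧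
        ∃ j j', j ≠ j' ∧ D.σ j (D.lin x) ∈ 𝔔 q ∧ D.σ j' (D.lin x) ∈ 𝔔 q) →
      (T.card : ℝ) ≤ C * B ^ (n - 1) := by
  classical
  have h : ∀ e : Fin d × Fin d, ∃ C B₀ : ℝ, 1 ≤ C ∧ 1 ≤ B₀ ∧ (e.1 ≠ e.2 → ∀ B, B₀ ≤ B →
      ∀ T : Finset (Fin n → ℤ),
      (∀ x ∈ T, (∀ i, |(x i : ℝ)| ≤ B) ∧ ∃ q : ℕ, q.Prime ∧ B ^ n < q ∧
        D.σ e.1 (D.lin x) ∈ 𝔔 q ∧ D.σ e.2 (D.lin x) ∈ 𝔔 q) →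
      (T.card : ℝ) ≤ C * B ^ (n - 1)) := by
    intro e
    by_cases he : e.1 = e.2
    · exact ⟨1, 1, le_rfl, le_rfl, fun h => absurd he h⟩
    · obtain ⟨C, B₀, h1, h2, h3⟩ := D.exists_card_bad_pair_le hn 𝔔 h𝔔 e.1 e.2 he
      exact ⟨C, B₀, h1, h2, fun _ => h3⟩
  choose C B₀ hC hB₀ hT using h
  refine ⟨∑ e, C e, 1 + ∑ e, B₀ e, Finset.sum_nonneg fun e _ => by linarith [hC e], ?_, ?_⟩
  · have : 0 ≤ ∑ e, B₀ e := Finset.sum_nonneg fun e _ => by linarith [hB₀ e]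
    linarith
  intro B hB T hTb
  let P : Fin d × Fin d → (Fin n → ℤ) → Prop := fun e x => e.1 ≠ e.2 ∧ ∃ q : ℕ, q.Prime ∧
    B ^ n < q ∧ D.σ e.1 (D.lin x) ∈ 𝔔 q ∧ D.σ e.2 (D.lin x) ∈ 𝔔 q
  have hsub : T ⊆ Finset.univ.biUnion fun e => T.filter (P e) := by
    intro x hx
    obtain ⟨-, q, h1, h2, j, j', h3, h4, h5⟩ := hTb x hx
    rw [Finset.mem_biUnion]
    exact ⟨(j, j'), Finset.mem_univ _, Finset.mem_filter.2 ⟨hx, h3, q, h1, h2, h4, h5⟩⟩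
  have hB0 : 0 ≤ ∑ e, B₀ e := Finset.sum_nonneg fun e _ => by linarith [hB₀ e]
  calc (T.card : ℝ) ≤ ((∑ e, (T.filter (P e)).card : ℕ) : ℝ) := by
        exact_mod_cast (Finset.card_le_card hsub).trans Finset.card_biUnion_le
    _ = ∑ e, ((T.filter (P e)).card : ℝ) := by push_cast; rfl
    _ ≤ ∑ e, C e * B ^ (n - 1) := by
        refine Finset.sum_le_sum fun e _ => ?_
        by_cases he : e.1 = e.2
        · have : T.filter (P e) = ∅ := Finset.filter_eq_empty_iff.2 fun x _ hx => hx.1 he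
          rw [this]
          have : 0 ≤ B := by linarith
          have := hC e
          simp only [Finset.card_empty, Nat.cast_zero]
          positivity
        · refine hT e he B ?_ _ ?_
          · have := Finset.single_le_sum (f := B₀) (fun e _ => by linarith [hB₀ e])
              (Finset.mem_univ e)
            linarith
          · intro x hx
            have hx' := Finset.mem_filter.1 hx
            exact ⟨(hTb x hx'.1).1, hx'.2.2⟩
    _ = _ := by rw [Finset.sum_mul]
end

section
variable {n d k : ℕ} {F : MvPolynomial (Fin n) ℤ} {K M : Type} [Field K] [NumberField K]
    [Field M] [NumberField M]

theorem NormData.norm_lin (D : NormData n d k F K M) (x : Fin n → ℤ) :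
    Algebra.norm ℤ (D.lin x) = D.c * eval x F := D.norm_form x

theorem NormData.exists_ideal_factor (D : NormData n d k F K M)
    (𝔔 : Ideal (NumberField.RingOfIntegers M)) {q : ℕ} (hq : q.Prime)
    (h𝔔 : 𝔔.IsPrime) (hq𝔔 : (q : NumberField.RingOfIntegers M) ∈ 𝔔) (hk : 1 ≤ k)
    {x : Fin n → ℤ} {u : ℕ} (hu : (eval x F).natAbs = u * q ^ k) (hqu : ¬ q ∣ u)
    (hqc : ¬ (q : ℤ) ∣ D.c)
    (hbad : ∀ j j', j ≠ j' → D.σ j (D.lin x) ∈ 𝔔 → D.σ j' (D.lin x) ∉ 𝔔) :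
    ∃ 𝔠 𝔭 : Ideal (NumberField.RingOfIntegers K), Ideal.span {D.lin x} = 𝔠 * 𝔭 ^ k ∧
      Ideal.absNorm 𝔠 = D.c.natAbs * u := by
  classical
  have hu0 : u ≠ 0 := by rintro rfl; exact hqu (dvd_zero _)
  have hFx : eval x F ≠ 0 := by
    intro h
    rw [h, Int.natAbs_zero] at hu
    exact mul_ne_zero hu0 (pow_ne_zero _ hq.ne_zero) hu.symm
  have hdvdF : (q : ℤ) ^ k ∣ eval x F := by
    rw [← Int.dvd_natAbs, hu]
    push_cast
    exact dvd_mul_left _ _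
  have hnorm := D.norm_lin x
  have hqN : (q : ℤ) ^ k ∣ Algebra.norm ℤ (D.lin x) := by
    rw [hnorm]; exact hdvdF.mul_left _
  have hξ0 : D.lin x ≠ 0 := by
    intro h
    rw [h, Algebra.norm_zero] at hnorm
    exact mul_ne_zero D.c_ne hFx hnorm.symm
  have hprod := D.norm_eq (D.lin x)
  obtain ⟨j, hj⟩ : ∃ j, D.σ j (D.lin x) ∈ 𝔔 := by
    have h1 : ∏ j, D.σ j (D.lin x) ∈ 𝔔 := by
      rw [← hprod, int_mem_prime_iff h𝔔 hq hq𝔔]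
      exact (dvd_pow_self _ (by omega)).trans hqN
    obtain ⟨j, -, hj⟩ := (h𝔔.prod_mem_iff).1 h1
    exact ⟨j, hj⟩
  obtain ⟨𝔭, h𝔭⟩ : ∃ 𝔭, 𝔭 = 𝔔.comap (D.σ j) := ⟨_, rfl⟩
  have h𝔭prime : 𝔭.IsPrime := by rw [h𝔭]; exact Ideal.comap_isPrime _ _
  have hq𝔭 : (q : NumberField.RingOfIntegers K) ∈ 𝔭 := by
    rw [h𝔭, Ideal.mem_comap, map_natCast]; exact hq𝔔
  obtain ⟨η, hη⟩ : D.lin x ∣ ((Algebra.norm ℤ (D.lin x) : ℤ) : NumberField.RingOfIntegers K) := by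
    have h1 := Ideal.absNorm_mem (Ideal.span {D.lin x})
    rw [Ideal.absNorm_span_singleton, Ideal.mem_span_singleton] at h1
    rcases Int.natAbs_eq (Algebra.norm ℤ (D.lin x)) with h | h
    · rw [h, Int.cast_natCast]; exact h1
    · rw [h, Int.cast_neg, Int.cast_natCast]; exact (dvd_neg).2 h1
  have hη𝔭 : η ∉ 𝔭 := by
    rw [h𝔭, Ideal.mem_comap]
    have h1 := congrArg (D.σ j) hη
    rw [map_intCast, hprod, map_mul, ← Finset.mul_prod_erase _ _ (Finset.mem_univ j)] at h1
    have h2 := mul_left_cancel₀ (by rwa [Ne, map_eq_zero_iff _ (D.σ_inj j)]) h1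
    rw [← h2]
    intro h3
    obtain ⟨j', hj', hj'm⟩ := (h𝔔.prod_mem_iff).1 h3
    exact hbad j j' (Finset.ne_of_mem_erase hj').symm hj hj'm
  have hξ𝔭 : D.lin x ∈ 𝔭 ^ k := by
    have h1 : η * D.lin x ∈ 𝔭 ^ k := by
      rw [mul_comm, ← hη]
      obtain ⟨t, ht⟩ := hqN
      rw [ht]
      push_cast
      exact Ideal.mul_mem_right _ _ (Ideal.pow_mem_pow hq𝔭 k)
    exact (h𝔭prime.mul_mem_pow 𝔭 h1).resolve_left hη𝔭
  obtain ⟨𝔠, h𝔠⟩ := Ideal.dvd_span_singleton.2 hξ𝔭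
  have habs : D.c.natAbs * (u * q ^ k) = Ideal.absNorm 𝔭 ^ k * Ideal.absNorm 𝔠 := by
    rw [← map_pow, ← map_mul, ← h𝔠, Ideal.absNorm_span_singleton, hnorm, Int.natAbs_mul, hu]
  obtain ⟨f, hf, hNp⟩ : ∃ f, f ≠ 0 ∧ Ideal.absNorm 𝔭 = q ^ f := by
    have h1 : Ideal.absNorm 𝔭 ∣ q ^ Module.finrank ℚ K := by
      have h2 := Ideal.absNorm_dvd_norm_of_mem hq𝔭
      have h3 : Algebra.norm ℤ (q : NumberField.RingOfIntegers K) = (q : ℤ) ^ Module.finrank ℚ K := by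
        have := Algebra.norm_algebraMap (S := NumberField.RingOfIntegers K) (R := ℤ) (q : ℤ)
        rw [NumberField.RingOfIntegers.rank] at this
        simpa using this
      rw [h3] at h2
      exact_mod_cast h2
    obtain ⟨f, -, hf⟩ := (Nat.dvd_prime_pow hq).1 h1
    refine ⟨f, ?_, hf⟩
    rintro rfl
    rw [pow_zero, Ideal.absNorm_eq_one_iff] at hf
    exact h𝔭prime.ne_top hf
  have hqcu : ¬ q ∣ D.c.natAbs * u := by
    intro h
    rcases hq.dvd_mul.1 h with h | h
    · exact hqc (Int.natCast_dvd.2 h)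
    · exact hqu h
  have hf1 : f = 1 := by
    by_contra hne
    have h2f : 2 ≤ f := by omega
    have h3 : q ^ k * q ∣ (D.c.natAbs * u) * q ^ k := by
      rw [mul_assoc, habs, hNp, ← pow_mul, ← pow_succ]
      refine (pow_dvd_pow q ?_).trans (dvd_mul_right _ _)
      nlinarith
    rw [mul_comm (q ^ k)] at h3
    exact hqcu (Nat.dvd_of_mul_dvd_mul_right (pow_pos hq.pos k) h3)
  refine ⟨𝔠, 𝔭, by rw [h𝔠, mul_comm], ?_⟩
  rw [hNp, hf1, pow_one, ← mul_assoc, mul_comm (q ^ k)] at habs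
  exact (Nat.eq_of_mul_eq_mul_right (pow_pos hq.pos k) habs).symm
end

section
variable {n d k : ℕ} {F : MvPolynomial (Fin n) ℤ} {K M : Type} [Field K] [NumberField K]
    [Field M] [NumberField M]

theorem int_dvd_norm_of_map_eq_zero {M : Type*} [Field M] [NumberField M] {p : ℕ} (hp : p.Prime)
    (ψ : NumberField.RingOfIntegers M →+* ZMod p) {y : NumberField.RingOfIntegers M}
    (hy : ψ y = 0) : (p : ℤ) ∣ Algebra.norm ℤ y := by
  have : Fact p.Prime := ⟨hp⟩
  exact int_dvd_norm_of_mem (RingHom.ker_isPrime ψ) hp (by simp [RingHom.mem_ker])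
    (RingHom.mem_ker.2 hy)

theorem map_ne_zero_of_norm_lt {M : Type*} [Field M] [NumberField M] {p : ℕ} (hp : p.Prime)
    (ψ : NumberField.RingOfIntegers M →+* ZMod p) {y : NumberField.RingOfIntegers M}
    (hy : y ≠ 0) (hlt : |((Algebra.norm ℤ y : ℤ) : ℝ)| < p) : ψ y ≠ 0 := by
  intro h
  have h1 := int_dvd_norm_of_map_eq_zero hp ψ h
  have h2 : Algebra.norm ℤ y = 0 := Int.eq_zero_of_abs_lt_dvd h1 (by exact_mod_cast hlt)
  exact (Algebra.norm_ne_zero_iff.2 hy) h2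

theorem NormData.exists_map_lin_ne_zero (D : NormData n d k F K M) {p : ℕ} (hp : p.Prime)
    (ψ : NumberField.RingOfIntegers M →+* ZMod p) (j₀ j₁ : Fin d) (i₁ : Fin n)
    (hψ : ψ (D.σ j₀ (D.ω i₁) - D.σ j₁ (D.ω i₁)) ≠ 0) (hpb : ¬ (p : ℤ) ∣ D.b)
    {v : Fin n → ℤ} (hv : ¬ (p : ℤ) ∣ Algebra.norm ℤ (D.lin v) ∨
      (n = 2 ∧ ∃ i, ¬ (p : ℤ) ∣ v i)) :
    ∃ j, ψ (D.σ j (D.lin v)) ≠ 0 := by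
  have : Fact p.Prime := ⟨hp⟩
  by_contra! h
  rcases hv with hv | ⟨hn2, i, hi⟩
  · refine hv ?_
    have h1 := D.norm_eq (D.lin v)
    have h2 := congrArg ψ h1
    rw [map_intCast, map_prod, Finset.prod_eq_zero (Finset.mem_univ j₀) (h j₀)] at h2
    exact (ZMod.intCast_zmod_eq_zero_iff_dvd _ _).1 h2
  · have hi₁ : i₁ ≠ D.i₀ := by
      rintro rfl
      exact hψ (by simp [D.ω_i₀])
    have huniv : ∀ i : Fin n, i = D.i₀ ∨ i = i₁ := by
      subst hn2
      intro i
      omega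
    have hsum : ∀ j, ψ (D.σ j (D.lin v)) = (v D.i₀ : ZMod p) * D.b
        + (v i₁ : ZMod p) * ψ (D.σ j (D.ω i₁)) := by
      intro j
      rw [D.lin_apply, map_sum, map_sum, ← Finset.add_sum_erase _ _ (Finset.mem_univ D.i₀),
        Finset.sum_eq_single i₁]
      · simp [D.ω_i₀]
      · intro i' hi' hne
        rcases huniv i' with h | h
        · exact absurd h (Finset.ne_of_mem_erase hi')
        · exact absurd h hne
      · intro h'; exact absurd (Finset.mem_erase.2 ⟨hi₁, Finset.mem_univ _⟩) h'
    have e0 := hsum j₀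
    have e1 := hsum j₁
    rw [h] at e0 e1
    have e2 : (v i₁ : ZMod p) * ψ (D.σ j₀ (D.ω i₁) - D.σ j₁ (D.ω i₁)) = 0 := by
      rw [map_sub]; linear_combination e1 - e0
    have e3 : (v i₁ : ZMod p) = 0 := (mul_eq_zero.1 e2).resolve_right hψ
    rw [e3, zero_mul, add_zero] at e0
    have e4 : (v D.i₀ : ZMod p) = 0 := (mul_eq_zero.1 e0.symm).resolve_right fun hb =>
      hpb ((ZMod.intCast_zmod_eq_zero_iff_dvd _ _).1 hb)
    refine hi ((ZMod.intCast_zmod_eq_zero_iff_dvd _ _).1 ?_)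
    rcases huniv i with rfl | rfl
    · exact e4
    · exact e3

theorem NormData.exists_sieve (D : NormData n d k F K M) (hk : 1 ≤ k) (hd : 2 ≤ d) :
    ∃ δ : ℝ, 0 < δ ∧ δ ≤ 1 ∧ ∃ P₀ : ℝ, 1 ≤ P₀ ∧ ∃ C : ℝ, 1 ≤ C ∧ ∀ P : ℝ, P₀ ≤ P →
      ∃ S : Finset ℕ, (∀ p ∈ S, p.Prime ∧ P ^ (2 * δ) ≤ p ∧ (p : ℝ) ≤ P) ∧
      P ^ δ ≤ S.card ∧ (S.card : ℝ) ≤ P ^ δ + 1 ∧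
      ∀ (𝔠 : Ideal (NumberField.RingOfIntegers K)) (v : Fin n → ℤ) (S' : Finset ℕ), S' ⊆ S →
        S'.Nonempty →
        (∀ p ∈ S', ¬ (p : ℤ) ∣ Algebra.norm ℤ (D.lin v) ∨ (n = 2 ∧ ∃ i, ¬ (p : ℤ) ∣ v i)) →
        ∀ (A Y : Finset (Fin n → ℤ)) (N : ℕ), 0 < N →
          (∀ x ∈ A, ∀ m < N, x + m • v ∈ Y) →
          (∀ x ∈ A, x ≠ 0 ∧ ∃ 𝔭 : Ideal (NumberField.RingOfIntegers K),
            Ideal.span {D.lin x} = 𝔠 * 𝔭 ^ k) →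
          (A.card : ℝ) ≤ C * Y.card * (1 / S'.card + P ^ 2 / N) := by
  classical
  obtain ⟨δ, hδ, hδ1, P₀, hP₀, hsup⟩ := exists_prime_supply M
  obtain ⟨Nc, hκ⟩ := exists_kpow_classes K k hk
  obtain ⟨j₀, j₁, hj⟩ : ∃ j₀ j₁ : Fin d, j₀ ≠ j₁ :=
    ⟨⟨0, by omega⟩, ⟨1, by omega⟩, by simp⟩
  obtain ⟨i₁, hi₁⟩ := D.σ_ne j₀ j₁ hj
  let m₁ : ℝ := |((Algebra.norm ℤ (D.ζ - 1) : ℤ) : ℝ)|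
  let m₂ : ℝ := |((Algebra.norm ℤ (D.σ j₀ (D.ω i₁) - D.σ j₁ (D.ω i₁)) : ℤ) : ℝ)|
  let Z : ℝ := 3 + m₁ + m₂ + |(D.b : ℝ)|
  have hm₁ : 0 ≤ m₁ := abs_nonneg _
  have hm₂ : 0 ≤ m₂ := abs_nonneg _
  have hb : 0 ≤ |(D.b : ℝ)| := abs_nonneg _
  have hZ : 3 ≤ Z := by simp only [Z]; linarith
  refine ⟨δ, hδ, hδ1, max P₀ (Z ^ (1 / (2 * δ))), le_max_of_le_left hP₀, 9 * (Nc + 1), ?_, ?_⟩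
  · have : (0 : ℝ) ≤ Nc := Nat.cast_nonneg _
    linarith
  intro P hP
  have hPZ : Z ≤ P ^ (2 * δ) := by
    have h1 := Real.rpow_le_rpow (by positivity) (le_trans (le_max_right _ _) hP)
      (by positivity : 0 ≤ 2 * δ)
    rwa [← Real.rpow_mul (by linarith), one_div, inv_mul_cancel₀ (by positivity),
      Real.rpow_one] at h1
  obtain ⟨S, hS, hS1, hS2⟩ := hsup P (le_trans (le_max_left _ _) hP)
  refine ⟨S, fun p hp => ⟨(hS p hp).1, (hS p hp).2.1, (hS p hp).2.2.1⟩, hS1, hS2, ?_⟩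
  intro 𝔠 v S' hS'S hS'ne hv A Y N hN hY hA
  obtain ⟨κ, hκ⟩ := hκ 𝔠
  have hφ : ∀ p : ℕ, ∃ φ : (Fin n → ℤ) →+ ZMod p, p ∈ S' → φ v ≠ 0 ∧
      ∀ A' ⊆ A, (∀ x ∈ A', ∀ y ∈ A', κ (D.lin x) = κ (D.lin y)) →
        3 * (A'.image φ).card ≤ 2 * p := by
    intro p
    by_cases hpS' : p ∈ S'
    · obtain ⟨hp, hpP, -, ⟨ψ⟩⟩ := hS p (hS'S hpS')
      have hfact : Fact p.Prime := ⟨hp⟩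
      have hpZ : Z ≤ p := hPZ.trans hpP
      have hψ1 : ψ (D.ζ - 1) ≠ 0 := map_ne_zero_of_norm_lt hp ψ (sub_ne_zero.2 D.ζ_ne)
        (lt_of_lt_of_le (by change m₁ < Z; simp only [Z]; linarith) hpZ)
      have hψ2 : ψ (D.σ j₀ (D.ω i₁) - D.σ j₁ (D.ω i₁)) ≠ 0 :=
        map_ne_zero_of_norm_lt hp ψ (sub_ne_zero.2 hi₁)
        (lt_of_lt_of_le (by change m₂ < Z; simp only [Z]; linarith) hpZ)
      have hpb : ¬ (p : ℤ) ∣ D.b := fun h => by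
        refine D.b_ne (Int.eq_zero_of_abs_lt_dvd h ?_)
        have : |(D.b : ℝ)| < p := lt_of_lt_of_le (by simp only [Z]; linarith) hpZ
        exact_mod_cast this
      obtain ⟨j, hjv⟩ := D.exists_map_lin_ne_zero hp ψ j₀ j₁ i₁ hψ2 hpb (hv p hpS')
      refine ⟨((ψ.comp (D.σ j)).toAddMonoidHom).comp D.lin, fun _ => ⟨hjv, ?_⟩⟩
      intro A' hA'A hA'
      refine three_mul_card_le_of_kpow p ?_ k hk (ψ D.ζ) ?_ ?_ _ ?_
      · have : (3 : ℝ) ≤ p := hZ.trans hpZ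
        exact_mod_cast this
      · rw [← map_pow, D.ζ_pow, map_one]
      · intro h
        exact hψ1 (by rw [map_sub, h, map_one, sub_self])
      · intro x' hx' y' hy'
        obtain ⟨x, hx, rfl⟩ := Finset.mem_image.1 hx'
        obtain ⟨y, hy, rfl⟩ := Finset.mem_image.1 hy'
        have hne : ∀ z ∈ A', D.lin z ≠ 0 := fun z hz h =>
          (hA z (hA'A hz)).1 (D.lin_indep z h)
        obtain ⟨w, hw⟩ := hκ (D.lin x) (D.lin y) (hne x hx) (hne y hy)
          (hA x (hA'A hx)).2 (hA y (hA'A hy)).2 (hA' x hx y hy)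
        refine ⟨ψ (D.σ j w), ?_⟩
        have := congrArg (ψ.comp (D.σ j)) hw
        rw [map_mul, map_pow, map_pow] at this
        exact this
    · exact ⟨0, fun h => absurd h hpS'⟩
  choose φ hφ using hφ
  have hclass : ∀ c : Fin Nc, ((A.filter (fun x => κ (D.lin x) = c)).card : ℝ)
      ≤ 9 * Y.card * (1 / S'.card + P ^ 2 / N) := by
    intro c
    refine row_sieve S' (fun p hp => (hS p (hS'S hp)).1) P (fun p hp => (hS p (hS'S hp)).2.2.1)
      hS'ne φ v (fun p hp => (hφ p hp).1) _ Y N hN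
      (fun x hx m hm => hY x (Finset.mem_filter.1 hx).1 m hm) ?_
    intro p hp
    refine (hφ p hp).2 _ (Finset.filter_subset _ _) fun x hx y hy => ?_
    rw [(Finset.mem_filter.1 hx).2, (Finset.mem_filter.1 hy).2]
  have hcard := Finset.card_eq_sum_card_fiberwise (f := fun x => κ (D.lin x)) (s := A)
    (t := Finset.univ) (fun x _ => Finset.mem_univ _)
  have hnn : (0 : ℝ) ≤ Y.card * (1 / S'.card + P ^ 2 / N) := by positivity
  calc (A.card : ℝ) = ∑ c : Fin Nc, ((A.filter (fun x => κ (D.lin x) = c)).card : ℝ) := by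
        rw [hcard]; push_cast; rfl
    _ ≤ ∑ c : Fin Nc, 9 * Y.card * (1 / S'.card + P ^ 2 / N) :=
        Finset.sum_le_sum fun c _ => hclass c
    _ = Nc * (9 * (Y.card * (1 / S'.card + P ^ 2 / N))) := by
        rw [Finset.sum_const, Finset.card_univ, Fintype.card_fin, nsmul_eq_mul]; ring
    _ ≤ 9 * (Nc + 1) * Y.card * (1 / S'.card + P ^ 2 / N) := by
        nlinarith
end

theorem natAbs_le_supNorm {n : ℕ} (x : Fin n → ℤ) (i : Fin n) : (x i).natAbs ≤ supNorm x :=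
  Finset.le_sup (f := fun i => (x i).natAbs) (Finset.mem_univ i)

theorem supNorm_le_iff {n : ℕ} {x : Fin n → ℤ} {m : ℕ} :
    supNorm x ≤ m ↔ ∀ i, (x i).natAbs ≤ m := by
  simp [supNorm, Finset.sup_le_iff]

theorem supNorm_pos {n : ℕ} {x : Fin n → ℤ} (hx : x ≠ 0) : 0 < supNorm x := by
  obtain ⟨i, hi⟩ := Function.ne_iff.1 hx
  exact lt_of_lt_of_le (Int.natAbs_pos.2 hi) (natAbs_le_supNorm x i)

theorem exists_natAbs_eq_supNorm {n : ℕ} {x : Fin n → ℤ} (hx : x ≠ 0) :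
    ∃ i, (x i).natAbs = supNorm x := by
  obtain ⟨i, -⟩ := Function.ne_iff.1 hx
  have hne : (Finset.univ : Finset (Fin n)).Nonempty := ⟨i, Finset.mem_univ i⟩
  obtain ⟨j, -, hj⟩ := Finset.exists_mem_eq_sup _ hne fun i => (x i).natAbs
  exact ⟨j, hj.symm⟩

theorem abs_le_supNorm {n : ℕ} (x : Fin n → ℤ) (i : Fin n) : |(x i : ℝ)| ≤ supNorm x := by
  have := natAbs_le_supNorm x i
  rw [← Int.cast_abs, Int.abs_eq_natAbs]
  exact_mod_cast this

section
variable {n d k : ℕ} {F : MvPolynomial (Fin n) ℤ} {K M : Type} [Field K] [NumberField K]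
    [Field M] [NumberField M]

theorem NormData.exists_small_vector (D : NormData n d k F K M) (hn : 1 ≤ n)
    {𝔠 : Ideal (NumberField.RingOfIntegers K)} (h𝔠 : 𝔠 ≠ ⊥) :
    ∃ v, v ≠ 0 ∧ D.lin v ∈ 𝔠 ∧ supNorm v ^ n ≤ Ideal.absNorm 𝔠 := by
  classical
  have hN : Ideal.absNorm 𝔠 ≠ 0 := by rwa [Ne, Ideal.absNorm_eq_zero_iff]
  have hcard : Nat.card (NumberField.RingOfIntegers K ⧸ 𝔠) = Ideal.absNorm 𝔠 := by
    rw [Ideal.absNorm_apply, Submodule.cardQuot_apply]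
  have hfin : Finite (NumberField.RingOfIntegers K ⧸ 𝔠) :=
    Nat.finite_of_card_ne_zero (by rwa [hcard])
  have := Fintype.ofFinite (NumberField.RingOfIntegers K ⧸ 𝔠)
  obtain ⟨m, hm1, hm2⟩ : ∃ m : ℕ, m ^ n ≤ Ideal.absNorm 𝔠 ∧ Ideal.absNorm 𝔠 < (m + 1) ^ n := by
    have hex : ∃ m : ℕ, Ideal.absNorm 𝔠 < (m + 1) ^ n :=
      ⟨Ideal.absNorm 𝔠, lt_of_lt_of_le (Nat.lt_succ_self _) (Nat.le_self_pow (by omega) _)⟩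
    refine ⟨Nat.find hex, ?_, Nat.find_spec hex⟩
    rcases Nat.eq_zero_or_pos (Nat.find hex) with h | h
    · rw [h, zero_pow (by omega)]; omega
    · have := Nat.find_min hex (Nat.sub_lt h one_pos)
      rwa [show Nat.find hex - 1 + 1 = Nat.find hex by omega, not_lt] at this
  let f : (Fin n → Fin (m + 1)) → NumberField.RingOfIntegers K ⧸ 𝔠 := fun a =>
    Ideal.Quotient.mk 𝔠 (D.lin fun i => ((a i : ℕ) : ℤ))
  obtain ⟨a, a', haa', hf⟩ := Fintype.exists_ne_map_eq_of_card_lt f (by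
    rw [← Nat.card_eq_fintype_card, hcard]
    simpa using hm2)
  refine ⟨(fun i => ((a i : ℕ) : ℤ)) - fun i => ((a' i : ℕ) : ℤ), ?_, ?_, ?_⟩
  · intro h
    refine haa' (funext fun i => Fin.ext ?_)
    have := congrFun h i
    simp only [Pi.sub_apply, Pi.zero_apply] at this
    omega
  · rw [map_sub]
    exact Ideal.Quotient.eq.1 hf
  · refine le_trans (Nat.pow_le_pow_left (supNorm_le_iff.2 fun i => ?_) n) hm1
    have h1 := (a i).2
    have h2 := (a' i).2
    simp only [Pi.sub_apply]
    omega

theorem NormData.exists_minimal_vector (D : NormData n d k F K M) (hn : 1 ≤ n)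
    {𝔠 : Ideal (NumberField.RingOfIntegers K)} (h𝔠 : 𝔠 ≠ ⊥) :
    ∃ v, v ≠ 0 ∧ D.lin v ∈ 𝔠 ∧ supNorm v ^ n ≤ Ideal.absNorm 𝔠 ∧
      ∀ w, w ≠ 0 → D.lin w ∈ 𝔠 → supNorm v ≤ supNorm w := by
  classical
  obtain ⟨v₀, h0, hmem, hle⟩ := D.exists_small_vector hn h𝔠
  have hex : ∃ m : ℕ, ∃ v, v ≠ 0 ∧ D.lin v ∈ 𝔠 ∧ supNorm v = m := ⟨_, v₀, h0, hmem, rfl⟩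
  obtain ⟨v, hv0, hv, hvm⟩ := Nat.find_spec hex
  have hmin : ∀ w, w ≠ 0 → D.lin w ∈ 𝔠 → supNorm v ≤ supNorm w := fun w hw hw' => by
    rw [hvm]; exact Nat.find_min' hex ⟨w, hw, hw', rfl⟩
  exact ⟨v, hv0, hv, le_trans (Nat.pow_le_pow_left (hmin v₀ h0 hmem) n) hle, hmin⟩

theorem NormData.absNorm_span_lin_le (D : NormData n d k F K M) :
    ∃ C : ℝ, 1 ≤ C ∧ ∀ (B : ℝ) (x : Fin n → ℤ), (∀ i, |(x i : ℝ)| ≤ B) → 0 ≤ B →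
      |((Algebra.norm ℤ (D.lin x) : ℤ) : ℝ)| ≤ (C * B) ^ d := by
  obtain ⟨C, hC, h⟩ := exists_abs_norm_sum_le D.ω
  refine ⟨C, hC, fun B x hx hB => ?_⟩
  have := h B x hx hB
  rw [D.finrank_eq] at this
  rwa [D.lin_apply]

end

section
variable {n d k : ℕ} {F : MvPolynomial (Fin n) ℤ} {K M : Type} [Field K] [NumberField K]
    [Field M] [NumberField M]

theorem mem_of_span_singleton_eq_mul {R : Type*} [CommRing R] {a : R} {I J : Ideal R}
    (h : Ideal.span {a} = I * J) : a ∈ I :=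
  (Ideal.span_singleton_le_iff_mem I).1 (h.le.trans Ideal.mul_le_left)

theorem NormData.lin_add_nsmul_mem (D : NormData n d k F K M)
    {𝔠 : Ideal (NumberField.RingOfIntegers K)} {x v : Fin n → ℤ} (hx : D.lin x ∈ 𝔠)
    (hv : D.lin v ∈ 𝔠) (m : ℕ) : D.lin (x + m • v) ∈ 𝔠 := by
  rw [map_add, map_nsmul]
  exact 𝔠.add_mem hx (nsmul_mem hv m)

theorem NormData.exists_card_fiber_le (D : NormData n d k F K M) (hk : 1 ≤ k) (hd : 2 ≤ d)
    (hn : 3 ≤ n) (A₀ : ℝ) (hA₀ : 1 ≤ A₀) :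
    ∃ δ : ℝ, 0 < δ ∧ ∃ C : ℝ, 1 ≤ C ∧ ∃ B₀ : ℝ, 1 ≤ B₀ ∧ ∀ B : ℝ, B₀ ≤ B →
      ∀ 𝔠 : Ideal (NumberField.RingOfIntegers K), 𝔠 ≠ ⊥ →
        (Ideal.absNorm 𝔠 : ℝ) ≤ A₀ * B ^ 2 → ∀ A Y : Finset (Fin n → ℤ),
        (∀ x ∈ A, (∀ i, |(x i : ℝ)| ≤ B) ∧ x ≠ 0 ∧
          ∃ 𝔭 : Ideal (NumberField.RingOfIntegers K), Ideal.span {D.lin x} = 𝔠 * 𝔭 ^ k) →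
        (∀ y : Fin n → ℤ, (∀ i, |(y i : ℝ)| ≤ 2 * B) → D.lin y ∈ 𝔠 → y ∈ Y) →
        (A.card : ℝ) ≤ C * Y.card * B ^ (-δ) := by
  classical
  obtain ⟨δ, hδ, hδ1, P₀, hP₀, C, hC, hsieve⟩ := D.exists_sieve hk hd
  obtain ⟨C₁, hC₁, hnorm⟩ := D.absNorm_span_lin_le
  obtain ⟨g, hg⟩ := exists_nat_ge (40 * (d : ℝ) / δ)
  have hev : ∀ᶠ B : ℝ in atTop, P₀ ≤ B ^ ((1 : ℝ) / 20) ∧ 2 * (g : ℝ) + 2 ≤ B ^ (δ / 20) ∧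
      A₀ ≤ B ^ ((1 : ℝ) / 3) ∧ C₁ * A₀ ≤ B ∧ 1 ≤ B := by
    refine (tendsto_atTop.1 (tendsto_rpow_atTop (by norm_num)) _).and
      ((tendsto_atTop.1 (tendsto_rpow_atTop (by positivity)) _).and
      ((tendsto_atTop.1 (tendsto_rpow_atTop (by norm_num)) _).and
      ((eventually_ge_atTop _).and (eventually_ge_atTop _))))
  obtain ⟨B₀, hB₀⟩ := eventually_atTop.1 hev
  refine ⟨δ / 20, by positivity, C * (2 + 2 * A₀), by nlinarith, max B₀ 1, le_max_right _ _,
    fun B hB 𝔠 h𝔠 hN A Y hA hY => ?_⟩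
  obtain ⟨hP, hgB, hAB, hCB, hB1⟩ := hB₀ B (le_trans (le_max_left _ _) hB)
  have hB0 : 0 < B := by linarith
  have hA0 : 0 < A₀ := by linarith
  obtain ⟨S, hS, hScard, -, hS'⟩ := hsieve _ hP
  obtain ⟨v, hv0, hv, hvN⟩ := D.exists_small_vector (by omega) h𝔠
  have hV1 : 1 ≤ supNorm v := supNorm_pos hv0
  have hPδ : (B ^ ((1 : ℝ) / 20)) ^ δ = B ^ (δ / 20) := by
    rw [← Real.rpow_mul hB0.le]; congr 1; ring
  have hP2δ : (B ^ ((1 : ℝ) / 20)) ^ (2 * δ) = B ^ (δ / 10) := by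
    rw [← Real.rpow_mul hB0.le]; congr 1; ring
  have hP2 : (B ^ ((1 : ℝ) / 20)) ^ 2 = B ^ ((1 : ℝ) / 10) := by
    rw [← Real.rpow_natCast, ← Real.rpow_mul hB0.le]; norm_num
  rw [hPδ] at hScard
  -- size of `v`
  have hV : (supNorm v : ℝ) ≤ A₀ * B ^ ((2 : ℝ) / 3) := by
    have h1 : (supNorm v : ℝ) ^ 3 ≤ (A₀ * B ^ ((2 : ℝ) / 3)) ^ 3 := by
      have e1 : (B ^ ((2 : ℝ) / 3)) ^ 3 = B ^ 2 := by
        rw [← Real.rpow_natCast, ← Real.rpow_mul hB0.le, ← Real.rpow_natCast]; norm_num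
      calc (supNorm v : ℝ) ^ 3 ≤ (supNorm v : ℝ) ^ n :=
            pow_le_pow_right₀ (by exact_mod_cast hV1) hn
        _ ≤ Ideal.absNorm 𝔠 := by exact_mod_cast hvN
        _ ≤ A₀ * B ^ 2 := hN
        _ ≤ A₀ ^ 3 * B ^ 2 := by gcongr; exact le_self_pow₀ hA₀ (by norm_num)
        _ = _ := by rw [mul_pow, e1]
    exact (pow_le_pow_iff_left₀ (by positivity) (by positivity) (by norm_num)).1 h1
  have hB23 : B ^ ((2 : ℝ) / 3) * B ^ ((1 : ℝ) / 3) = B := by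
    rw [← Real.rpow_add hB0]; norm_num
  have hN0 : Algebra.norm ℤ (D.lin v) ≠ 0 :=
    Algebra.norm_ne_zero_iff.2 fun h => hv0 (D.lin_injective (by rw [h, map_zero]))
  have hB23' : B ^ ((2 : ℝ) / 3) ≤ B := by
    calc B ^ ((2 : ℝ) / 3) ≤ B ^ (1 : ℝ) := Real.rpow_le_rpow_of_exponent_le hB1 (by norm_num)
      _ = B := Real.rpow_one B
  have hNle : |((Algebra.norm ℤ (D.lin v) : ℤ) : ℝ)| ≤ (B ^ (δ / 20)) ^ g := by
    calc _ ≤ (C₁ * (A₀ * B)) ^ d := hnorm _ v (fun i => (abs_le_supNorm v i).trans (hV.trans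
            (by gcongr))) (by positivity)
      _ ≤ (B * B) ^ d := by
          rw [← mul_assoc]; gcongr
      _ = B ^ (2 * (d : ℝ)) := by
          rw [← sq, ← pow_mul, ← Real.rpow_natCast]; push_cast; rfl
      _ ≤ B ^ (δ / 20 * g) := by
          refine Real.rpow_le_rpow_of_exponent_le hB1 ?_
          rw [div_le_iff₀ hδ] at hg
          linarith
      _ = _ := by rw [Real.rpow_mul hB0.le, Real.rpow_natCast]
  let S' := S.filter fun p : ℕ => ¬ (p : ℤ) ∣ Algebra.norm ℤ (D.lin v)
  have hg0 : (0 : ℝ) ≤ g := Nat.cast_nonneg g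
  have hbadS : (S.filter fun p : ℕ => (p : ℤ) ∣ Algebra.norm ℤ (D.lin v)).card ≤ g := by
    refine prime_card_le_of_dvd (by linarith) hN0 hNle _ fun q hq => ?_
    obtain ⟨hqS, hqd⟩ := Finset.mem_filter.1 hq
    obtain ⟨h1, h2, h3⟩ := hS q hqS
    rw [hP2δ] at h2
    refine ⟨h1, lt_of_lt_of_le ?_ h2, hqd⟩
    have e : B ^ (δ / 10) = B ^ (δ / 20) * B ^ (δ / 20) := by
      rw [← Real.rpow_add hB0]; congr 1; ring
    rw [e]
    nlinarith
  have hS'card : B ^ (δ / 20) / 2 ≤ S'.card := by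
    have h1 := Finset.card_filter_add_card_filter_not (s := S)
      (fun p : ℕ => (p : ℤ) ∣ Algebra.norm ℤ (D.lin v))
    have h2 : (S.card : ℝ) ≤ g + S'.card := by
      rw [← h1]; push_cast
      have : ((S.filter fun p : ℕ => (p : ℤ) ∣ Algebra.norm ℤ (D.lin v)).card : ℝ) ≤ g := by
        exact_mod_cast hbadS
      simp only [S']
      linarith
    linarith
  have hS'pos : 0 < (S'.card : ℝ) := by
    have : 0 < B ^ (δ / 20) := by positivity
    linarith
  have hS'ne : S'.Nonempty := Finset.card_pos.1 (by exact_mod_cast hS'pos)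
  have hfl1 : 1 ≤ B ^ ((1 : ℝ) / 3) / A₀ := by rwa [le_div_iff₀ hA0, one_mul]
  have hfl : B ^ ((1 : ℝ) / 3) / A₀ / 2 ≤ (⌊B ^ ((1 : ℝ) / 3) / A₀⌋₊ : ℝ) := by
    have h1 := Nat.lt_floor_add_one (B ^ ((1 : ℝ) / 3) / A₀)
    have h2 : (1 : ℝ) ≤ (⌊B ^ ((1 : ℝ) / 3) / A₀⌋₊ : ℝ) := by
      exact_mod_cast Nat.le_floor (by simpa using hfl1)
    linarith
  have hflle : (⌊B ^ ((1 : ℝ) / 3) / A₀⌋₊ : ℝ) ≤ B ^ ((1 : ℝ) / 3) / A₀ :=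
    Nat.floor_le (by positivity)
  have main := hS' 𝔠 v S' (Finset.filter_subset _ _) hS'ne
    (fun p hp => Or.inl (Finset.mem_filter.1 hp).2) A Y _ (Nat.floor_pos.2 hfl1)
    (fun x hx m hm => by
      obtain ⟨hxB, -, 𝔭, hx𝔭⟩ := hA x hx
      refine hY _ (fun i => ?_) ?_
      · have h1 : (m : ℝ) ≤ B ^ ((1 : ℝ) / 3) / A₀ :=
          le_trans (by exact_mod_cast hm.le) hflle
        have h2 : (m : ℝ) * |(v i : ℝ)| ≤ B := by
          calc (m : ℝ) * |(v i : ℝ)| ≤ B ^ ((1 : ℝ) / 3) / A₀ * (A₀ * B ^ ((2 : ℝ) / 3)) := by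
                gcongr
                exact (abs_le_supNorm v i).trans hV
            _ = B ^ ((2 : ℝ) / 3) * B ^ ((1 : ℝ) / 3) := by field_simp
            _ = B := hB23
        have h3 : (((x + m • v) i : ℤ) : ℝ) = x i + m * v i := by simp
        rw [h3]
        calc _ ≤ |(x i : ℝ)| + |(m : ℝ) * v i| := abs_add_le _ _
          _ ≤ B + B := by
              rw [abs_mul, Nat.abs_cast]
              exact add_le_add (hxB i) h2
          _ = 2 * B := by ring
      · exact D.lin_add_nsmul_mem (mem_of_span_singleton_eq_mul hx𝔭) hv m)
    (fun x hx => (hA x hx).2)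
  refine main.trans ?_
  have h1 : 1 / (S'.card : ℝ) ≤ 2 * B ^ (-(δ / 20)) := by
    rw [Real.rpow_neg hB0.le, div_le_iff₀ hS'pos]
    have : 0 < B ^ (δ / 20) := by positivity
    rw [mul_assoc, ← div_eq_inv_mul, ← div_le_iff₀' (by norm_num), le_div_iff₀ this]
    linarith
  have h2 : (B ^ ((1 : ℝ) / 20)) ^ 2 / (⌊B ^ ((1 : ℝ) / 3) / A₀⌋₊ : ℝ)
      ≤ 2 * A₀ * B ^ (-(δ / 20)) := by
    rw [hP2]
    calc _ ≤ B ^ ((1 : ℝ) / 10) / (B ^ ((1 : ℝ) / 3) / A₀ / 2) := by gcongr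
      _ = 2 * A₀ * (B ^ ((1 : ℝ) / 10) / B ^ ((1 : ℝ) / 3)) := by field_simp
      _ = 2 * A₀ * B ^ ((1 : ℝ) / 10 - 1 / 3) := by rw [Real.rpow_sub hB0]
      _ ≤ _ := by
          refine mul_le_mul_of_nonneg_left ?_ (by positivity)
          exact Real.rpow_le_rpow_of_exponent_le hB1 (by linarith)
  calc _ ≤ C * Y.card * (2 * B ^ (-(δ / 20)) + 2 * A₀ * B ^ (-(δ / 20))) := by gcongr
    _ = _ := by ring

end

section
variable {n d k : ℕ} {F : MvPolynomial (Fin n) ℤ} {K M : Type} [Field K] [NumberField K]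
    [Field M] [NumberField M]

theorem NormData.exists_card_le_of_three_le (D : NormData n d k F K M) (hk : 1 ≤ k) (hd : 2 ≤ d)
    (hn : 3 ≤ n) (A₀ : ℝ) (hA₀ : 1 ≤ A₀) :
    ∃ δ : ℝ, 0 < δ ∧ ∃ C : ℝ, 1 ≤ C ∧ ∃ B₀ : ℝ, 1 ≤ B₀ ∧ ∀ B : ℝ, B₀ ≤ B →
      ∀ T : Finset (Fin n → ℤ),
        (∀ x ∈ T, (∀ i, |(x i : ℝ)| ≤ B) ∧ x ≠ 0 ∧
          ∃ 𝔠 𝔭 : Ideal (NumberField.RingOfIntegers K), Ideal.span {D.lin x} = 𝔠 * 𝔭 ^ k ∧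
            (Ideal.absNorm 𝔠 : ℝ) ≤ A₀ * B ^ 2) →
        (T.card : ℝ) ≤ C * B ^ n * B ^ (-δ) := by
  classical
  obtain ⟨δ, hδ, C, hC, B₀, hB₀, hfib⟩ := D.exists_card_fiber_le hk hd hn A₀ hA₀
  obtain ⟨C₁, hC₁, hnorm⟩ := D.absNorm_span_lin_le
  obtain ⟨C₂, hC₂, hdiv⟩ := exists_card_ideal_dvd_le K (δ / (4 * d)) (by positivity)
  refine ⟨δ / 2, by positivity, C * (3 ^ n + 6 ^ n * C₂), ?_, max B₀ (2 * C₁),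
    hB₀.trans (le_max_left _ _), fun B hB T hT => ?_⟩
  · have : (1 : ℝ) ≤ 3 ^ n := one_le_pow₀ (by norm_num)
    have h2 : (0 : ℝ) ≤ 6 ^ n * C₂ := by positivity
    nlinarith
  have hBB₀ : B₀ ≤ B := le_trans (le_max_left _ _) hB
  have hBC : 2 * C₁ ≤ B := le_trans (le_max_right _ _) hB
  have hB1 : 1 ≤ B := hB₀.trans hBB₀
  have hB0 : 0 < B := by linarith
  have hd0 : (0 : ℝ) < d := by exact_mod_cast (by omega : 0 < d)
  have hT' : ∀ x : T, ∃ 𝔠 𝔭 : Ideal (NumberField.RingOfIntegers K),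
      Ideal.span {D.lin (x : Fin n → ℤ)} = 𝔠 * 𝔭 ^ k ∧ (Ideal.absNorm 𝔠 : ℝ) ≤ A₀ * B ^ 2 :=
    fun x => (hT x x.2).2.2
  choose c' p' hc' hN' using hT'
  let c : (Fin n → ℤ) → Ideal (NumberField.RingOfIntegers K) := fun x =>
    if h : x ∈ T then c' ⟨x, h⟩ else ⊤
  have hc : ∀ x ∈ T, (∃ 𝔭, Ideal.span {D.lin x} = c x * 𝔭 ^ k) ∧
      (Ideal.absNorm (c x) : ℝ) ≤ A₀ * B ^ 2 := fun x hx => by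
    simp only [c, dif_pos hx]
    exact ⟨⟨_, hc' ⟨x, hx⟩⟩, hN' ⟨x, hx⟩⟩
  have hlin0 : ∀ x, x ≠ 0 → D.lin x ≠ 0 := fun x hx h =>
    hx (D.lin_injective (by rw [h, map_zero]))
  have hcne : ∀ x ∈ T, c x ≠ ⊥ := fun x hx h => by
    obtain ⟨⟨𝔭, h1⟩, -⟩ := hc x hx
    rw [h, Ideal.bot_mul, Ideal.span_singleton_eq_bot] at h1
    exact hlin0 x (hT x hx).2.1 h1
  let 𝒞 := T.image c
  let Box := (finite_box (n := n) (2 * B)).toFinset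
  have hBox : ∀ y, y ∈ Box ↔ ∀ i, |(y i : ℝ)| ≤ 2 * B := fun y => by simp [Box]
  let Y : Ideal (NumberField.RingOfIntegers K) → Finset (Fin n → ℤ) := fun 𝔠 =>
    Box.filter fun y => D.lin y ∈ 𝔠
  -- summing the sizes of the sets `Y 𝔠`
  have hY : ((∑ 𝔠 ∈ 𝒞, (Y 𝔠).card : ℕ) : ℝ) ≤ (3 ^ n + 6 ^ n * C₂) * B ^ n * B ^ (δ / 2) := by
    have e1 : ∑ 𝔠 ∈ 𝒞, (Y 𝔠).card = ∑ y ∈ Box, (𝒞.filter fun 𝔠 => D.lin y ∈ 𝔠).card := by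
      simp only [Y, Finset.card_filter]
      rw [Finset.sum_comm]
    have h𝒞 : (𝒞.card : ℝ) ≤ (3 * B) ^ n :=
      le_trans (by exact_mod_cast Finset.card_image_le)
        (card_box_le B hB1 T fun x hx => (hT x hx).1)
    have hBd : 1 ≤ B ^ (δ / 2) := Real.one_le_rpow hB1 (by positivity)
    have hy : ∀ y ∈ Box.erase 0, ((𝒞.filter fun 𝔠 => D.lin y ∈ 𝔠).card : ℝ)
        ≤ C₂ * B ^ (δ / 2) := by
      intro y hy
      obtain ⟨hy0, hyB⟩ := Finset.mem_erase.1 hy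
      have hspan : Ideal.span {D.lin y} ≠ ⊥ := by
        rw [Ne, Ideal.span_singleton_eq_bot]; exact hlin0 y hy0
      obtain ⟨hfin, hle⟩ := hdiv _ hspan
      have h1 : (𝒞.filter fun 𝔠 => D.lin y ∈ 𝔠).card ≤
          {J : Ideal (NumberField.RingOfIntegers K) | J ∣ Ideal.span {D.lin y}}.ncard := by
        rw [← Set.ncard_coe_finset]
        refine Set.ncard_le_ncard (fun J hJ => ?_) hfin
        have := (Finset.mem_filter.1 (Finset.mem_coe.1 hJ)).2
        exact Ideal.dvd_span_singleton.2 this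
      have h2 : ((Ideal.absNorm (Ideal.span {D.lin y}) : ℕ) : ℝ) ≤ B ^ (2 * (d : ℝ)) := by
        rw [Ideal.absNorm_span_singleton, Nat.cast_natAbs, Int.cast_abs]
        calc _ ≤ (C₁ * (2 * B)) ^ d := hnorm _ y ((hBox y).1 hyB) (by positivity)
          _ ≤ (B * B) ^ d := by
              refine pow_le_pow_left₀ (by positivity) ?_ d
              nlinarith
          _ = B ^ (2 * (d : ℝ)) := by
              rw [← sq, ← pow_mul, ← Real.rpow_natCast]; push_cast; rfl
      calc _ ≤ C₂ * ((Ideal.absNorm (Ideal.span {D.lin y}) : ℕ) : ℝ) ^ (δ / (4 * d)) :=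
            le_trans (by exact_mod_cast h1) hle
        _ ≤ C₂ * (B ^ (2 * (d : ℝ))) ^ (δ / (4 * d)) := by gcongr
        _ = _ := by
            rw [← Real.rpow_mul hB0.le]; congr 2; field_simp; ring
    have h0 : (0 : Fin n → ℤ) ∈ Box := (hBox 0).2 fun i => by simp; positivity
    rw [e1, ← Finset.add_sum_erase _ _ h0]
    push_cast
    have h3 : ((𝒞.filter fun 𝔠 => D.lin 0 ∈ 𝔠).card : ℝ) ≤ (3 * B) ^ n :=
      le_trans (by exact_mod_cast Finset.card_filter_le _ _) h𝒞
    have h4 : ∑ y ∈ Box.erase 0, ((𝒞.filter fun 𝔠 => D.lin y ∈ 𝔠).card : ℝ)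
        ≤ (6 * B) ^ n * (C₂ * B ^ (δ / 2)) := by
      refine (Finset.sum_le_card_nsmul _ _ _ hy).trans ?_
      rw [nsmul_eq_mul]
      refine mul_le_mul_of_nonneg_right ?_ (by positivity)
      have := card_box_le (2 * B) (by linarith) (Box.erase 0) fun x hx =>
        (hBox x).1 (Finset.mem_of_mem_erase hx)
      calc _ ≤ _ := this
        _ = _ := by ring
    calc _ ≤ (3 * B) ^ n * B ^ (δ / 2) + (6 * B) ^ n * (C₂ * B ^ (δ / 2)) :=
          add_le_add (h3.trans (le_mul_of_one_le_right (by positivity) hBd)) h4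
      _ = _ := by rw [mul_pow, mul_pow]; ring
  have hfib' : ∀ 𝔠 ∈ 𝒞, ((T.filter fun x => c x = 𝔠).card : ℝ) ≤ C * (Y 𝔠).card * B ^ (-δ) := by
    intro 𝔠 h𝔠
    obtain ⟨x₀, hx₀, rfl⟩ := Finset.mem_image.1 h𝔠
    refine hfib B hBB₀ (c x₀) (hcne x₀ hx₀) (hc x₀ hx₀).2 _ _ (fun x hx => ?_) fun y hy hyc =>
      Finset.mem_filter.2 ⟨(hBox y).2 hy, hyc⟩
    obtain ⟨hxT, hxc⟩ := Finset.mem_filter.1 hx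
    have := (hc x hxT).1
    rw [hxc] at this
    exact ⟨(hT x hxT).1, (hT x hxT).2.1, this⟩
  have hcard := Finset.card_eq_sum_card_fiberwise (s := T) (t := 𝒞) (f := c)
    fun x hx => Finset.mem_image_of_mem c hx
  calc (T.card : ℝ) = ∑ 𝔠 ∈ 𝒞, ((T.filter fun x => c x = 𝔠).card : ℝ) := by
        rw [hcard]; push_cast; rfl
    _ ≤ ∑ 𝔠 ∈ 𝒞, C * (Y 𝔠).card * B ^ (-δ) := Finset.sum_le_sum hfib'
    _ = C * ((∑ 𝔠 ∈ 𝒞, (Y 𝔠).card : ℕ) : ℝ) * B ^ (-δ) := by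
        push_cast; rw [Finset.mul_sum, Finset.sum_mul]
    _ ≤ C * ((3 ^ n + 6 ^ n * C₂) * B ^ n * B ^ (δ / 2)) * B ^ (-δ) := by gcongr
    _ = C * (3 ^ n + 6 ^ n * C₂) * B ^ n * (B ^ (δ / 2) * B ^ (-δ)) := by ring
    _ = _ := by rw [← Real.rpow_add hB0]; congr 2; ring

end

/-- The determinant of two vectors of the plane. -/
def planeDet (v y : Fin 2 → ℤ) : ℤ := v 0 * y 1 - v 1 * y 0

theorem planeDet_sub (v y z : Fin 2 → ℤ) : planeDet v (y - z) = planeDet v y - planeDet v z := by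
  simp only [planeDet, Pi.sub_apply]; ring

theorem planeDet_add_nsmul (v y : Fin 2 → ℤ) (m : ℕ) :
    planeDet v (y + m • v) = planeDet v y := by
  simp only [planeDet, Pi.add_apply, Pi.smul_apply]
  simp only [nsmul_eq_mul]
  ring

theorem exists_eq_zsmul_of_planeDet_eq_zero {Λ : AddSubgroup (Fin 2 → ℤ)} {v y : Fin 2 → ℤ}
    (hv : v ∈ Λ) (hv0 : v ≠ 0) (hmin : ∀ w ∈ Λ, w ≠ 0 → supNorm v ≤ supNorm w)
    (hy : y ∈ Λ) (hdet : planeDet v y = 0) : ∃ m : ℤ, y = m • v := by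
  obtain ⟨i, hi⟩ := exists_natAbs_eq_supNorm hv0
  have hvi : v i ≠ 0 := by
    have := supNorm_pos hv0
    omega
  refine ⟨y i / v i, ?_⟩
  by_contra hne
  have hz0 : y - (y i / v i) • v ≠ 0 := sub_ne_zero.2 hne
  have h1 := hmin _ (Λ.sub_mem hy (Λ.zsmul_mem hv _)) hz0
  have hr : (y - (y i / v i) • v) i = y i % v i := by
    simp only [Pi.sub_apply, Pi.smul_apply, smul_eq_mul]
    have := Int.emod_add_mul_ediv (y i) (v i)
    linarith
  have hrlt : (y i % v i).natAbs < (v i).natAbs := by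
    have e1 := Int.emod_nonneg (y i) hvi
    have e2 := Int.emod_lt_abs (y i) hvi
    zify
    rwa [abs_of_nonneg e1]
  have h2 : supNorm (y - (y i / v i) • v) ≤ (y i % v i).natAbs := by
    refine supNorm_le_iff.2 fun j => ?_
    obtain ⟨z, hz⟩ : ∃ z, z = y - (y i / v i) • v := ⟨_, rfl⟩
    rw [← hz] at hr ⊢
    rw [← hr]
    have hzd : planeDet v z = 0 := by
      rw [hz]
      simp only [planeDet, Pi.sub_apply, Pi.smul_apply, smul_eq_mul] at hdet ⊢
      linear_combination hdet
    have hzv : z j * v i = v j * z i := by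
      simp only [planeDet] at hzd
      fin_cases i <;> fin_cases j <;> simp <;> linarith
    have h3 : (z j).natAbs * (v i).natAbs ≤ (z i).natAbs * (v i).natAbs := by
      rw [← Int.natAbs_mul, hzv, Int.natAbs_mul, mul_comm]
      gcongr
      rw [hi]; exact natAbs_le_supNorm v j
    exact Nat.le_of_mul_le_mul_right h3 (Int.natAbs_pos.2 hvi)
  omega

theorem card_int_le {t : ℝ} (ht : 0 ≤ t) (A : Finset ℤ) (hA : ∀ a ∈ A, |(a : ℝ)| ≤ t) :
    (A.card : ℝ) ≤ 2 * t + 1 := by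
  have h1 : A ⊆ Finset.Icc (-⌊t⌋) ⌊t⌋ := fun a ha => by
    have h := abs_le.1 (hA a ha)
    refine Finset.mem_Icc.2 ⟨?_, Int.le_floor.2 h.2⟩
    have : -a ≤ ⌊t⌋ := Int.le_floor.2 (by push_cast; linarith)
    linarith
  have h2 := Finset.card_le_card h1
  rw [Int.card_Icc] at h2
  have h3 : 0 ≤ ⌊t⌋ := Int.floor_nonneg.2 ht
  have h4 : (A.card : ℤ) ≤ 2 * ⌊t⌋ + 1 := by omega
  have h5 : (A.card : ℝ) ≤ 2 * (⌊t⌋ : ℝ) + 1 := by exact_mod_cast h4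
  have := Int.floor_le t
  linarith

theorem card_nonzero_int_le {t : ℝ} (ht : 0 ≤ t) (A : Finset ℤ)
    (hA : ∀ a ∈ A, |(a : ℝ)| ≤ t ∧ a ≠ 0) : (A.card : ℝ) ≤ 2 * t := by
  have h0 : (0 : ℤ) ∉ A := fun h => (hA 0 h).2 rfl
  have := card_int_le ht (insert 0 A) fun a ha => by
    rcases Finset.mem_insert.1 ha with rfl | ha
    · simpa using ht
    · exact (hA a ha).1
  rw [Finset.card_insert_of_notMem h0] at this
  push_cast at this
  linarith

theorem card_multiples_le {n : ℕ} {v : Fin n → ℤ} {t : ℝ} (ht : 0 ≤ t)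
    (Z : Finset (Fin n → ℤ)) (y : Fin n → ℤ)
    (hZ : ∀ z ∈ Z, ∃ m : ℤ, |(m : ℝ)| ≤ t ∧ z = y + m • v) :
    (Z.card : ℝ) ≤ 2 * t + 1 := by
  classical
  have hZ' : ∀ z : Z, ∃ m : ℤ, |(m : ℝ)| ≤ t ∧ (z : Fin n → ℤ) = y + m • v := fun z => hZ z z.2
  choose f hf hf' using hZ'
  have hinj : Function.Injective f := fun a b h => Subtype.ext (by rw [hf', hf', h])
  have h1 := card_int_le ht (Finset.univ.image f) fun a ha => by
    obtain ⟨z, -, rfl⟩ := Finset.mem_image.1 ha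
    exact hf z
  rwa [Finset.card_image_of_injective _ hinj, Finset.card_univ, Fintype.card_coe] at h1

theorem card_plane_le {Λ : AddSubgroup (Fin 2 → ℤ)} {v : Fin 2 → ℤ}
    (hv : v ∈ Λ) (hv0 : v ≠ 0) (hmin : ∀ w ∈ Λ, w ≠ 0 → supNorm v ≤ supNorm w) {B : ℝ}
    (hB : (supNorm v : ℝ) ≤ B) {b : ℤ} (hb : b ≠ 0) {s : ℕ} (hs : 0 < s)
    (hdvd : ∀ y ∈ Λ, (s : ℤ) ∣ b * planeDet v y) (Y : Finset (Fin 2 → ℤ))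
    (hY : ∀ y ∈ Y, y ∈ Λ ∧ (∀ i, |(y i : ℝ)| ≤ 2 * B) ∧ planeDet v y ≠ 0) :
    (Y.card : ℝ) ≤ 72 * |(b : ℝ)| * B ^ 2 / s := by
  classical
  have hV : 0 < (supNorm v : ℝ) := by exact_mod_cast supNorm_pos hv0
  obtain ⟨V, hVeq⟩ : ∃ V : ℝ, V = supNorm v := ⟨_, rfl⟩
  rw [← hVeq] at hV hB
  have hB0 : 0 < B := lt_of_lt_of_le hV hB
  have hs0 : (0 : ℝ) < s := by exact_mod_cast hs
  let f : (Fin 2 → ℤ) → ℤ := fun y => b * planeDet v y / s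
  have hf : ∀ y ∈ Y, (s : ℤ) * f y = b * planeDet v y := fun y hy =>
    Int.mul_ediv_cancel' (hdvd y (hY y hy).1)
  have hfib : ∀ t ∈ Y.image f, (Y.filter fun y => f y = t).card ≤ ⌊9 * B / V⌋₊ := by
    intro t ht
    obtain ⟨y₀, hy₀, rfl⟩ := Finset.mem_image.1 ht
    have h1 := card_multiples_le (v := v) (t := 4 * B / V) (by positivity)
      (Y.filter fun y => f y = f y₀) y₀ fun z hz => by
        obtain ⟨hzY, hzf⟩ := Finset.mem_filter.1 hz
        have hdet : planeDet v (z - y₀) = 0 := by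
          have h := hf z hzY
          rw [hzf, hf y₀ hy₀] at h
          rw [planeDet_sub, mul_left_cancel₀ hb h, sub_self]
        obtain ⟨m, hm⟩ := exists_eq_zsmul_of_planeDet_eq_zero hv hv0 hmin
          (Λ.sub_mem (hY z hzY).1 (hY y₀ hy₀).1) hdet
        refine ⟨m, ?_, by rw [← hm]; abel⟩
        obtain ⟨i, hi⟩ := exists_natAbs_eq_supNorm hv0
        have hvi : |(v i : ℝ)| = V := by
          rw [hVeq, ← hi, Nat.cast_natAbs, Int.cast_abs]
        rw [le_div_iff₀ hV, ← hvi, ← abs_mul]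
        have h2 : (m : ℝ) * v i = z i - y₀ i := by
          have := congrFun hm i
          simp only [Pi.sub_apply, Pi.smul_apply, smul_eq_mul] at this
          exact_mod_cast this.symm
        rw [h2]
        have h3 := (hY z hzY).2.1 i
        have h4 := (hY y₀ hy₀).2.1 i
        calc _ ≤ |(z i : ℝ)| + |(y₀ i : ℝ)| := abs_sub _ _
          _ ≤ 4 * B := by linarith
    refine Nat.le_floor (h1.trans ?_)
    have : 1 ≤ B / V := by rwa [le_div_iff₀ hV, one_mul]
    calc 2 * (4 * B / V) + 1 ≤ 8 * (B / V) + B / V := by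
          rw [mul_div_assoc]; linarith
      _ = 9 * B / V := by ring
  have hcard := Finset.card_le_mul_card_image Y _ hfib
  have himg : ((Y.image f).card : ℝ) ≤ 2 * (4 * |(b : ℝ)| * V * B / s) := by
    refine card_nonzero_int_le (by positivity) _ fun t ht => ?_
    obtain ⟨y, hy, rfl⟩ := Finset.mem_image.1 ht
    have hfy := hf y hy
    constructor
    · have h1 : (s : ℝ) * f y = b * (v 0 * y 1 - v 1 * y 0) := by
        have := congrArg (fun t : ℤ => (t : ℝ)) hfy
        simp only [planeDet] at this
        push_cast at this
        exact this
      rw [le_div_iff₀ hs0, ← Nat.abs_cast s, ← abs_mul, mul_comm, h1, abs_mul]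
      have a0 := abs_le_supNorm v 0
      have a1 := abs_le_supNorm v 1
      rw [← hVeq] at a0 a1
      have b0 := (hY y hy).2.1 0
      have b1 := (hY y hy).2.1 1
      have h2 : |(v 0 * y 1 - v 1 * y 0 : ℝ)| ≤ 4 * V * B := by
        calc _ ≤ |(v 0 * y 1 : ℝ)| + |(v 1 * y 0 : ℝ)| := abs_sub _ _
          _ ≤ V * (2 * B) + V * (2 * B) := by
              rw [abs_mul, abs_mul]; gcongr
          _ = _ := by ring
      calc _ ≤ |(b : ℝ)| * (4 * V * B) := by gcongr
        _ = _ := by ring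
    · intro h
      rw [h, mul_zero] at hfy
      exact (mul_ne_zero hb (hY y hy).2.2) hfy.symm
  calc (Y.card : ℝ) ≤ (⌊9 * B / V⌋₊ : ℝ) * ((Y.image f).card : ℝ) := by exact_mod_cast hcard
    _ ≤ (9 * B / V) * (2 * (4 * |(b : ℝ)| * V * B / s)) := by
        gcongr
        exact Nat.floor_le (by positivity)
    _ = _ := by field_simp; ring

section
variable {d k : ℕ} {F : MvPolynomial (Fin 2) ℤ} {K M : Type} [Field K] [NumberField K]
    [Field M] [NumberField M]

theorem exists_prime_ideal_over {K : Type*} [Field K] [NumberField K]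
    {𝔠 : Ideal (NumberField.RingOfIntegers K)} {p : ℕ} (hp : p.Prime)
    (h : p ∣ Ideal.absNorm 𝔠) : ∃ 𝔭 : Ideal (NumberField.RingOfIntegers K),
      𝔭.IsPrime ∧ (p : NumberField.RingOfIntegers K) ∈ 𝔭 ∧ 𝔭 ∣ 𝔠 := by
  obtain ⟨𝔭, hmax, hunder, hdvd⟩ := Ideal.exists_isMaximal_dvd_of_dvd_absNorm' hp 𝔠 h
  refine ⟨𝔭, hmax.isPrime, ?_, hdvd⟩
  have : (p : ℤ) ∈ 𝔭.under ℤ := by rw [hunder]; exact Ideal.mem_span_singleton_self _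
  rw [Ideal.under, Ideal.mem_comap] at this
  simpa using this

theorem NormData.dvd_planeDet (D : NormData 2 d k F K M)
    {𝔠 : Ideal (NumberField.RingOfIntegers K)} {s : ℕ} (hs : Squarefree s)
    (hdvd : s ∣ Ideal.absNorm 𝔠) {v y : Fin 2 → ℤ} (hv : D.lin v ∈ 𝔠) (hy : D.lin y ∈ 𝔠) :
    (s : ℤ) ∣ D.b * planeDet v y := by
  rw [Int.natCast_dvd, ← Nat.prod_primeFactors_of_squarefree hs]
  refine Finset.prod_primes_dvd _ (fun p hp => (Nat.prime_of_mem_primeFactors hp).prime)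
    fun p hp => ?_
  have hpp := Nat.prime_of_mem_primeFactors hp
  obtain ⟨𝔭, hprime, hp𝔭, hle⟩ := exists_prime_ideal_over hpp
    ((Nat.dvd_of_mem_primeFactors hp).trans hdvd)
  rw [Ideal.dvd_iff_le] at hle
  rw [← Int.natCast_dvd, ← int_mem_prime_iff hprime hpp hp𝔭]
  have hv' := hle hv
  have hy' := hle hy
  rw [D.lin_apply, Fin.sum_univ_two, zsmul_eq_mul, zsmul_eq_mul] at hv' hy'
  have hω := D.ω_i₀
  have hi : D.i₀ = 0 ∨ D.i₀ = 1 := by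
    rcases D.i₀ with ⟨i, hi⟩
    interval_cases i
    · left; rfl
    · right; rfl
  rcases hi with h0 | h0 <;> rw [h0] at hω <;> rw [hω] at hv' hy'
  · have := 𝔭.sub_mem (𝔭.mul_mem_left (y 1 : NumberField.RingOfIntegers K) hv')
      (𝔭.mul_mem_left (v 1 : NumberField.RingOfIntegers K) hy')
    convert this using 1
    simp only [planeDet]
    push_cast
    ring
  · have := 𝔭.sub_mem (𝔭.mul_mem_left (v 0 : NumberField.RingOfIntegers K) hy')
      (𝔭.mul_mem_left (y 0 : NumberField.RingOfIntegers K) hv')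
    convert this using 1
    simp only [planeDet]
    push_cast
    ring

theorem exists_card_ideals_dvd_le (K : Type*) [Field K] [NumberField K] (δ : ℝ) (hδ : 0 < δ) :
    ∃ C : ℝ, 1 ≤ C ∧ ∀ P : ℝ, 1 ≤ P → ∀ S : Finset ℕ,
      (∀ p ∈ S, p.Prime ∧ P ^ (2 * δ) ≤ p ∧ (p : ℝ) ≤ P) → (S.card : ℝ) ≤ P ^ δ + 1 →
      ∀ X : ℝ, 0 ≤ X → ∀ 𝒞 : Finset (Ideal (NumberField.RingOfIntegers K)),
        (∀ 𝔠 ∈ 𝒞, 𝔠 ≠ ⊥ ∧ (Ideal.absNorm 𝔠 : ℝ) ≤ X ∧ ∃ p ∈ S, p ∣ Ideal.absNorm 𝔠) →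
        (𝒞.card : ℝ) ≤ C * X * P ^ (-(δ / 2)) := by
  classical
  let g := Module.finrank ℤ (NumberField.RingOfIntegers K)
  obtain ⟨C₁, hC₁, hdiv⟩ := exists_card_ideal_dvd_le K (δ / (2 * (g + 1))) (by positivity)
  obtain ⟨C₂, hC₂, hcount⟩ := exists_card_ideals_le K
  refine ⟨2 * C₁ * C₂, by nlinarith, fun P hP S hS hScard X hX 𝒞 h𝒞 => ?_⟩
  have hP0 : 0 < P := by linarith
  have hspan : ∀ p ∈ S, Ideal.span {(p : NumberField.RingOfIntegers K)} ≠ ⊥ := fun p hp => by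
    rw [Ne, Ideal.span_singleton_eq_bot]
    exact_mod_cast (hS p hp).1.ne_zero
  let Dv : ℕ → Finset (Ideal (NumberField.RingOfIntegers K)) := fun p =>
    if hp : p ∈ S then (hdiv _ (hspan p hp)).1.toFinset else ∅
  have hDv : ∀ p ∈ S, ∀ J, J ∈ Dv p ↔ J ∣ Ideal.span {(p : NumberField.RingOfIntegers K)} :=
    fun p hp J => by simp [Dv, dif_pos hp]
  let E : ℝ → Finset (Ideal (NumberField.RingOfIntegers K)) := fun y =>
    (Ideal.finite_setOfPred_absNorm_le (S := NumberField.RingOfIntegers K) ⌊y⌋₊).toFinset.erase ⊥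
  have hE : ∀ y, 0 ≤ y → ∀ J, J ∈ E y ↔ J ≠ ⊥ ∧ (Ideal.absNorm J : ℝ) ≤ y := fun y hy J => by
    simp [E, Nat.le_floor_iff hy]
  have hsub : 𝒞 ⊆ S.biUnion fun p => (Dv p ×ˢ E (X / p)).image fun q => q.1 * q.2 := by
    intro 𝔠 h𝔠
    obtain ⟨h0, hX', p, hpS, hp⟩ := h𝒞 𝔠 h𝔠
    have hpp := (hS p hpS).1
    obtain ⟨𝔭, hprime, hp𝔭, 𝔮, rfl⟩ := exists_prime_ideal_over hpp hp
    refine Finset.mem_biUnion.2 ⟨p, hpS, Finset.mem_image.2 ⟨(𝔭, 𝔮), Finset.mem_product.2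
      ⟨(hDv p hpS _).2 (Ideal.dvd_span_singleton.2 hp𝔭), (hE _ (by positivity) _).2 ⟨?_, ?_⟩⟩,
      rfl⟩⟩
    · rintro rfl
      exact h0 (Ideal.mul_bot _)
    · have hpos : (0 : ℝ) < p := by exact_mod_cast hpp.pos
      rw [le_div_iff₀ hpos]
      refine le_trans ?_ hX'
      rw [map_mul, mul_comm]
      push_cast
      refine mul_le_mul_of_nonneg_right ?_ (by positivity)
      have hne : Ideal.absNorm 𝔭 ≠ 0 := by
        rw [Ne, Ideal.absNorm_eq_zero_iff]
        rintro rfl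
        exact h0 (Ideal.bot_mul _)
      have h1 := Ideal.absNorm_mem 𝔭
      have h2 : ((Ideal.absNorm 𝔭 : ℤ) : NumberField.RingOfIntegers K) ∈ 𝔭 := by simpa using h1
      rw [int_mem_prime_iff hprime hpp hp𝔭] at h2
      exact_mod_cast Nat.le_of_dvd (Nat.pos_of_ne_zero hne) (by exact_mod_cast h2)
  have hterm : ∀ p ∈ S, (((Dv p ×ˢ E (X / p)).image fun q => q.1 * q.2).card : ℝ) ≤
      C₁ * C₂ * X * P ^ (-(3 * δ / 2)) := by
    intro p hpS
    obtain ⟨hpp, hpl, hpu⟩ := hS p hpS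
    have hpos : (0 : ℝ) < p := by exact_mod_cast hpp.pos
    have h1 : ((Dv p).card : ℝ) ≤ C₁ * P ^ (δ / 2) := by
      have h2 := (hdiv _ (hspan p hpS)).2
      rw [Set.ncard_eq_toFinset_card _ (hdiv _ (hspan p hpS)).1] at h2
      simp only [Dv, dif_pos hpS]
      refine h2.trans ?_
      rw [Ideal.absNorm_span_natCast]
      refine mul_le_mul_of_nonneg_left ?_ (by linarith)
      have hgle : (g : ℝ) * (δ / (2 * (g + 1))) ≤ δ / 2 := by
        have : (g : ℝ) * (δ / (2 * (g + 1))) = δ / 2 * (g / (g + 1)) := by field_simp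
        rw [this]
        refine mul_le_of_le_one_right (by positivity) ?_
        rw [div_le_one (by positivity)]; linarith
      push_cast
      calc ((p : ℝ) ^ g) ^ (δ / (2 * ((g : ℝ) + 1)))
          ≤ (P ^ g) ^ (δ / (2 * ((g : ℝ) + 1))) := by gcongr
        _ = P ^ ((g : ℝ) * (δ / (2 * (g + 1)))) := by
            rw [← Real.rpow_natCast, ← Real.rpow_mul hP0.le]
        _ ≤ P ^ (δ / 2) := Real.rpow_le_rpow_of_exponent_le hP hgle
    have h3 : ((E (X / p)).card : ℝ) ≤ C₂ * (X * P ^ (-(2 * δ))) := by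
      refine (hcount (X / p) (E (X / p)) (fun J hJ => (hE _ (by positivity) _).1 hJ)
        (by positivity)).trans ?_
      refine mul_le_mul_of_nonneg_left ?_ (by linarith)
      rw [Real.rpow_neg hP0.le, ← div_eq_mul_inv]
      gcongr
    calc _ ≤ (((Dv p).card * (E (X / p)).card : ℕ) : ℝ) := by
          rw [← Finset.card_product]
          exact_mod_cast Finset.card_image_le
      _ ≤ (C₁ * P ^ (δ / 2)) * (C₂ * (X * P ^ (-(2 * δ)))) := by push_cast; gcongr
      _ = C₁ * C₂ * X * (P ^ (δ / 2) * P ^ (-(2 * δ))) := by ring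
      _ = _ := by rw [← Real.rpow_add hP0]; congr 2; ring
  have hPd : 1 ≤ P ^ δ := Real.one_le_rpow hP hδ.le
  calc (𝒞.card : ℝ) ≤ ∑ p ∈ S, (((Dv p ×ˢ E (X / p)).image fun q => q.1 * q.2).card : ℝ) := by
        exact_mod_cast (Finset.card_le_card hsub).trans Finset.card_biUnion_le
    _ ≤ S.card • (C₁ * C₂ * X * P ^ (-(3 * δ / 2))) := Finset.sum_le_card_nsmul _ _ _ hterm
    _ ≤ (2 * P ^ δ) * (C₁ * C₂ * X * P ^ (-(3 * δ / 2))) := by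
        rw [nsmul_eq_mul]
        gcongr
        linarith
    _ = 2 * C₁ * C₂ * X * (P ^ δ * P ^ (-(3 * δ / 2))) := by ring
    _ = _ := by rw [← Real.rpow_add hP0]; congr 2; ring

end

section
variable {n d k : ℕ} {K M : Type} [Field K] [NumberField K] [Field M] [NumberField M]

theorem NormData.exists_not_dvd_of_minimal {F : MvPolynomial (Fin n) ℤ} (D : NormData n d k F K M)
    {𝔠 : Ideal (NumberField.RingOfIntegers K)} {v : Fin n → ℤ} (hv0 : v ≠ 0) (hv : D.lin v ∈ 𝔠)
    (hmin : ∀ w, w ≠ 0 → D.lin w ∈ 𝔠 → supNorm v ≤ supNorm w) {p : ℕ} (hp : p.Prime)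
    (hpN : ¬ p ∣ Ideal.absNorm 𝔠) : ∃ i, ¬ (p : ℤ) ∣ v i := by
  by_contra! h
  choose w hw using h
  have hvw : v = (p : ℤ) • w := funext fun i => by simp [hw i]
  have hw0 : w ≠ 0 := by
    rintro rfl
    exact hv0 (by rw [hvw, smul_zero])
  have hc : IsCoprime (p : ℤ) (Ideal.absNorm 𝔠 : ℤ) :=
    Nat.isCoprime_iff_coprime.2 ((Nat.Prime.coprime_iff_not_dvd hp).2 hpN)
  obtain ⟨a, b, hab⟩ := hc
  have hmem : D.lin w ∈ 𝔠 := by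
    have e : D.lin w = (a : NumberField.RingOfIntegers K) * D.lin v +
        ((b : NumberField.RingOfIntegers K) * D.lin w) *
          ((Ideal.absNorm 𝔠 : ℕ) : NumberField.RingOfIntegers K) := by
      have h1 := congrArg (fun t : ℤ => (t : NumberField.RingOfIntegers K)) hab
      push_cast at h1
      rw [hvw, map_zsmul, zsmul_eq_mul]
      push_cast
      linear_combination (-D.lin w) * h1
    rw [e]
    exact 𝔠.add_mem (𝔠.mul_mem_left _ hv) (𝔠.mul_mem_left _ (Ideal.absNorm_mem 𝔠))
  have h1 := hmin w hw0 hmem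
  obtain ⟨i, hi⟩ := exists_natAbs_eq_supNorm hw0
  have h2 := natAbs_le_supNorm v i
  rw [hw i, Int.natAbs_mul, Int.natAbs_natCast, hi] at h2
  have h3 := supNorm_pos hw0
  have h4 := hp.two_le
  nlinarith

variable {F : MvPolynomial (Fin 2) ℤ}

theorem NormData.exists_plane_vector (D : NormData 2 d k F K M) {R B W : ℝ} (hR : 1 ≤ R)
    (hB : 0 < B) {𝔠 : Ideal (NumberField.RingOfIntegers K)} (h𝔠 : 𝔠 ≠ ⊥)
    {u s : ℕ} (hus : Ideal.absNorm 𝔠 = u * s) (hu : (u : ℝ) ≤ W) (hs : Squarefree s)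
    (hlow : B ^ 2 / (2 * R) ≤ Ideal.absNorm 𝔠) (hupp : (Ideal.absNorm 𝔠 : ℝ) ≤ B ^ 2 / R) :
    ∃ v, v ≠ 0 ∧ D.lin v ∈ 𝔠 ∧ (supNorm v : ℝ) * R ^ ((1 : ℝ) / 2) ≤ B ∧
      (∀ w, w ≠ 0 → D.lin w ∈ 𝔠 → supNorm v ≤ supNorm w) ∧
      (∀ y, D.lin y ∈ 𝔠 → planeDet v y = 0 → ∃ m : ℤ, y = m • v) ∧
      ∀ Y : Finset (Fin 2 → ℤ),
        (∀ y ∈ Y, D.lin y ∈ 𝔠 ∧ (∀ i, |(y i : ℝ)| ≤ 2 * B) ∧ planeDet v y ≠ 0) →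
        (Y.card : ℝ) ≤ 144 * |(D.b : ℝ)| * W * R := by
  obtain ⟨v, hv0, hv, hvN, hmin⟩ := D.exists_minimal_vector (by norm_num) h𝔠
  have hR0 : 0 < R := by linarith
  have hVB : (supNorm v : ℝ) * R ^ ((1 : ℝ) / 2) ≤ B := by
    have h1 : ((supNorm v : ℝ) * R ^ ((1 : ℝ) / 2)) ^ 2 ≤ B ^ 2 := by
      have e : (R ^ ((1 : ℝ) / 2)) ^ 2 = R := by
        rw [← Real.rpow_natCast, ← Real.rpow_mul hR0.le]; norm_num
      rw [mul_pow, e, ← le_div_iff₀ hR0]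
      exact le_trans (by exact_mod_cast hvN) hupp
    exact (pow_le_pow_iff_left₀ (by positivity) hB.le (by norm_num)).1 h1
  have hVB' : (supNorm v : ℝ) ≤ B :=
    le_trans (le_mul_of_one_le_right (by positivity) (Real.one_le_rpow hR (by norm_num))) hVB
  let Λ : AddSubgroup (Fin 2 → ℤ) := 𝔠.toAddSubgroup.comap D.lin
  have hΛ : ∀ y, y ∈ Λ ↔ D.lin y ∈ 𝔠 := fun y => Iff.rfl
  have hminΛ : ∀ w ∈ Λ, w ≠ 0 → supNorm v ≤ supNorm w := fun w hw hw0 => hmin w hw0 hw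
  refine ⟨v, hv0, hv, hVB, hmin, fun y hy hdet =>
    exists_eq_zsmul_of_planeDet_eq_zero (Λ := Λ) hv hv0 hminΛ hy hdet, fun Y hY => ?_⟩
  have hs0 : 0 < s := Nat.pos_of_ne_zero hs.ne_zero
  have h1 := card_plane_le (Λ := Λ) hv hv0 hminΛ hVB' D.b_ne hs0
    (fun y hy => D.dvd_planeDet hs (hus ▸ Dvd.intro_left _ rfl) hv hy) Y hY
  refine h1.trans ?_
  have hs' : (0 : ℝ) < s := by exact_mod_cast hs0
  rw [div_le_iff₀ hs']
  have h2 : B ^ 2 / (2 * R) ≤ W * s := by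
    refine hlow.trans ?_
    rw [hus]; push_cast
    gcongr
  rw [div_le_iff₀ (by positivity)] at h2
  have hb : 0 ≤ |(D.b : ℝ)| := abs_nonneg _
  calc 72 * |(D.b : ℝ)| * B ^ 2 ≤ 72 * |(D.b : ℝ)| * (W * s * (2 * R)) := by gcongr
    _ = _ := by ring

end

section
variable {d k : ℕ} {F : MvPolynomial (Fin 2) ℤ} {K M : Type} [Field K] [NumberField K]
    [Field M] [NumberField M]

theorem NormData.exists_card_plane_fiber_le (D : NormData 2 d k F K M) (hk : 1 ≤ k) (hd : 2 ≤ d) :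
    ∃ δ : ℝ, 0 < δ ∧ δ ≤ 1 ∧ ∃ R₀ : ℝ, 1 ≤ R₀ ∧ ∃ C : ℝ, 1 ≤ C ∧ ∀ R : ℝ, R₀ ≤ R →
      ∃ S : Finset ℕ, (∀ p ∈ S, p.Prime ∧ (R ^ ((1 : ℝ) / 20)) ^ (2 * δ) ≤ p ∧
        (p : ℝ) ≤ R ^ ((1 : ℝ) / 20)) ∧ (S.card : ℝ) ≤ (R ^ ((1 : ℝ) / 20)) ^ δ + 1 ∧
      ∀ B W : ℝ, 0 < B → 1 ≤ W → ∀ 𝔠 : Ideal (NumberField.RingOfIntegers K), 𝔠 ≠ ⊥ →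
        ∀ u s : ℕ, Ideal.absNorm 𝔠 = u * s → (u : ℝ) ≤ W → Squarefree s →
        B ^ 2 / (2 * R) ≤ Ideal.absNorm 𝔠 → (Ideal.absNorm 𝔠 : ℝ) ≤ B ^ 2 / R →
        ∀ A : Finset (Fin 2 → ℤ),
          (∀ x ∈ A, (∀ i, |(x i : ℝ)| ≤ B) ∧ x ≠ 0 ∧
            (∀ (m : ℤ) (w : Fin 2 → ℤ), x = m • w → |(m : ℝ)| ≤ W) ∧
            ∃ 𝔭 : Ideal (NumberField.RingOfIntegers K), Ideal.span {D.lin x} = 𝔠 * 𝔭 ^ k) →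
          (A.card : ℝ) ≤ 3 * W + C * W * R ∧ ((∀ p ∈ S, ¬ p ∣ Ideal.absNorm 𝔠) →
            (A.card : ℝ) ≤ 3 * W + C * W * R * R ^ (-(δ / 20))) := by
  classical
  obtain ⟨δ, hδ, hδ1, P₀, hP₀, C, hC, hsieve⟩ := D.exists_sieve hk hd
  have hb1 : 1 ≤ |(D.b : ℝ)| := by exact_mod_cast Int.one_le_abs D.b_ne
  refine ⟨δ, hδ, hδ1, P₀ ^ (20 : ℝ), Real.one_le_rpow hP₀ (by norm_num),
    C * (144 * |(D.b : ℝ)|) * 3, by nlinarith, fun R hR => ?_⟩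
  have hR1 : 1 ≤ R := (Real.one_le_rpow hP₀ (by norm_num)).trans hR
  have hR0 : 0 < R := by linarith
  have hPR : P₀ ≤ R ^ ((1 : ℝ) / 20) := by
    calc P₀ = (P₀ ^ (20 : ℝ)) ^ ((1 : ℝ) / 20) := by
          rw [← Real.rpow_mul (by linarith)]; norm_num
      _ ≤ _ := Real.rpow_le_rpow (by positivity) hR (by norm_num)
  obtain ⟨S, hS, hScard, hScard', hS'⟩ := hsieve _ hPR
  refine ⟨S, hS, hScard', fun B W hB hW 𝔠 h𝔠 u s hus hu hs hlow hupp A hA => ?_⟩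
  obtain ⟨v, hv0, hv, hVB, hmin, hline, hYcard⟩ :=
    D.exists_plane_vector hR1 hB h𝔠 hus hu hs hlow hupp
  let Box := (finite_box (n := 2) (2 * B)).toFinset
  have hBox : ∀ y, y ∈ Box ↔ ∀ i, |(y i : ℝ)| ≤ 2 * B := fun y => by simp [Box]
  obtain ⟨Y, hYdef⟩ : ∃ Y, Y = Box.filter fun y => D.lin y ∈ 𝔠 ∧ planeDet v y ≠ 0 := ⟨_, rfl⟩
  have hYmem : ∀ y, y ∈ Y ↔ (∀ i, |(y i : ℝ)| ≤ 2 * B) ∧ D.lin y ∈ 𝔠 ∧ planeDet v y ≠ 0 := by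
    intro y; rw [hYdef, Finset.mem_filter, hBox]
  have hYle : (Y.card : ℝ) ≤ 144 * |(D.b : ℝ)| * W * R := hYcard Y fun y hy => by
    obtain ⟨h1, h2, h3⟩ := (hYmem y).1 hy
    exact ⟨h2, h1, h3⟩
  have hAmem : ∀ x ∈ A, D.lin x ∈ 𝔠 := fun x hx => by
    obtain ⟨𝔭, h𝔭⟩ := (hA x hx).2.2.2
    exact mem_of_span_singleton_eq_mul h𝔭
  obtain ⟨A₁, hA₁⟩ : ∃ A₁, A₁ = A.filter fun x => planeDet v x = 0 := ⟨_, rfl⟩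
  obtain ⟨A₂, hA₂⟩ : ∃ A₂, A₂ = A.filter fun x => ¬ planeDet v x = 0 := ⟨_, rfl⟩
  have hsplit : A₁.card + A₂.card = A.card := by
    rw [hA₁, hA₂]; exact Finset.card_filter_add_card_filter_not _
  have hsplit' : (A.card : ℝ) = A₁.card + A₂.card := by rw [← hsplit]; push_cast; rfl
  have hon : (A₁.card : ℝ) ≤ 3 * W := by
    have h1 := card_multiples_le (v := v) (t := W) (by linarith) A₁ 0 fun x hx => by
      rw [hA₁, Finset.mem_filter] at hx
      obtain ⟨m, hm⟩ := hline x (hAmem x hx.1) hx.2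
      exact ⟨m, (hA x hx.1).2.2.1 m v hm, by rw [hm, zero_add]⟩
    linarith
  have hoffY : A₂ ⊆ Y := fun x hx => by
    rw [hA₂, Finset.mem_filter] at hx
    exact (hYmem x).2 ⟨fun i => ((hA x hx.1).1 i).trans (by linarith), hAmem x hx.1, hx.2⟩
  have hC144 : 144 * |(D.b : ℝ)| ≤ C * (144 * |(D.b : ℝ)|) * 3 := by nlinarith
  constructor
  · have h1 : (A₂.card : ℝ) ≤ Y.card := by exact_mod_cast Finset.card_le_card hoffY
    have h2 : 144 * |(D.b : ℝ)| * W * R ≤ C * (144 * |(D.b : ℝ)|) * 3 * W * R := by gcongr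
    linarith
  · intro hgood
    have hfl1 : 1 ≤ R ^ ((1 : ℝ) / 2) := Real.one_le_rpow hR1 (by norm_num)
    have hfl : R ^ ((1 : ℝ) / 2) / 2 ≤ (⌊R ^ ((1 : ℝ) / 2)⌋₊ : ℝ) := by
      have h1 := Nat.lt_floor_add_one (R ^ ((1 : ℝ) / 2))
      have h2 : (1 : ℝ) ≤ (⌊R ^ ((1 : ℝ) / 2)⌋₊ : ℝ) := by
        exact_mod_cast Nat.le_floor (by simpa using hfl1)
      linarith
    have hflle : (⌊R ^ ((1 : ℝ) / 2)⌋₊ : ℝ) ≤ R ^ ((1 : ℝ) / 2) := Nat.floor_le (by positivity)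
    have hPδ : (R ^ ((1 : ℝ) / 20)) ^ δ = R ^ (δ / 20) := by
      rw [← Real.rpow_mul hR0.le]; congr 1; ring
    have hP2 : (R ^ ((1 : ℝ) / 20)) ^ 2 = R ^ ((1 : ℝ) / 10) := by
      rw [← Real.rpow_natCast, ← Real.rpow_mul hR0.le]; norm_num
    rw [hPδ] at hScard
    have hRδ : 0 < R ^ (δ / 20) := by positivity
    have hSpos : (0 : ℝ) < S.card := by linarith
    have main := hS' 𝔠 v S (Finset.Subset.refl _) (Finset.card_pos.1 (by exact_mod_cast hSpos))
      (fun p hp => Or.inr ⟨rfl, D.exists_not_dvd_of_minimal hv0 hv hmin (hS p hp).1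
        (hgood p hp)⟩) A₂ Y _ (Nat.floor_pos.2 hfl1)
      (fun x hx m hm => by
        have hx' := (hYmem x).1 (hoffY hx)
        have hxA : x ∈ A := by
          rw [hA₂] at hx; exact Finset.mem_of_mem_filter x hx
        refine (hYmem _).2 ⟨fun i => ?_, D.lin_add_nsmul_mem hx'.2.1 hv m, ?_⟩
        · have h1 : (m : ℝ) ≤ R ^ ((1 : ℝ) / 2) := le_trans (by exact_mod_cast hm.le) hflle
          have h2 : (m : ℝ) * |(v i : ℝ)| ≤ B := by
            calc (m : ℝ) * |(v i : ℝ)| ≤ R ^ ((1 : ℝ) / 2) * supNorm v := by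
                  gcongr
                  exact abs_le_supNorm v i
              _ ≤ B := by rwa [mul_comm]
          have h3 : (((x + m • v) i : ℤ) : ℝ) = x i + m * v i := by simp
          rw [h3]
          calc _ ≤ |(x i : ℝ)| + |(m : ℝ) * v i| := abs_add_le _ _
            _ ≤ B + B := by
                rw [abs_mul, Nat.abs_cast]
                exact add_le_add ((hA x hxA).1 i) h2
            _ = 2 * B := by ring
        · rw [planeDet_add_nsmul]; exact hx'.2.2)
      (fun x hx => by
        have hxA : x ∈ A := by
          rw [hA₂] at hx; exact Finset.mem_of_mem_filter x hx
        exact ⟨(hA x hxA).2.1, (hA x hxA).2.2.2⟩)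
    have h1 : 1 / (S.card : ℝ) ≤ R ^ (-(δ / 20)) := by
      rw [Real.rpow_neg hR0.le, ← one_div]
      gcongr
    have h2 : (R ^ ((1 : ℝ) / 20)) ^ 2 / (⌊R ^ ((1 : ℝ) / 2)⌋₊ : ℝ) ≤ 2 * R ^ (-(δ / 20)) := by
      rw [hP2]
      calc _ ≤ R ^ ((1 : ℝ) / 10) / (R ^ ((1 : ℝ) / 2) / 2) := by gcongr
        _ = 2 * (R ^ ((1 : ℝ) / 10) / R ^ ((1 : ℝ) / 2)) := by field_simp
        _ = 2 * R ^ ((1 : ℝ) / 10 - 1 / 2) := by rw [Real.rpow_sub hR0]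
        _ ≤ _ := by
            refine mul_le_mul_of_nonneg_left ?_ (by positivity)
            exact Real.rpow_le_rpow_of_exponent_le hR1 (by linarith)
    have h3 : (A₂.card : ℝ) ≤ C * (144 * |(D.b : ℝ)|) * 3 * W * R * R ^ (-(δ / 20)) := by
      calc _ ≤ _ := main
        _ ≤ C * (144 * |(D.b : ℝ)| * W * R) * (R ^ (-(δ / 20)) + 2 * R ^ (-(δ / 20))) := by
            gcongr
        _ = _ := by ring
    linarith

theorem NormData.exists_card_scale_le (D : NormData 2 d k F K M) (hk : 1 ≤ k) (hd : 2 ≤ d) :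
    ∃ δ : ℝ, 0 < δ ∧ ∃ R₀ : ℝ, 1 ≤ R₀ ∧ ∃ C : ℝ, 1 ≤ C ∧ ∀ R : ℝ, R₀ ≤ R →
      ∀ B W : ℝ, 0 < B → 1 ≤ W → ∀ T : Finset (Fin 2 → ℤ),
        (∀ x ∈ T, (∀ i, |(x i : ℝ)| ≤ B) ∧ x ≠ 0 ∧
          (∀ (m : ℤ) (w : Fin 2 → ℤ), x = m • w → |(m : ℝ)| ≤ W) ∧
          ∃ 𝔠 𝔭 : Ideal (NumberField.RingOfIntegers K), ∃ u s : ℕ,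
            Ideal.span {D.lin x} = 𝔠 * 𝔭 ^ k ∧ Ideal.absNorm 𝔠 = u * s ∧ (u : ℝ) ≤ W ∧
            Squarefree s ∧ B ^ 2 / (2 * R) ≤ Ideal.absNorm 𝔠 ∧
            (Ideal.absNorm 𝔠 : ℝ) ≤ B ^ 2 / R) →
        (T.card : ℝ) ≤ C * W * B ^ 2 * R ^ (-δ) := by
  classical
  obtain ⟨δ, hδ, hδ1, R₀, hR₀, C, hC, hfib⟩ := D.exists_card_plane_fiber_le hk hd
  obtain ⟨C₂, hC₂, hcount⟩ := exists_card_ideals_le K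
  obtain ⟨C₃, hC₃, hbad⟩ := exists_card_ideals_dvd_le K δ hδ
  refine ⟨δ / 40, by positivity, R₀, hR₀, C₂ * (3 + C) + C₃ * C, ?_, ?_⟩
  · nlinarith [mul_nonneg (by linarith : 0 ≤ C₃) (by linarith : 0 ≤ C)]
  intro R hR B W hB hW T hT
  have hR1 : 1 ≤ R := hR₀.trans hR
  have hR0 : 0 < R := by linarith
  obtain ⟨S, hS, hScard, hfib'⟩ := hfib R hR
  have hT' : ∀ x : T, ∃ 𝔠 𝔭 : Ideal (NumberField.RingOfIntegers K), ∃ u s : ℕ,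
      Ideal.span {D.lin (x : Fin 2 → ℤ)} = 𝔠 * 𝔭 ^ k ∧ Ideal.absNorm 𝔠 = u * s ∧ (u : ℝ) ≤ W ∧
      Squarefree s ∧ B ^ 2 / (2 * R) ≤ Ideal.absNorm 𝔠 ∧ (Ideal.absNorm 𝔠 : ℝ) ≤ B ^ 2 / R :=
    fun x => (hT x x.2).2.2.2
  choose c' p' u' s' hc' using hT'
  let c : (Fin 2 → ℤ) → Ideal (NumberField.RingOfIntegers K) := fun x =>
    if h : x ∈ T then c' ⟨x, h⟩ else ⊤
  have hc : ∀ x ∈ T, (∃ 𝔭, Ideal.span {D.lin x} = c x * 𝔭 ^ k) ∧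
      ∃ u s : ℕ, Ideal.absNorm (c x) = u * s ∧ (u : ℝ) ≤ W ∧
      Squarefree s ∧ B ^ 2 / (2 * R) ≤ Ideal.absNorm (c x) ∧
      (Ideal.absNorm (c x) : ℝ) ≤ B ^ 2 / R := fun x hx => by
    simp only [c, dif_pos hx]
    have h := hc' ⟨x, hx⟩
    exact ⟨⟨_, h.1⟩, _, _, h.2⟩
  have hcne : ∀ x ∈ T, c x ≠ ⊥ := fun x hx h => by
    obtain ⟨⟨𝔭, h1⟩, -⟩ := hc x hx
    rw [h, Ideal.bot_mul, Ideal.span_singleton_eq_bot] at h1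
    exact (hT x hx).2.1 (D.lin_injective (by rw [h1, map_zero]))
  obtain ⟨𝒞, h𝒞⟩ : ∃ 𝒞, 𝒞 = T.image c := ⟨_, rfl⟩
  have h𝒞prop : ∀ 𝔠 ∈ 𝒞, 𝔠 ≠ ⊥ ∧ (Ideal.absNorm 𝔠 : ℝ) ≤ B ^ 2 / R := fun 𝔠 h => by
    rw [h𝒞] at h
    obtain ⟨x, hx, rfl⟩ := Finset.mem_image.1 h
    obtain ⟨-, u, s, -, -, -, -, h'⟩ := hc x hx
    exact ⟨hcne x hx, h'⟩
  have h𝒞card : (𝒞.card : ℝ) ≤ C₂ * (B ^ 2 / R) := hcount _ 𝒞 h𝒞prop (by positivity)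
  obtain ⟨𝒟, h𝒟⟩ : ∃ 𝒟, 𝒟 = 𝒞.filter fun 𝔠 => ∃ p ∈ S, p ∣ Ideal.absNorm 𝔠 := ⟨_, rfl⟩
  have h𝒟card : (𝒟.card : ℝ) ≤ C₃ * (B ^ 2 / R) * R ^ (-(δ / 40)) := by
    have := hbad (R ^ ((1 : ℝ) / 20)) (Real.one_le_rpow hR1 (by norm_num)) S hS hScard
      (B ^ 2 / R) (by positivity) 𝒟 fun 𝔠 h => by
        rw [h𝒟, Finset.mem_filter] at h
        exact ⟨(h𝒞prop 𝔠 h.1).1, (h𝒞prop 𝔠 h.1).2, h.2⟩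
    rw [← Real.rpow_mul hR0.le] at this
    convert this using 3
    ring
  have hfiber : ∀ 𝔠 ∈ 𝒞, ((T.filter fun x => c x = 𝔠).card : ℝ) ≤
      (3 * W + C * W * R * R ^ (-(δ / 20))) + if 𝔠 ∈ 𝒟 then C * W * R else 0 := by
    intro 𝔠 h𝔠
    have h𝔠' := h𝔠
    rw [h𝒞] at h𝔠'
    obtain ⟨x₀, hx₀, hx₀c⟩ := Finset.mem_image.1 h𝔠'
    obtain ⟨-, u, s, h1, h2, h3, h4, h5⟩ := hc x₀ hx₀
    rw [hx₀c] at h1 h4 h5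
    obtain ⟨e1, e2⟩ := hfib' B W hB hW 𝔠 (h𝒞prop 𝔠 h𝔠).1 u s h1 h2 h3 h4 h5
      (T.filter fun x => c x = 𝔠) fun x hx => by
        obtain ⟨hxT, hxc⟩ := Finset.mem_filter.1 hx
        have := (hc x hxT).1
        rw [hxc] at this
        exact ⟨(hT x hxT).1, (hT x hxT).2.1, (hT x hxT).2.2.1, this⟩
    have hpos : 0 ≤ C * W * R * R ^ (-(δ / 20)) := by positivity
    split_ifs with h
    · linarith
    · have := e2 fun p hp hdvd => h (by
        rw [h𝒟, Finset.mem_filter]; exact ⟨h𝔠, p, hp, hdvd⟩)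
      linarith
  have hcard := Finset.card_eq_sum_card_fiberwise (s := T) (t := 𝒞) (f := c)
    fun x hx => by rw [h𝒞]; exact Finset.mem_image_of_mem c hx
  have hsub : 𝒟 ⊆ 𝒞 := by rw [h𝒟]; exact Finset.filter_subset _ _
  have hR20 : R * R ^ (-(δ / 20)) = R ^ (1 - δ / 20) := by
    rw [sub_eq_add_neg, Real.rpow_add hR0, Real.rpow_one]
  have hle1 : R ^ (-(δ / 20)) ≤ R ^ (-(δ / 40)) :=
    Real.rpow_le_rpow_of_exponent_le hR1 (by linarith)
  have hle2 : 1 / R ≤ R ^ (-(δ / 40)) := by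
    rw [one_div, ← Real.rpow_neg_one]
    exact Real.rpow_le_rpow_of_exponent_le hR1 (by linarith)
  calc (T.card : ℝ) = ∑ 𝔠 ∈ 𝒞, ((T.filter fun x => c x = 𝔠).card : ℝ) := by
        rw [hcard]; push_cast; rfl
    _ ≤ ∑ 𝔠 ∈ 𝒞, ((3 * W + C * W * R * R ^ (-(δ / 20))) +
          if 𝔠 ∈ 𝒟 then C * W * R else 0) := Finset.sum_le_sum hfiber
    _ = 𝒞.card * (3 * W + C * W * R * R ^ (-(δ / 20))) + 𝒟.card * (C * W * R) := by
        rw [Finset.sum_add_distrib, Finset.sum_const, nsmul_eq_mul, ← Finset.sum_filter,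
          Finset.filter_mem_eq_inter, Finset.inter_eq_right.2 hsub, Finset.sum_const, nsmul_eq_mul]
    _ ≤ C₂ * (B ^ 2 / R) * (3 * W + C * W * R * R ^ (-(δ / 20))) +
          C₃ * (B ^ 2 / R) * R ^ (-(δ / 40)) * (C * W * R) := by gcongr
    _ = C₂ * B ^ 2 * W * (3 * (1 / R) + C * R ^ (-(δ / 20))) +
          C₃ * C * W * B ^ 2 * R ^ (-(δ / 40)) := by field_simp
    _ ≤ C₂ * B ^ 2 * W * (3 * R ^ (-(δ / 40)) + C * R ^ (-(δ / 40))) +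
          C₃ * C * W * B ^ 2 * R ^ (-(δ / 40)) := by gcongr
    _ = _ := by ring

end

section
variable {d k : ℕ} {F : MvPolynomial (Fin 2) ℤ} {K M : Type} [Field K] [NumberField K]
    [Field M] [NumberField M]

theorem exists_dyadic_bracket {a b : ℝ} (ha : 0 < a) (hab : a ≤ b) :
    ∃ j : ℕ, b / (2 * 2 ^ j) ≤ a ∧ a ≤ b / 2 ^ j := by
  have h1 : 1 ≤ b / a := by rwa [le_div_iff₀ ha, one_mul]
  obtain ⟨j, hj1, hj2⟩ := exists_nat_pow_near h1 (by norm_num : (1 : ℝ) < 2)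
  refine ⟨j, ?_, ?_⟩
  · rw [div_lt_iff₀ ha, pow_succ] at hj2
    rw [div_le_iff₀ (by positivity)]
    linarith
  · rw [le_div_iff₀ ha] at hj1
    rw [le_div_iff₀ (by positivity)]
    linarith

theorem NormData.exists_card_plane_le (D : NormData 2 d k F K M) (hk : 1 ≤ k) (hd : 2 ≤ d) :
    ∃ δ : ℝ, 0 < δ ∧ ∃ R₀ : ℝ, 1 ≤ R₀ ∧ ∃ C : ℝ, 1 ≤ C ∧ ∀ R : ℝ, R₀ ≤ R →
      ∀ B W : ℝ, 0 < B → 1 ≤ W → ∀ T : Finset (Fin 2 → ℤ),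
        (∀ x ∈ T, (∀ i, |(x i : ℝ)| ≤ B) ∧ x ≠ 0 ∧
          (∀ (m : ℤ) (w : Fin 2 → ℤ), x = m • w → |(m : ℝ)| ≤ W) ∧
          ∃ 𝔠 𝔭 : Ideal (NumberField.RingOfIntegers K), ∃ u s : ℕ,
            Ideal.span {D.lin x} = 𝔠 * 𝔭 ^ k ∧ Ideal.absNorm 𝔠 = u * s ∧ (u : ℝ) ≤ W ∧
            Squarefree s ∧ (Ideal.absNorm 𝔠 : ℝ) ≤ B ^ 2 / R) →
        (T.card : ℝ) ≤ C * W * B ^ 2 * R ^ (-δ) := by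
  classical
  obtain ⟨δ, hδ, R₀, hR₀, C, hC, hscale⟩ := D.exists_card_scale_le hk hd
  obtain ⟨r, hr⟩ : ∃ r : ℝ, r = 2 ^ (-δ) := ⟨_, rfl⟩
  have hr0 : 0 < r := by rw [hr]; positivity
  have hr1 : r < 1 := by
    rw [hr]; exact Real.rpow_lt_one_of_one_lt_of_neg (by norm_num) (by linarith)
  have hinv : 1 ≤ (1 - r)⁻¹ := (one_le_inv₀ (by linarith)).2 (by linarith)
  refine ⟨δ, hδ, R₀, hR₀, C * (1 - r)⁻¹, by nlinarith, ?_⟩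
  intro R hR B W hB hW T hT
  have hR0 : 0 < R := by linarith
  have hj : ∀ x ∈ T, ∃ j : ℕ, ∃ 𝔠 𝔭 : Ideal (NumberField.RingOfIntegers K), ∃ u s : ℕ,
      Ideal.span {D.lin x} = 𝔠 * 𝔭 ^ k ∧ Ideal.absNorm 𝔠 = u * s ∧ (u : ℝ) ≤ W ∧
      Squarefree s ∧ B ^ 2 / (2 * (R * 2 ^ j)) ≤ Ideal.absNorm 𝔠 ∧
      (Ideal.absNorm 𝔠 : ℝ) ≤ B ^ 2 / (R * 2 ^ j) := by
    intro x hx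
    obtain ⟨-, hx0, -, 𝔠, 𝔭, u, s, h1, h2, h3, h4, h5⟩ := hT x hx
    have hne : Ideal.absNorm 𝔠 ≠ 0 := fun h => by
      rw [Ideal.absNorm_eq_zero_iff] at h
      rw [h, Ideal.bot_mul, Ideal.span_singleton_eq_bot] at h1
      exact hx0 (D.lin_injective (by rw [h1, map_zero]))
    obtain ⟨j, hj1, hj2⟩ := exists_dyadic_bracket
      (by exact_mod_cast Nat.pos_of_ne_zero hne : (0 : ℝ) < Ideal.absNorm 𝔠) h5
    refine ⟨j, 𝔠, 𝔭, u, s, h1, h2, h3, h4, ?_, ?_⟩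
    · convert hj1 using 1; field_simp
    · convert hj2 using 1; field_simp
  choose! f hf using hj
  have hfiber : ∀ j ∈ T.image f, ((T.filter fun x => f x = j).card : ℝ) ≤
      C * W * B ^ 2 * R ^ (-δ) * r ^ j := by
    intro j _
    have hRj : R ≤ R * 2 ^ j := le_mul_of_one_le_right hR0.le (one_le_pow₀ (by norm_num))
    have := hscale (R * 2 ^ j) (hR.trans hRj) B W hB hW (T.filter fun x => f x = j) fun x hx => by
      obtain ⟨hxT, rfl⟩ := Finset.mem_filter.1 hx
      exact ⟨(hT x hxT).1, (hT x hxT).2.1, (hT x hxT).2.2.1, hf x hxT⟩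
    calc _ ≤ _ := this
      _ = _ := by
        have hpow : ((2 : ℝ) ^ j) ^ (-δ) = r ^ j := by
          rw [hr]; exact Real.rpow_pow_comm (by norm_num) _ _ |>.symm
        rw [Real.mul_rpow hR0.le (by positivity), hpow]
        ring
  have hcard := Finset.card_eq_sum_card_fiberwise (s := T) (t := T.image f) (f := f)
    fun x hx => Finset.mem_image_of_mem f hx
  calc (T.card : ℝ) = ∑ j ∈ T.image f, ((T.filter fun x => f x = j).card : ℝ) := by
        rw [hcard]; push_cast; rfl
    _ ≤ ∑ j ∈ T.image f, C * W * B ^ 2 * R ^ (-δ) * r ^ j := Finset.sum_le_sum hfiber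
    _ = C * W * B ^ 2 * R ^ (-δ) * ∑ j ∈ T.image f, r ^ j := by rw [Finset.mul_sum]
    _ ≤ C * W * B ^ 2 * R ^ (-δ) * (1 - r)⁻¹ := by
        gcongr
        rw [← tsum_geometric_of_lt_one hr0.le hr1]
        exact (summable_geometric_of_lt_one hr0.le hr1).sum_le_tsum _ fun j _ => by positivity
    _ = _ := by ring

end

theorem Nat.le_four_pow_of_smooth {m k : ℕ} {ξ : ℝ} (hm : m ≠ 0)
    (h : ∀ p : ℕ, p.Prime → p ∣ m → (p : ℝ) ≤ ξ ∧ ¬ p ^ k ∣ m) :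
    m ≤ 4 ^ ((k - 1) * ⌊ξ⌋₊) := by
  have hsub : m.primeFactors ⊆ (Finset.range (⌊ξ⌋₊ + 1)).filter Nat.Prime := fun p hp => by
    have hp' := Nat.prime_of_mem_primeFactors hp
    have := Nat.le_floor (h p hp' (Nat.dvd_of_mem_primeFactors hp)).1
    simp only [Finset.mem_filter, Finset.mem_range]
    exact ⟨by omega, hp'⟩
  calc m = ∏ p ∈ m.primeFactors, p ^ m.factorization p :=
        (Nat.prod_factorization_pow_eq_self hm).symm
    _ ≤ ∏ p ∈ m.primeFactors, p ^ (k - 1) := by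
        refine Finset.prod_le_prod' fun p hp => ?_
        have hp' := Nat.prime_of_mem_primeFactors hp
        refine Nat.pow_le_pow_right hp'.pos ?_
        have h1 := (h p hp' (Nat.dvd_of_mem_primeFactors hp)).2
        rw [hp'.pow_dvd_iff_le_factorization hm] at h1
        omega
    _ = (∏ p ∈ m.primeFactors, p) ^ (k - 1) := Finset.prod_pow _ _ _
    _ ≤ (primorial ⌊ξ⌋₊) ^ (k - 1) := by
        refine Nat.pow_le_pow_left ?_ _
        refine Finset.prod_le_prod_of_subset_of_one_le' hsub fun p hp _ => ?_
        exact (Finset.mem_filter.1 hp).2.one_lt.le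
    _ ≤ (4 ^ ⌊ξ⌋₊) ^ (k - 1) := Nat.pow_le_pow_left (primorial_le_four_pow _) _
    _ = 4 ^ ((k - 1) * ⌊ξ⌋₊) := by rw [← pow_mul, mul_comm]

theorem Nat.exists_eq_smooth_mul_rough (u : ℕ) (hu : u ≠ 0) (ξ : ℝ) :
    ∃ u₁ s : ℕ, u = u₁ * s ∧ (∀ p : ℕ, p.Prime → p ∣ u₁ → (p : ℝ) ≤ ξ) ∧
      ∀ p : ℕ, p.Prime → p ∣ s → ξ < p := by
  induction u using induction_on_primes with
  | zero => exact absurd rfl hu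
  | one =>
    exact ⟨1, 1, rfl, fun p hp h => absurd (Nat.dvd_one.1 h) hp.ne_one,
      fun p hp h => absurd (Nat.dvd_one.1 h) hp.ne_one⟩
  | prime_mul p a hp ih =>
    obtain ⟨u₁, s, rfl, h1, h2⟩ := ih (right_ne_zero_of_mul hu)
    by_cases hpξ : (p : ℝ) ≤ ξ
    · refine ⟨p * u₁, s, by ring, fun q hq hdvd => ?_, h2⟩
      rcases hq.dvd_mul.1 hdvd with h | h
      · rwa [(Nat.prime_dvd_prime_iff_eq hq hp).1 h]
      · exact h1 q hq h
    · refine ⟨u₁, p * s, by ring, h1, fun q hq hdvd => ?_⟩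
      rcases hq.dvd_mul.1 hdvd with h | h
      · rw [(Nat.prime_dvd_prime_iff_eq hq hp).1 h]; exact not_le.1 hpξ
      · exact h2 q hq h

section
variable {n d k : ℕ} {F : MvPolynomial (Fin n) ℤ} {K M : Type} [Field K] [NumberField K]
    [Field M] [NumberField M]

theorem NormData.eval_zsmul (D : NormData n d k F K M) (m : ℤ) (w : Fin n → ℤ) :
    eval (m • w) F = m ^ d * eval w F := by
  have h : D.lin (m • w) = algebraMap ℤ (NumberField.RingOfIntegers K) m * D.lin w := by
    rw [map_zsmul, zsmul_eq_mul]; rfl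
  have h1 := D.norm_lin (m • w)
  rw [h, map_mul, Algebra.norm_algebraMap, NumberField.RingOfIntegers.rank, D.finrank_eq,
    D.norm_lin] at h1
  refine mul_left_cancel₀ D.c_ne ?_
  rw [← h1]; ring

theorem NormData.eval_ne_zero (D : NormData n d k F K M) {x : Fin n → ℤ} (hx : x ≠ 0) :
    eval x F ≠ 0 := by
  intro h
  have h1 := D.norm_lin x
  rw [h, mul_zero, Algebra.norm_eq_zero_iff] at h1
  exact hx (D.lin_injective (by rw [h1, map_zero]))

theorem NormData.abs_le_of_eq_zsmul (D : NormData n d k F K M) (hd : 2 ≤ d) {B ξ ξ₂ : ℝ}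
    (hBξ : B ≤ ξ₂) {x : Fin n → ℤ} (hx : x ≠ 0) (hbox : ∀ i, |(x i : ℝ)| ≤ B)
    (hsq : ∀ p : ℕ, p.Prime → ξ < p → (p : ℝ) ≤ ξ₂ → ¬ (p : ℤ) ^ 2 ∣ eval x F)
    (hpow : ∀ p : ℕ, p.Prime → (p : ℤ) ^ k ∣ eval x F → ξ < p) (m : ℤ) (w : Fin n → ℤ)
    (hm : x = m • w) : |(m : ℝ)| ≤ 4 ^ ((k - 1) * ⌊ξ⌋₊) := by
  have hF : eval x F = m ^ d * eval w F := by rw [hm, D.eval_zsmul]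
  have hm0 : m ≠ 0 := by
    rintro rfl; exact hx (by rw [hm, zero_smul])
  have hmB : (m.natAbs : ℝ) ≤ B := by
    obtain ⟨i, hi⟩ : ∃ i, x i ≠ 0 := by
      by_contra! h; exact hx (funext h)
    have h1 : |m| ≤ |x i| := Int.le_of_dvd (abs_pos.2 hi) (by
      rw [abs_dvd_abs, hm]; exact ⟨w i, by simp⟩)
    have h2 : ((|m| : ℤ) : ℝ) ≤ ((|x i| : ℤ) : ℝ) := by exact_mod_cast h1
    rw [Nat.cast_natAbs]
    push_cast at h2 ⊢
    exact h2.trans (hbox i)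
  have key := Nat.le_four_pow_of_smooth (m := m.natAbs) (k := k) (ξ := ξ)
    (Int.natAbs_ne_zero.2 hm0) fun p hp hpm => by
      have hpm' : (p : ℤ) ∣ m := Int.natCast_dvd.2 hpm
      have hpξ : (p : ℝ) ≤ ξ := by
        by_contra! h
        refine hsq p hp h ?_ ?_
        · have : (p : ℝ) ≤ m.natAbs := by
            exact_mod_cast Nat.le_of_dvd (Int.natAbs_pos.2 hm0) hpm
          linarith
        · rw [hF]
          exact ((pow_dvd_pow_of_dvd hpm' 2).trans (pow_dvd_pow m hd)).mul_right _
      refine ⟨hpξ, fun h => ?_⟩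
      have h1 : (p : ℤ) ^ k ∣ m := by
        have := Int.natCast_dvd.2 h
        push_cast at this; exact this
      have := hpow p hp (by rw [hF]; exact (h1.trans (dvd_pow_self m (by omega))).mul_right _)
      linarith
  have h3 : (m.natAbs : ℝ) ≤ 4 ^ ((k - 1) * ⌊ξ⌋₊) := by exact_mod_cast key
  rw [Nat.cast_natAbs] at h3
  push_cast at h3
  exact h3

end

section
variable {n d k : ℕ} {F : MvPolynomial (Fin n) ℤ} {K M : Type} [Field K] [NumberField K]
    [Field M] [NumberField M]

theorem pow_le_xi2 {B : ℝ} (hB : 1 ≤ B) (hlog : 1 ≤ Real.log B) (n : ℕ) : B ^ n ≤ xi2 n B :=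
  le_mul_of_one_le_right (by positivity) (Real.one_le_rpow hlog (by norm_num))

theorem NormData.exists_cofactor_le (D : NormData n d k F K M) (hk : 2 ≤ k)
    (hkd : d ≤ n * k + 2) :
    ∃ A : ℝ, 1 ≤ A ∧ ∀ B : ℝ, 1 ≤ B → 1 ≤ Real.log B →
      ∀ x : Fin n → ℤ, (∀ i, |(x i : ℝ)| ≤ B) → ∀ q u : ℕ, xi2 n B < q →
        (eval x F).natAbs = u * q ^ k →
        ((D.c.natAbs * u : ℕ) : ℝ) ≤ B ^ 2 / (Real.log B ^ ((4 : ℝ) / 3) / A) := by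
  obtain ⟨C, hC, hnorm⟩ := D.absNorm_span_lin_le
  refine ⟨C ^ d, one_le_pow₀ hC, fun B hB hlog x hx q u hq hu => ?_⟩
  have h1 := hnorm B x hx (by linarith)
  rw [D.norm_lin] at h1
  have h2 : |((D.c * eval x F : ℤ) : ℝ)| = ((D.c.natAbs * u : ℕ) : ℝ) * (q : ℝ) ^ k := by
    rw [← Int.cast_abs, Int.abs_eq_natAbs, Int.natAbs_mul, hu, Int.cast_natCast, ← mul_assoc,
      Nat.cast_mul _ (q ^ k), Nat.cast_pow]
  rw [h2, mul_pow] at h1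
  have hlog0 : 0 < Real.log B := by linarith
  have h3 : B ^ (n * k) * Real.log B ^ ((4 : ℝ) / 3) ≤ (q : ℝ) ^ k := by
    calc _ ≤ (B ^ n) ^ k * (Real.log B ^ ((2 : ℝ) / 3)) ^ k := by
          rw [← pow_mul]
          gcongr
          calc Real.log B ^ ((4 : ℝ) / 3) = (Real.log B ^ ((2 : ℝ) / 3)) ^ 2 := by
                rw [← Real.rpow_natCast, ← Real.rpow_mul hlog0.le]; norm_num
            _ ≤ _ := pow_le_pow_right₀ (Real.one_le_rpow hlog (by norm_num)) hk
      _ = (xi2 n B) ^ k := by rw [xi2, mul_pow]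
      _ ≤ _ := by
          refine pow_le_pow_left₀ ?_ hq.le k
          unfold xi2; positivity
  have h4 : ((D.c.natAbs * u : ℕ) : ℝ) * (B ^ (n * k) * Real.log B ^ ((4 : ℝ) / 3)) ≤
      C ^ d * (B ^ (n * k) * B ^ 2) := by
    calc _ ≤ ((D.c.natAbs * u : ℕ) : ℝ) * (q : ℝ) ^ k := by gcongr
      _ ≤ C ^ d * B ^ d := h1
      _ ≤ _ := by
          rw [← pow_add]
          gcongr
  rw [le_div_iff₀ (by positivity)]
  have h5 : 0 < B ^ (n * k) := by positivity
  have h6 : ((D.c.natAbs * u : ℕ) : ℝ) * Real.log B ^ ((4 : ℝ) / 3) ≤ C ^ d * B ^ 2 := by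
    refine le_of_mul_le_mul_left ?_ h5
    linarith
  rw [← mul_div_assoc, div_le_iff₀ (by positivity)]
  linarith

theorem NormData.exists_dichotomy (D : NormData n d k F K M) (hn : 2 ≤ n) (hd : 2 ≤ d) (hk : 2 ≤ k)
    (hkd : d ≤ n * k + 2) (𝔔 : ℕ → Ideal (NumberField.RingOfIntegers M))
    (h𝔔 : ∀ q : ℕ, q.Prime → (𝔔 q).IsPrime ∧ (q : NumberField.RingOfIntegers M) ∈ 𝔔 q) :
    ∃ A : ℝ, 1 ≤ A ∧ ∃ B₀ : ℝ, 1 ≤ B₀ ∧ ∀ B : ℝ, B₀ ≤ B → 1 ≤ Real.log B ∧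
      ∀ ξ : ℝ, ∀ x : Fin n → ℤ, x ≠ 0 → (∀ i, |(x i : ℝ)| ≤ B) →
        (∃ p : ℕ, p.Prime ∧ xi2 n B < p ∧ (p : ℤ) ^ k ∣ eval x F) →
        (∀ p : ℕ, p.Prime → ξ < p → (p : ℝ) ≤ xi2 n B → ¬ (p : ℤ) ^ 2 ∣ eval x F) →
        (∀ p : ℕ, p.Prime → (p : ℤ) ^ k ∣ eval x F → ξ < p) →
        (∃ q : ℕ, q.Prime ∧ B ^ n < q ∧ ∃ j j', j ≠ j' ∧ D.σ j (D.lin x) ∈ 𝔔 q ∧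
          D.σ j' (D.lin x) ∈ 𝔔 q) ∨
        ((∀ (m : ℤ) (w : Fin n → ℤ), x = m • w → |(m : ℝ)| ≤ 4 ^ ((k - 1) * ⌊ξ⌋₊)) ∧
          ∃ 𝔠 𝔭 : Ideal (NumberField.RingOfIntegers K), ∃ u s : ℕ,
            Ideal.span {D.lin x} = 𝔠 * 𝔭 ^ k ∧ Ideal.absNorm 𝔠 = u * s ∧
            (u : ℝ) ≤ D.c.natAbs * 4 ^ ((k - 1) * ⌊ξ⌋₊) ∧ Squarefree s ∧
            (Ideal.absNorm 𝔠 : ℝ) ≤ B ^ 2 / (Real.log B ^ ((4 : ℝ) / 3) / A)) := by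
  obtain ⟨A, hA, hcof⟩ := D.exists_cofactor_le hk hkd
  refine ⟨A, hA, Real.exp A + D.c.natAbs, ?_, fun B hB => ?_⟩
  · have := Real.add_one_le_exp A
    have : (0 : ℝ) ≤ D.c.natAbs := by positivity
    linarith
  have hc0 : (0 : ℝ) ≤ D.c.natAbs := by positivity
  have hexp := Real.add_one_le_exp A
  have hB1 : 1 ≤ B := by linarith
  have hB0 : 0 < B := by linarith
  have hlogA : A ≤ Real.log B := by
    rw [Real.le_log_iff_exp_le hB0]; linarith
  have hlog : 1 ≤ Real.log B := hA.trans hlogA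
  refine ⟨hlog, fun ξ x hx hbox hq hsq hpow => ?_⟩
  have hBn : B ^ n ≤ xi2 n B := pow_le_xi2 hB1 hlog n
  have hB2 : B ^ 2 ≤ xi2 n B := (pow_le_pow_right₀ hB1 hn).trans hBn
  have hBx : B ≤ xi2 n B := (le_self_pow₀ hB1 (by norm_num)).trans hB2
  obtain ⟨q, hqp, hqξ, hqF⟩ := hq
  by_cases hbad : ∃ q : ℕ, q.Prime ∧ B ^ n < q ∧ ∃ j j', j ≠ j' ∧ D.σ j (D.lin x) ∈ 𝔔 q ∧
          D.σ j' (D.lin x) ∈ 𝔔 q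
  · exact Or.inl hbad
  refine Or.inr ⟨D.abs_le_of_eq_zsmul hd hBx hx hbox hsq hpow, ?_⟩
  have hF0 := D.eval_ne_zero hx
  obtain ⟨u, hu⟩ : q ^ k ∣ (eval x F).natAbs := by
    rw [← Int.natCast_dvd]; push_cast; exact hqF
  rw [mul_comm] at hu
  have hu0 : u ≠ 0 := by
    rintro rfl
    rw [zero_mul, Int.natAbs_eq_zero] at hu
    exact hF0 hu
  have hcu := hcof B hB1 hlog x hbox q u hqξ hu
  have hc1 : 1 ≤ D.c.natAbs := Int.natAbs_pos.2 D.c_ne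
  have hden : 1 ≤ Real.log B ^ ((4 : ℝ) / 3) / A := by
    rw [le_div_iff₀ (by linarith), one_mul]
    calc A ≤ Real.log B := hlogA
      _ = Real.log B ^ (1 : ℝ) := (Real.rpow_one _).symm
      _ ≤ _ := Real.rpow_le_rpow_of_exponent_le hlog (by norm_num)
  have huξ : (u : ℝ) ≤ xi2 n B := by
    have h1 : (u : ℝ) ≤ ((D.c.natAbs * u : ℕ) : ℝ) := by
      exact_mod_cast Nat.le_mul_of_pos_left u hc1
    have h2 : B ^ 2 / (Real.log B ^ ((4 : ℝ) / 3) / A) ≤ B ^ 2 := div_le_self (by positivity) hden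
    linarith
  have huq : u < q := by exact_mod_cast huξ.trans_lt hqξ
  have hqu : ¬ q ∣ u := fun h => by
    have := Nat.le_of_dvd (Nat.pos_of_ne_zero hu0) h
    omega
  have hqc : ¬ (q : ℤ) ∣ D.c := fun h => by
    have h1 := Nat.le_of_dvd hc1 (Int.natCast_dvd.1 h)
    have h2 : (q : ℝ) ≤ D.c.natAbs := by exact_mod_cast h1
    linarith
  obtain ⟨𝔠, 𝔭, hspan, hN⟩ := D.exists_ideal_factor (𝔔 q) hqp (h𝔔 q hqp).1 (h𝔔 q hqp).2
    (by omega) hu hqu hqc fun j j' hjj' h1 h2 =>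
      hbad ⟨q, hqp, hBn.trans_lt hqξ, j, j', hjj', h1, h2⟩
  obtain ⟨u₁, s, hus, hsmooth, hrough⟩ := Nat.exists_eq_smooth_mul_rough u hu0 ξ
  have hdvd : ∀ t : ℕ, t ∣ u → (t : ℤ) ∣ eval x F := fun t ht => by
    rw [Int.natCast_dvd, hu]; exact ht.mul_right _
  refine ⟨𝔠, 𝔭, D.c.natAbs * u₁, s, hspan, by rw [hN, hus, mul_assoc], ?_, ?_, by rw [hN]; exact hcu⟩
  · have hu₁ : u₁ ≠ 0 := by rintro rfl; exact hu0 (by rw [hus, zero_mul])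
    have h1 := Nat.le_four_pow_of_smooth (k := k) hu₁ fun p hp hpu =>
      ⟨hsmooth p hp hpu, fun h => by
        have := hpow p hp (by
          have := hdvd (p ^ k) (h.trans ⟨s, hus⟩)
          push_cast at this; exact this)
        have := hsmooth p hp hpu
        linarith⟩
    have h2 : (u₁ : ℝ) ≤ 4 ^ ((k - 1) * ⌊ξ⌋₊) := by exact_mod_cast h1
    rw [Nat.cast_mul]
    gcongr
  · rw [Nat.squarefree_iff_prime_squarefree]
    intro p hp hps
    have hsu : s ∣ u := ⟨u₁, by rw [hus, mul_comm]⟩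
    have hpu : p ∣ u := ((dvd_mul_right p p).trans hps).trans hsu
    refine hsq p hp (hrough p hp ((dvd_mul_right p p).trans hps)) ?_ ?_
    · have : (p : ℝ) ≤ u := by exact_mod_cast Nat.le_of_dvd (Nat.pos_of_ne_zero hu0) hpu
      linarith
    · have := hdvd (p * p) (hps.trans hsu)
      push_cast at this
      rwa [sq]

end

section
variable {n d k : ℕ} {F : MvPolynomial (Fin n) ℤ} {K M : Type} [Field K] [NumberField K]
    [Field M] [NumberField M]

theorem NormData.exists_card_factor_le (D : NormData n d k F K M) (hn : 2 ≤ n) (hd : 2 ≤ d)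
    (hk : 1 ≤ k) (A : ℝ) (hA : 1 ≤ A) :
    ∃ δ : ℝ, 0 < δ ∧ ∃ C : ℝ, 1 ≤ C ∧ ∃ B₀ : ℝ, 1 ≤ B₀ ∧ ∀ B : ℝ, B₀ ≤ B → ∀ W : ℝ, 1 ≤ W →
      ∀ T : Finset (Fin n → ℤ),
        (∀ x ∈ T, (∀ i, |(x i : ℝ)| ≤ B) ∧ x ≠ 0 ∧
          (∀ (m : ℤ) (w : Fin n → ℤ), x = m • w → |(m : ℝ)| ≤ W) ∧
          ∃ 𝔠 𝔭 : Ideal (NumberField.RingOfIntegers K), ∃ u s : ℕ,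
            Ideal.span {D.lin x} = 𝔠 * 𝔭 ^ k ∧ Ideal.absNorm 𝔠 = u * s ∧
            (u : ℝ) ≤ D.c.natAbs * W ∧ Squarefree s ∧
            (Ideal.absNorm 𝔠 : ℝ) ≤ B ^ 2 / (Real.log B ^ ((4 : ℝ) / 3) / A)) →
        (T.card : ℝ) ≤ C * W * B ^ n * Real.log B ^ (-δ) := by
  have hA0 : 0 < A := by linarith
  rcases hn.eq_or_lt with rfl | hn
  · obtain ⟨δ, hδ, R₀, hR₀, C, hC, hcard⟩ := D.exists_card_plane_le hk hd
    have hc1 : (1 : ℝ) ≤ D.c.natAbs := by exact_mod_cast Int.natAbs_pos.2 D.c_ne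
    refine ⟨4 / 3 * δ, by positivity, C * D.c.natAbs * A ^ δ, ?_, Real.exp (A * R₀), ?_, ?_⟩
    · have h1 : 1 ≤ A ^ δ := Real.one_le_rpow hA hδ.le
      have h2 : 1 ≤ C * D.c.natAbs := by nlinarith
      nlinarith
    · exact Real.one_le_exp (by positivity)
    intro B hB W hW T hT
    have hB0 : 0 < B := (Real.exp_pos _).trans_le hB
    have hlogR : A * R₀ ≤ Real.log B := (Real.le_log_iff_exp_le hB0).2 hB
    have hlog : 1 ≤ Real.log B := by nlinarith
    have hlog0 : 0 < Real.log B := by linarith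
    have hR : R₀ ≤ Real.log B ^ ((4 : ℝ) / 3) / A := by
      rw [le_div_iff₀ hA0]
      calc R₀ * A ≤ Real.log B ^ (1 : ℝ) := by rw [Real.rpow_one]; linarith
        _ ≤ _ := Real.rpow_le_rpow_of_exponent_le hlog (by norm_num)
    have hWc : W ≤ D.c.natAbs * W := le_mul_of_one_le_left (by linarith) hc1
    have := hcard _ hR B (D.c.natAbs * W) hB0 (hW.trans hWc) T fun x hx => by
      obtain ⟨h1, h2, h3, h4⟩ := hT x hx
      exact ⟨h1, h2, fun m w h => (h3 m w h).trans hWc, h4⟩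
    calc _ ≤ _ := this
      _ = _ := by
        rw [Real.div_rpow (by positivity) hA0.le, ← Real.rpow_mul hlog0.le, Real.rpow_neg hA0.le δ,
          div_inv_eq_mul, mul_neg]
        ring
  · obtain ⟨δ, hδ, C, hC, B₀, hB₀, hcard⟩ := D.exists_card_le_of_three_le hk hd hn A hA
    refine ⟨δ, hδ, C, hC, max B₀ (Real.exp 1), le_max_of_le_left hB₀, ?_⟩
    intro B hB W hW T hT
    have hB1 : 1 ≤ B := hB₀.trans ((le_max_left _ _).trans hB)
    have hB0 : 0 < B := by linarith
    have hlog : 1 ≤ Real.log B :=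
      (Real.le_log_iff_exp_le hB0).2 ((le_max_right _ _).trans hB)
    have hlog0 : 0 < Real.log B := by linarith
    have := hcard B ((le_max_left _ _).trans hB) T fun x hx => by
      obtain ⟨h1, h2, -, 𝔠, 𝔭, u, s, h3, -, -, -, h4⟩ := hT x hx
      refine ⟨h1, h2, 𝔠, 𝔭, h3, h4.trans ?_⟩
      have h5 : 1 ≤ Real.log B ^ ((4 : ℝ) / 3) := Real.one_le_rpow hlog (by norm_num)
      rw [div_le_iff₀ (by positivity)]
      calc B ^ 2 ≤ B ^ 2 * Real.log B ^ ((4 : ℝ) / 3) := le_mul_of_one_le_right (by positivity) h5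
        _ = _ := by field_simp
    calc (T.card : ℝ) ≤ C * B ^ n * B ^ (-δ) := this
      _ ≤ C * B ^ n * Real.log B ^ (-δ) := by
          refine mul_le_mul_of_nonneg_left ?_ (by positivity)
          exact Real.rpow_le_rpow_of_nonpos hlog0
            (Real.log_le_self hB0.le) (by linarith)
      _ ≤ C * W * B ^ n * Real.log B ^ (-δ) := by
          gcongr
          exact le_mul_of_one_le_right (by linarith) hW

theorem NormData.exists_N3count_le (D : NormData n d k F K M) (hn : 2 ≤ n) (hd : n < d)
    (hk : 2 ≤ k) (hkd : d ≤ n * k + 2) :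
    ∃ δ : ℝ, 0 < δ ∧ ∃ C : ℝ, 0 ≤ C ∧ ∃ B₀ : ℝ, ∀ B : ℝ, B₀ ≤ B → ∀ ξ : ℝ,
      (N3count F k ξ (xi2 n B) B : ℝ) ≤
        C * 4 ^ ((k - 1) * ⌊ξ⌋₊) * B ^ n * Real.log B ^ (-δ) := by
  classical
  have h𝔔 : ∀ q : ℕ, ∃ 𝔮 : Ideal (NumberField.RingOfIntegers M), q.Prime →
      𝔮.IsPrime ∧ (q : NumberField.RingOfIntegers M) ∈ 𝔮 := fun q => by
    by_cases hq : q.Prime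
    · obtain ⟨𝔮, h1, h2, -⟩ := exists_prime_ideal_over (K := M) (𝔠 := ⊥) hq (by simp)
      exact ⟨𝔮, fun _ => ⟨h1, h2⟩⟩
    · exact ⟨⊥, fun h => absurd h hq⟩
  choose 𝔔 h𝔔 using h𝔔
  obtain ⟨C₁, B₁, hC₁, hB₁, hbad⟩ := D.exists_card_bad_le hn 𝔔 h𝔔
  obtain ⟨A, hA, B₂, hB₂, hdich⟩ := D.exists_dichotomy hn (by omega) hk hkd 𝔔 h𝔔
  obtain ⟨δ, hδ, C₃, hC₃, B₃, hB₃, hgood⟩ := D.exists_card_factor_le hn (by omega) (by omega) A hA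
  refine ⟨min δ 1, lt_min hδ one_pos, C₁ + 1 + C₃, by linarith, max B₁ (max B₂ B₃), ?_⟩
  intro B hB ξ
  have hBB₁ : B₁ ≤ B := (le_max_left _ _).trans hB
  have hBB₂ : B₂ ≤ B := ((le_max_left _ _).trans (le_max_right _ _)).trans hB
  have hBB₃ : B₃ ≤ B := ((le_max_right _ _).trans (le_max_right _ _)).trans hB
  have hB1 : 1 ≤ B := hB₁.trans hBB₁
  have hB0 : 0 < B := by linarith
  obtain ⟨hlog, hx⟩ := hdich B hBB₂
  have hlog0 : 0 < Real.log B := by linarith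
  obtain ⟨W, hW⟩ : ∃ W : ℝ, W = 4 ^ ((k - 1) * ⌊ξ⌋₊) := ⟨_, rfl⟩
  have hW1 : 1 ≤ W := by rw [hW]; exact one_le_pow₀ (by norm_num)
  rw [← hW]
  have hfin : {x : Fin n → ℤ | (∀ i, |(x i : ℝ)| ≤ B) ∧
      (∃ p : ℕ, p.Prime ∧ xi2 n B < (p : ℝ) ∧ (p : ℤ) ^ k ∣ eval x F) ∧
      (∀ p : ℕ, p.Prime → ξ < (p : ℝ) → (p : ℝ) ≤ xi2 n B → ¬ ((p : ℤ) ^ 2 ∣ eval x F)) ∧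
      (∀ p : ℕ, p.Prime → (p : ℤ) ^ k ∣ eval x F → ξ < (p : ℝ))}.Finite :=
    (finite_box B).subset fun x h => h.1
  rw [N3count, Set.ncard_eq_toFinset_card _ hfin]
  obtain ⟨T, hT⟩ : ∃ T, T = hfin.toFinset := ⟨_, rfl⟩
  rw [← hT]
  obtain ⟨P, hP⟩ : ∃ P : (Fin n → ℤ) → Prop, P = fun x => ∃ q : ℕ, q.Prime ∧ B ^ n < q ∧
      ∃ j j', j ≠ j' ∧ D.σ j (D.lin x) ∈ 𝔔 q ∧ D.σ j' (D.lin x) ∈ 𝔔 q := ⟨_, rfl⟩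
  have hmem : ∀ x ∈ T, _ := fun x hx => hfin.mem_toFinset.1 (hT ▸ hx)
  have h1 : ((T.filter P).card : ℝ) ≤ C₁ * B ^ (n - 1) := hbad B hBB₁ _ fun x hxT => by
    obtain ⟨h1, h2⟩ := Finset.mem_filter.1 hxT
    rw [hP] at h2
    exact ⟨(hmem x h1).1, h2⟩
  have h2 : ((T.filter fun x => ¬ P x ∧ x ≠ 0).card : ℝ) ≤
      C₃ * W * B ^ n * Real.log B ^ (-δ) := hgood B hBB₃ W hW1 _ fun x hxT => by
    obtain ⟨h1, h2, h3⟩ := Finset.mem_filter.1 hxT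
    obtain ⟨e1, e2, e3, e4⟩ := hmem x h1
    rw [hP] at h2
    obtain ⟨f1, f2⟩ := (hx ξ x h3 e1 e2 e3 e4).resolve_left h2
    rw [← hW] at f1 f2
    exact ⟨e1, h3, f1, f2⟩
  have hsub : T ⊆ T.filter P ∪ (T.filter fun x => ¬ P x ∧ x ≠ 0) ∪ {0} := fun x hx => by
    simp only [Finset.mem_union, Finset.mem_filter, Finset.mem_singleton]
    tauto
  have h3 : (T.card : ℝ) ≤ (T.filter P).card + (T.filter fun x => ¬ P x ∧ x ≠ 0).card + 1 := by
    have e1 := Finset.card_le_card hsub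
    have e2 := Finset.card_union_le (T.filter P ∪ (T.filter fun x => ¬ P x ∧ x ≠ 0)) {0}
    have e3 := Finset.card_union_le (T.filter P) (T.filter fun x => ¬ P x ∧ x ≠ 0)
    rw [Finset.card_singleton] at e2
    exact_mod_cast e1.trans (e2.trans (Nat.add_le_add_right e3 1))
  have h4 : Real.log B ^ (-δ) ≤ Real.log B ^ (-min δ 1) :=
    Real.rpow_le_rpow_of_exponent_le hlog (neg_le_neg (min_le_left _ _))
  have h5 : B ^ (n - 1) ≤ W * B ^ n * Real.log B ^ (-min δ 1) := by
    have e1 : B⁻¹ ≤ Real.log B ^ (-min δ 1) := by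
      calc B⁻¹ ≤ (Real.log B)⁻¹ := inv_anti₀ hlog0 (Real.log_le_self hB0.le)
        _ = Real.log B ^ (-1 : ℝ) := (Real.rpow_neg_one _).symm
        _ ≤ _ := Real.rpow_le_rpow_of_exponent_le hlog (neg_le_neg (min_le_right _ _))
    calc B ^ (n - 1) = 1 * B ^ n * B⁻¹ := by
          obtain ⟨m, rfl⟩ : ∃ m, n = m + 1 := ⟨n - 1, by omega⟩
          rw [Nat.add_sub_cancel, pow_succ]; field_simp
      _ ≤ _ := by gcongr
  have h6 : 1 ≤ B ^ (n - 1) := one_le_pow₀ hB1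
  calc (T.card : ℝ) ≤ C₁ * B ^ (n - 1) + C₃ * W * B ^ n * Real.log B ^ (-δ) + 1 := by linarith
    _ ≤ (C₁ + 1) * B ^ (n - 1) + C₃ * W * B ^ n * Real.log B ^ (-δ) := by linarith
    _ ≤ (C₁ + 1) * (W * B ^ n * Real.log B ^ (-min δ 1)) +
        C₃ * W * B ^ n * Real.log B ^ (-min δ 1) := by gcongr
    _ = _ := by ring

end

theorem four_pow_floor_le {k n : ℕ} (hk : 2 ≤ k) {δ B : ℝ} (hδ : 0 < δ)
    (hB : Real.exp 1 ≤ Real.log B) :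
    (4 : ℝ) ^ ((k - 1) *
      ⌊max 1 (δ * log2 B / (4 * ((n : ℝ) + 1) * ((k : ℝ) - 1) * log3 B))⌋₊) ≤
      4 ^ (k - 1) * Real.log B ^ (δ / 2) := by
  have hlog0 : 0 < Real.log B := (Real.exp_pos 1).trans_le hB
  have hlog1 : 1 ≤ Real.log B := (Real.one_le_exp zero_le_one).trans hB
  have hloglog : 1 ≤ Real.log (Real.log B) := (Real.le_log_iff_exp_le hlog0).2 hB
  have hlog2 : log2 B = Real.log (Real.log B) := by
    rw [log2, log1, log1, max_eq_right hlog1, max_eq_right hloglog]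
  have hlog3 : 1 ≤ log3 B := le_max_left _ _
  obtain ⟨y, hy⟩ : ∃ y, y = δ * log2 B / (4 * ((n : ℝ) + 1) * ((k : ℝ) - 1) * log3 B) := ⟨_, rfl⟩
  rw [← hy]
  have hk1 : (1 : ℝ) ≤ (k : ℝ) - 1 := by
    have : (2 : ℝ) ≤ k := by exact_mod_cast hk
    linarith
  have hkc : ((k - 1 : ℕ) : ℝ) = (k : ℝ) - 1 := by
    rw [Nat.cast_sub (by omega), Nat.cast_one]
  have hnum : 0 ≤ δ * log2 B := by rw [hlog2]; positivity
  have hy0 : 0 ≤ y := by rw [hy]; positivity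
  have hyle : ((k : ℝ) - 1) * y ≤ δ * Real.log (Real.log B) / 4 := by
    have h1 : ((k : ℝ) - 1) * y = δ * log2 B / (4 * ((n : ℝ) + 1) * log3 B) := by
      rw [hy]; field_simp
    rw [h1, ← hlog2]
    refine div_le_div_of_nonneg_left hnum (by norm_num) ?_
    have h2 : (1 : ℝ) ≤ (n : ℝ) + 1 := by linarith [Nat.cast_nonneg (α := ℝ) n]
    nlinarith [mul_le_mul h2 hlog3 zero_le_one (by linarith)]
  have hexp : (((k - 1) * ⌊max 1 y⌋₊ : ℕ) : ℝ) ≤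
      ((k - 1 : ℕ) : ℝ) + δ * Real.log (Real.log B) / 4 := by
    rw [Nat.cast_mul, hkc]
    calc ((k : ℝ) - 1) * (⌊max 1 y⌋₊ : ℝ) ≤ ((k : ℝ) - 1) * (1 + y) := by
          gcongr
          exact (Nat.floor_le (by positivity)).trans (max_le (by linarith) (by linarith))
      _ ≤ _ := by linarith
  have hlog4 : Real.log 4 ≤ 2 := by
    have h1 : Real.log 4 = 2 * Real.log 2 := by
      rw [show (4 : ℝ) = 2 ^ 2 by norm_num, Real.log_pow]; norm_num
    have h2 := Real.log_two_lt_d9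
    linarith
  calc (4 : ℝ) ^ ((k - 1) * ⌊max 1 y⌋₊) = (4 : ℝ) ^ (((k - 1) * ⌊max 1 y⌋₊ : ℕ) : ℝ) :=
        (Real.rpow_natCast _ _).symm
    _ ≤ (4 : ℝ) ^ (((k - 1 : ℕ) : ℝ) + δ * Real.log (Real.log B) / 4) :=
        Real.rpow_le_rpow_of_exponent_le (by norm_num) hexp
    _ = 4 ^ (k - 1) * (4 : ℝ) ^ (δ * Real.log (Real.log B) / 4) := by
        rw [Real.rpow_add (by norm_num), Real.rpow_natCast]
    _ ≤ 4 ^ (k - 1) * Real.log B ^ (δ / 2) := by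
        gcongr
        rw [Real.rpow_def_of_pos (by norm_num), Real.rpow_def_of_pos hlog0]
        refine Real.exp_le_exp.2 ?_
        have : 0 ≤ δ * Real.log (Real.log B) := by positivity
        nlinarith

theorem stmt10 (n d k : ℕ) (hn : 2 ≤ n) (hd : n < d) (hk : 2 ≤ k)
    (F : MvPolynomial (Fin n) ℤ) (L : Fin d → Fin n → ℂ)
    (hF : IsDecomp F L) (hirr : Irreducible (F.map (Int.castRingHom ℚ)))
    (hΔ : discProd L ≠ 0)
    (hkd : ((d : ℝ) - 2) / (n : ℝ) ≤ (k : ℝ)) :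
    ∃ C₄ : ℝ, 0 < C₄ ∧
      Tendsto (fun B : ℝ =>
        (N3count F k (max 1 (C₄ * log2 B / (4 * ((n : ℝ) + 1) * ((k : ℝ) - 1) * log3 B)))
          (xi2 n B) B : ℝ) / B ^ n) atTop (nhds 0) := by
  obtain ⟨K, M, _, _, _, _, ⟨D⟩⟩ := exists_normData hd hk F L hF hirr hΔ
  have hn0 : (0 : ℝ) < n := by exact_mod_cast (by omega : 0 < n)
  have hkd' : d ≤ n * k + 2 := by
    rw [div_le_iff₀ hn0] at hkd
    have : (d : ℝ) ≤ n * k + 2 := by linarith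
    exact_mod_cast this
  obtain ⟨δ, hδ, C, hC, B₀, hcount⟩ := D.exists_N3count_le hn hd hk hkd'
  refine ⟨δ, hδ, ?_⟩
  have hlim : Tendsto (fun B : ℝ => C * 4 ^ (k - 1) * Real.log B ^ (-(δ / 2))) atTop (nhds 0) := by
    simpa using ((tendsto_rpow_neg_atTop (half_pos hδ)).comp
      Real.tendsto_log_atTop).const_mul (C * 4 ^ (k - 1))
  refine tendsto_of_tendsto_of_tendsto_of_le_of_le' tendsto_const_nhds hlim ?_ ?_
  · filter_upwards [eventually_ge_atTop 0] with B hB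
    positivity
  · filter_upwards [eventually_ge_atTop B₀, eventually_gt_atTop 0,
      Real.tendsto_log_atTop.eventually_ge_atTop (Real.exp 1)] with B hB hB0 hlog
    have hlog0 : 0 < Real.log B := (Real.exp_pos 1).trans_le hlog
    rw [div_le_iff₀ (by positivity)]
    calc _ ≤ _ := hcount B hB _
      _ ≤ C * (4 ^ (k - 1) * Real.log B ^ (δ / 2)) * B ^ n * Real.log B ^ (-δ) := by
          gcongr
          exact four_pow_floor_le hk hδ hlog
      _ = C * 4 ^ (k - 1) * (Real.log B ^ (δ / 2) * Real.log B ^ (-δ)) * B ^ n := by ring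
      _ = _ := by
          rw [← Real.rpow_add hlog0]
          congr 3
          ring

end
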